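/- arXiv:2511.14507 — 7 statements merged into one kernel-verified Lean document; each statement's English description precedes it below -/
import Mathlib

section
/- Every finite simple (P₂ ∪ P₄, HVN)-free graph G with ω(G) ≥ 4 satisfies χ(G) ≤ ⌈(4/3)·ω(G)⌉. -/
open SimpleGraph

/-- `P₂ ∪ P₄`: the disjoint union of a path on 2 vertices (vertices 0,1) and a
path on 4 vertices (vertices 2,3,4,5). -/
def P2P4 : SimpleGraph (Fin 6) :=
  SimpleGraph.fromEdgeSet {s(0, 1), s(2, 3), s(3, 4), s(4, 5)}

/-- The HVN: `K₅` minus two edges incident to a common vertex; `{0,1,2,3}` is a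
clique and vertex `4` is adjacent exactly to `0` and `1`. -/
def HVN : SimpleGraph (Fin 5) :=
  SimpleGraph.fromEdgeSet
    {s(0, 1), s(0, 2), s(0, 3), s(1, 2), s(1, 3), s(2, 3), s(4, 0), s(4, 1)}

/-- A graph `G` is `H`-free if it has no induced subgraph isomorphic to `H`,
i.e. there is no graph embedding of `H` into `G`. -/
def IsFree {W V : Type*} (G : SimpleGraph V) (H : SimpleGraph W) : Prop :=
  IsEmpty (H ↪g G)

namespace ForbiddenColoring

variable {V : Type*} {G : SimpleGraph V}

/-- `p, q, r, s` is an induced path. -/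
structure IsPath4 (G : SimpleGraph V) (p q r s : V) : Prop where
  pq : G.Adj p q
  qr : G.Adj q r
  rs : G.Adj r s
  pr : ¬ G.Adj p r
  ps : ¬ G.Adj p s
  qs : ¬ G.Adj q s

/-- Every edge has an end adjacent to a vertex of any given induced path on four vertices. -/
def PathsDominateEdges (G : SimpleGraph V) : Prop :=
  ∀ p q r s a b, IsPath4 G p q r s → G.Adj a b →
    (G.Adj p a ∨ G.Adj q a ∨ G.Adj r a ∨ G.Adj s a) ∨
      (G.Adj p b ∨ G.Adj q b ∨ G.Adj r b ∨ G.Adj s b)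

/-- Relative to a clique of size four, no vertex has two neighbours and two non-neighbours. -/
def NoHVN (G : SimpleGraph V) : Prop :=
  ∀ a b c d x, G.Adj a b → G.Adj a c → G.Adj a d → G.Adj b c → G.Adj b d → G.Adj c d →
    G.Adj x a → G.Adj x b → G.Adj x c ∨ G.Adj x d

lemma pathsDominateEdges_of_isFree (h : IsFree G P2P4) : PathsDominateEdges G := by
  intro p q r s a b hp hab
  by_contra! hn
  obtain ⟨⟨n1, n2, n3, n4⟩, n5, n6, n7, n8⟩ := hn
  obtain ⟨h1, h2, h3, h4, h5, h6⟩ := hp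
  have hadj : ∀ i j : Fin 6, G.Adj (![a, b, p, q, r, s] i) (![a, b, p, q, r, s] j) ↔
      P2P4.Adj i j := by
    intro i j
    fin_cases i <;> fin_cases j <;> simp [P2P4] <;> grind [SimpleGraph.adj_comm, SimpleGraph.irrefl]
  have hinj : Function.Injective ![a, b, p, q, r, s] := by
    intro i j hij
    fin_cases i <;> fin_cases j <;> simp at hij ⊢ <;> subst hij <;>
      grind [SimpleGraph.adj_comm, SimpleGraph.irrefl]
  exact h.false ⟨⟨_, hinj⟩, fun {i j} => hadj i j⟩

lemma noHVN_of_isFree (h : IsFree G HVN) : NoHVN G := by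
  intro a b c d x hab hac had hbc hbd hcd hxa hxb
  by_contra! hn
  obtain ⟨n1, n2⟩ := hn
  have hadj : ∀ i j : Fin 5, G.Adj (![a, b, c, d, x] i) (![a, b, c, d, x] j) ↔ HVN.Adj i j := by
    intro i j
    fin_cases i <;> fin_cases j <;> simp [HVN] <;> grind [SimpleGraph.adj_comm, SimpleGraph.irrefl]
  have hinj : Function.Injective ![a, b, c, d, x] := by
    intro i j hij
    fin_cases i <;> fin_cases j <;> simp at hij ⊢ <;> subst hij <;>
      grind [SimpleGraph.adj_comm, SimpleGraph.irrefl]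
  exact h.false ⟨⟨_, hinj⟩, fun {i j} => hadj i j⟩

/-- The cliques contained in `A` have at most `k` vertices. -/
def CliqueBound (G : SimpleGraph V) (A : Set V) (k : ℕ) : Prop :=
  ∀ K : Finset V, (∀ x ∈ K, x ∈ A) → G.IsClique K → K.card ≤ k

/-- `G` has a proper colouring of `X` with the colours below `d`. -/
def SetColorable (G : SimpleGraph V) (X : Set V) (d : ℕ) : Prop :=
  ∃ c : V → ℕ, (∀ x ∈ X, c x < d) ∧ ∀ x ∈ X, ∀ y ∈ X, G.Adj x y → c x ≠ c y

lemma CliqueBound.mono {A B : Set V} {k l : ℕ} (h : CliqueBound G A k) (hBA : B ⊆ A)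
    (hkl : k ≤ l) : CliqueBound G B l :=
  fun K hK hc => (h K (fun x hx => hBA (hK x hx)) hc).trans hkl

lemma CliqueBound.not_adj_all {A : Set V} {k : ℕ} (h : CliqueBound G A k) {e : Fin k → V}
    (heA : ∀ i, e i ∈ A) (he : ∀ i j, i ≠ j → G.Adj (e i) (e j)) {x : V} (hx : x ∈ A) :
    ∃ m, ¬ G.Adj x (e m) := by
  classical
  by_contra! hn
  have hinj : Function.Injective e := fun i j hij => by
    by_contra hne
    exact G.irrefl (hij ▸ he i j hne)
  have hxe : x ∉ Finset.univ.image e := by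
    simp only [Finset.mem_image, Finset.mem_univ, true_and, not_exists]
    intro i hi
    exact G.irrefl (hi ▸ hn i)
  have := h (insert x (Finset.univ.image e)) (by
      intro y hy
      simp only [Finset.mem_insert, Finset.mem_image, Finset.mem_univ, true_and] at hy
      rcases hy with rfl | ⟨i, rfl⟩
      exacts [hx, heA i]) (by
      intro y hy z hz hyz
      simp only [Finset.coe_insert, Finset.coe_image, Finset.coe_univ, Set.image_univ,
        Set.mem_insert_iff, Set.mem_range] at hy hz
      rcases hy with rfl | ⟨i, rfl⟩ <;> rcases hz with rfl | ⟨j, rfl⟩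
      · exact absurd rfl hyz
      · exact hn j
      · exact (hn i).symm
      · exact he i j (fun hij => hyz (by rw [hij])))
  rw [Finset.card_insert_of_notMem hxe, Finset.card_image_of_injective _ hinj] at this
  simp at this

/-- Induced subgraphs without an induced path on four vertices are coloured optimally. -/
lemma setColorable_of_forall_not_isPath4 [Finite V] {X : Set V} {d : ℕ}
    (hP : ∀ p ∈ X, ∀ q ∈ X, ∀ r ∈ X, ∀ s ∈ X, ¬ IsPath4 G p q r s)
    (hcl : CliqueBound G X d) : SetColorable G X d := by
  classical
  have := Fintype.ofFinite V
  let T : Set (V → ℕ) := {c | ∀ x ∈ X, ∀ y ∈ X, G.Adj x y → c x ≠ c y}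
  have hT : T.Nonempty := ⟨fun v => (Fintype.equivFin V v : ℕ), fun x _ y _ hxy he =>
    G.ne_of_adj hxy ((Fintype.equivFin V).injective (Fin.ext he))⟩
  obtain ⟨c, hc, hmin⟩ := WellFounded.has_min
    (measure fun c : V → ℕ => ∑ v, c v).wf T hT
  have greedy : ∀ x ∈ X, ∀ i < c x, ∃ w ∈ X, G.Adj x w ∧ c w = i := by
    intro x hx i hi
    by_contra! hn
    refine hmin (Function.update c x i) ?_ ?_
    · intro y hy z hz hyz
      by_cases hyx : y = x <;> by_cases hzx : z = x
      · subst hyx; subst hzx; exact absurd hyz G.irrefl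
      · subst hyx
        simpa [Function.update_of_ne hzx] using (hn z hz hyz).symm
      · subst hzx
        simpa [Function.update_of_ne hyx] using hn y hy hyz.symm
      · simpa [Function.update_of_ne hyx, Function.update_of_ne hzx] using hc y hy z hz hyz
    · change ∑ v, Function.update c x i v < ∑ v, c v
      refine Finset.sum_lt_sum (fun v _ => ?_) ⟨x, Finset.mem_univ _, by simpa using hi⟩
      by_cases hv : v = x
      · subst hv; simpa using hi.le
      · simp [Function.update_of_ne hv]
  refine ⟨c, fun v hv => ?_, hc⟩
  have key : ∀ m ≤ c v, ∃ K : Finset V, (∀ x ∈ K, x ∈ X) ∧ G.IsClique K ∧ K.card = m + 1 ∧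
      ∀ x ∈ K, c v - m ≤ c x := by
    intro m
    induction m with
    | zero => exact fun _ => ⟨{v}, by simpa using hv, by simp, by simp, by simp⟩
    | succ m ih =>
      intro hm
      obtain ⟨K, hKX, hK, hcard, hcol⟩ := ih (by omega)
      set i := c v - (m + 1) with hi
      have hlt : ∀ x ∈ K, i < c x := fun x hx => by have := hcol x hx; omega
      obtain ⟨k0, hk0⟩ : K.Nonempty := Finset.card_pos.mp (by omega)
      obtain ⟨w0, hw0, -, hw0i⟩ := greedy k0 (hKX _ hk0) i (hlt _ hk0)
      obtain ⟨u, hu, humax⟩ := Finset.exists_max_image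
        (Finset.univ.filter fun w => w ∈ X ∧ c w = i)
        (fun w => (K.filter fun q => G.Adj w q).card) ⟨w0, by simp [hw0, hw0i]⟩
      simp only [Finset.mem_filter, Finset.mem_univ, true_and] at hu humax
      have hall : ∀ q ∈ K, G.Adj u q := by
        intro q hq
        by_contra huq
        obtain ⟨w, hw, hqw, hwi⟩ := greedy q (hKX _ hq) i (hlt _ hq)
        have hle := humax w ⟨hw, hwi⟩
        obtain ⟨q', hq', hq'2⟩ : ∃ q' ∈ K.filter fun q => G.Adj u q,
            q' ∉ K.filter fun q => G.Adj w q := by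
          by_contra! hsub
          have hlt' : (K.filter fun q => G.Adj u q).card < (K.filter fun q => G.Adj w q).card :=
            Finset.card_lt_card ⟨hsub, fun hsup => huq (Finset.mem_filter.mp
              (hsup (Finset.mem_filter.mpr ⟨hq, hqw.symm⟩))).2⟩
          omega
        simp only [Finset.mem_filter, not_and] at hq' hq'2
        have hne : q' ≠ q := fun h => huq (h ▸ hq'.2)
        exact hP u hu.1 q' (hKX _ hq'.1) q (hKX _ hq) w hw
          ⟨hq'.2, hK hq'.1 hq hne, hqw, huq,
            fun h => hc u hu.1 w hw h (hu.2.trans hwi.symm), fun h => hq'2 hq'.1 h.symm⟩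
      have huK : u ∉ K := fun h => G.irrefl (hall u h)
      refine ⟨insert u K, ?_, ?_, ?_, ?_⟩
      · simpa using ⟨hu.1, hKX⟩
      · rw [Finset.coe_insert, SimpleGraph.isClique_insert]
        exact ⟨hK, fun b hb _ => hall b hb⟩
      · rw [Finset.card_insert_of_notMem huK, hcard]
      · intro x hx
        rcases Finset.mem_insert.mp hx with rfl | hx
        · omega
        · have := hlt x hx; omega
  obtain ⟨K, hKX, hK, hcard, -⟩ := key (c v) le_rfl
  have := hcl K hKX hK
  omega

/-- A complete multipartite induced subgraph of `A` such that every other vertex of `A` has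
neighbours in at most one of its parts. -/
structure Block (G : SimpleGraph V) (A : Set V) {k : ℕ} (S : Fin k → Set V) : Prop where
  subset : ∀ i, ∀ u ∈ S i, u ∈ A
  nonempty : ∀ i, ∃ u, u ∈ S i
  adj_iff : ∀ i j u v, u ∈ S i → v ∈ S j → (G.Adj u v ↔ i ≠ j)
  unique : ∀ x ∈ A, (∀ i, x ∉ S i) → ∀ i j u v, u ∈ S i → v ∈ S j → G.Adj x u → G.Adj x v → i = j

lemma exists_ne_three {n : ℕ} (hn : 4 ≤ n) (a b c : Fin n) : ∃ d, d ≠ a ∧ d ≠ b ∧ d ≠ c := by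
  by_contra! h
  have : (Finset.univ : Finset (Fin n)) ⊆ {a, b, c} := fun d _ => by
    simp only [Finset.mem_insert, Finset.mem_singleton]
    by_cases h1 : d = a
    · exact .inl h1
    · by_cases h2 : d = b
      · exact .inr (.inl h2)
      · exact .inr (.inr (h d h1 h2))
  have := (Finset.card_le_card this).trans Finset.card_le_three
  simp at this
  omega

lemma NoHVN.block_of_clique (hG : NoHVN G) {A : Set V} {k : ℕ} (hk : 4 ≤ k)
    (hA : CliqueBound G A k) {e : Fin k → V} (heA : ∀ i, e i ∈ A)
    (he : ∀ i j, i ≠ j → G.Adj (e i) (e j)) :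
    Block G A fun i => {x | x ∈ A ∧ ∀ j, G.Adj x (e j) ↔ j ≠ i} := by
  classical
  have update_adj : ∀ i u, (∀ j, G.Adj u (e j) ↔ j ≠ i) → ∀ a b, a ≠ b →
      G.Adj (Function.update e i u a) (Function.update e i u b) := by
    intro i u hu a b hab
    by_cases ha : a = i
    · subst ha
      rw [Function.update_self, Function.update_of_ne hab.symm]
      exact (hu b).2 hab.symm
    · rw [Function.update_of_ne ha]
      by_cases hb : b = i
      · subst hb
        rw [Function.update_self]
        exact ((hu a).2 hab).symm
      · rw [Function.update_of_ne hb]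
        exact he a b hab
  have cross : ∀ i j u v, i ≠ j → (∀ l, G.Adj u (e l) ↔ l ≠ i) → (∀ l, G.Adj v (e l) ↔ l ≠ j) →
      G.Adj u v := by
    intro i j u v hij hu hv
    obtain ⟨a, hai, haj, -⟩ := exists_ne_three hk i j j
    obtain ⟨b, hbi, hbj, hba⟩ := exists_ne_three hk i j a
    by_contra huv
    rcases hG (e a) (e b) (e j) u v (he _ _ hba.symm) (he _ _ haj) ((hu a).2 hai).symm
      (he _ _ hbj) ((hu b).2 hbi).symm ((hu j).2 hij.symm).symm ((hv a).2 haj) ((hv b).2 hbj)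
      with h | h
    · exact (hv j).1 h rfl
    · exact huv h.symm
  refine ⟨fun i u hu => hu.1, fun i => ⟨e i, heA i, fun j => ⟨fun h hj => ?_, fun h => he _ _ h.symm⟩⟩,
    fun i j u v hu hv => ⟨?_, fun h => cross i j u v h hu.2 hv.2⟩, ?_⟩
  · subst hj; exact G.irrefl h
  · rintro huv rfl
    obtain ⟨m, hm⟩ := hA.not_adj_all (e := Function.update e i u) (x := v)
      (fun l => by by_cases hl : l = i <;> simp [hl, hu.1, heA]) (update_adj i u hu.2) hv.1
    by_cases hmi : m = i
    · subst hmi; simp [huv.symm] at hm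
    · rw [Function.update_of_ne hmi] at hm
      exact hm ((hv.2 m).2 hmi)
  · intro x hx hxS i j u v hu hv hxu hxv
    by_contra hij
    have huv := cross i j u v hij hu.2 hv.2
    have hea : ∃ a b, a ≠ i ∧ a ≠ j ∧ b ≠ i ∧ b ≠ j ∧ a ≠ b ∧ G.Adj x (e a) := by
      obtain ⟨a, hai, haj, -⟩ := exists_ne_three hk i j j
      obtain ⟨b, hbi, hbj, hba⟩ := exists_ne_three hk i j a
      rcases hG u v (e a) (e b) x huv ((hu.2 a).2 hai) ((hu.2 b).2 hbi) ((hv.2 a).2 haj)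
        ((hv.2 b).2 hbj) (he _ _ hba.symm) hxu hxv with h | h
      · exact ⟨a, b, hai, haj, hbi, hbj, hba.symm, h⟩
      · exact ⟨b, a, hbi, hbj, hai, haj, hba, h⟩
    obtain ⟨a, b, hai, haj, hbi, hbj, hab, hxa⟩ := hea
    have hec : ∃ c, c ≠ a ∧ G.Adj x (e c) := by
      rcases hG u (e a) (e j) (e b) x ((hu.2 a).2 hai) ((hu.2 j).2 (Ne.symm hij)) ((hu.2 b).2 hbi)
        (he _ _ haj) (he _ _ hab) (he _ _ hbj.symm) hxu hxa with h | h
      exacts [⟨j, haj.symm, h⟩, ⟨b, hab.symm, h⟩]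
    obtain ⟨c, hca, hxc⟩ := hec
    obtain ⟨m, hm⟩ := hA.not_adj_all heA he hx
    refine hxS m ⟨hx, fun l => ⟨?_, fun hlm => ?_⟩⟩
    · rintro h rfl; exact hm h
    · by_contra hl
      have hne : ∀ p q, G.Adj x (e p) → ¬ G.Adj x (e q) → p ≠ q := by
        rintro p q h1 h2 rfl; exact h2 h1
      rcases hG (e a) (e c) (e m) (e l) x (he _ _ hca.symm) (he _ _ (hne _ _ hxa hm))
        (he _ _ (hne _ _ hxa hl)) (he _ _ (hne _ _ hxc hm)) (he _ _ (hne _ _ hxc hl))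
        (he _ _ (Ne.symm hlm)) hxa hxc with h | h
      exacts [hm h, hl h]

/-- Every set with a clique of size `k ≥ 4` and none larger contains a block with `k` parts. -/
lemma NoHVN.exists_block (hG : NoHVN G) {A : Set V} {k : ℕ} (hk : 4 ≤ k)
    (hA : CliqueBound G A k) {K : Finset V} (hKA : ∀ x ∈ K, x ∈ A) (hK : G.IsClique K)
    (hcard : K.card = k) :
    ∃ S : Fin k → Set V, Block G A S ∧ ∀ i, ∃ x ∈ K, x ∈ S i := by
  classical
  let f := (K.equivFinOfCardEq hcard).symm
  have he : ∀ i j, i ≠ j → G.Adj (f i : V) (f j) := fun i j hij =>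
    hK (f i).2 (f j).2 fun h => hij (f.injective (Subtype.ext h))
  exact ⟨_, hG.block_of_clique hk hA (fun i => hKA _ (f i).2) he, fun i => ⟨f i, (f i).2,
    hKA _ (f i).2, fun j => ⟨fun h hj => G.irrefl (hj ▸ h), fun h => he _ _ h.symm⟩⟩⟩

/-- The vertices outside the parts `S i`. -/
def outside {k : ℕ} (S : Fin k → Set V) : Set V := {x | ∀ i, x ∉ S i}

/-- `x` has neighbours in at most one of the parts `S i`. -/
def TouchesOne (G : SimpleGraph V) {k : ℕ} (S : Fin k → Set V) (x : V) : Prop :=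
  ∀ i j u v, u ∈ S i → v ∈ S j → G.Adj x u → G.Adj x v → i = j

open Classical in
/-- The index of a part in which `x` has a neighbour, if there is one. -/
noncomputable def label (G : SimpleGraph V) {k : ℕ} (S : Fin k → Set V) (x : V) :
    Option (Fin k) :=
  if h : ∃ i, ∃ u ∈ S i, G.Adj x u then some h.choose else none

section label

variable {k : ℕ} {S : Fin k → Set V} {x u : V} {i : Fin k}

lemma exists_adj_of_label_eq (h : label G S x = some i) : ∃ u ∈ S i, G.Adj x u := by
  unfold label at h
  split_ifs at h with hx
  obtain rfl := Option.some.inj h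
  exact hx.choose_spec

lemma TouchesOne.label_eq (h : TouchesOne G S x) (hu : u ∈ S i) (hxu : G.Adj x u) :
    label G S x = some i := by
  have hx : ∃ i, ∃ u ∈ S i, G.Adj x u := ⟨i, u, hu, hxu⟩
  unfold label
  rw [dif_pos hx]
  obtain ⟨v, hv, hxv⟩ := hx.choose_spec
  exact congrArg some (h _ _ _ _ hv hu hxv hxu)

lemma Block.label_eq {A : Set V} (h : Block G A S) (hx : x ∈ A) (hxS : x ∈ outside S)
    (hu : u ∈ S i) (hxu : G.Adj x u) : label G S x = some i :=
  TouchesOne.label_eq (h.unique x hx hxS) hu hxu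

end label

lemma colorable_of_nat {N : ℕ} (g : V → ℕ) (hg : ∀ x, g x < N)
    (hg' : ∀ x y, G.Adj x y → g x ≠ g y) : G.Colorable N :=
  ⟨SimpleGraph.Coloring.mk (fun x => ⟨g x, hg x⟩) fun {x y} hxy he =>
    hg' x y hxy (congrArg Fin.val he)⟩

/-- A set that is anticomplete to two parts of a block is coloured optimally. -/
lemma Block.setColorable [Finite V] (hP : PathsDominateEdges G) {A : Set V} {k : ℕ}
    {S : Fin k → Set V} (hS : Block G A S) {X : Set V} {d : ℕ} {i j : Fin k} (hij : i ≠ j)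
    (hi : ∀ x ∈ X, ∀ u ∈ S i, ¬ G.Adj x u) (hj : ∀ x ∈ X, ∀ u ∈ S j, ¬ G.Adj x u)
    (hX : CliqueBound G X d) : SetColorable G X d := by
  refine setColorable_of_forall_not_isPath4 (fun p hp q hq r hr s hs h => ?_) hX
  obtain ⟨u, hu⟩ := hS.nonempty i
  obtain ⟨v, hv⟩ := hS.nonempty j
  have := hP p q r s u v h ((hS.adj_iff i j u v hu hv).2 hij)
  simp [hi _ hp _ hu, hi _ hq _ hu, hi _ hr _ hu, hi _ hs _ hu, hj _ hp _ hv, hj _ hq _ hv,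
    hj _ hr _ hv, hj _ hs _ hv] at this

lemma Block.setColorable_half [Finite V] (hP : PathsDominateEdges G) {n : ℕ}
    {S : Fin n → Set V} (hS : Block G Set.univ S) (h : Fin n → Bool) (b : Bool) {a : ℕ}
    (h2 : ∃ i j, i ≠ j ∧ h i = b ∧ h j = b) (ha : (Finset.univ.filter (h · = b)).card ≤ a)
    (hX : CliqueBound G {x | x ∈ outside S ∧ ∀ i, label G S x = some i → h i ≠ b} a) :
    SetColorable G {x | (∃ i, h i = b ∧ x ∈ S i) ∨
      (x ∈ outside S ∧ ∀ i, label G S x = some i → h i ≠ b)} a := by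
  classical
  obtain ⟨i, j, hij, hi, hj⟩ := h2
  have hno : ∀ i, h i = b → ∀ x, (x ∈ outside S ∧ ∀ i, label G S x = some i → h i ≠ b) →
      ∀ u ∈ S i, ¬ G.Adj x u := fun i hi x hx u hu hxu =>
    hx.2 i (hS.label_eq trivial hx.1 hu hxu) hi
  obtain ⟨c, hc, hc'⟩ := hS.setColorable hP hij (hno i hi) (hno j hj) hX
  let F := Finset.univ.filter (h · = b)
  have hF : ∀ i, i ∈ F ↔ h i = b := fun i => by simp [F]
  let g : V → ℕ := fun x => if hx : ∃ i, h i = b ∧ x ∈ S i then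
    F.equivFin ⟨hx.choose, (hF _).2 hx.choose_spec.1⟩ else c x
  have gS : ∀ x, (hx : ∃ i, h i = b ∧ x ∈ S i) →
      ∃ i, ∃ hi : i ∈ F, x ∈ S i ∧ g x = F.equivFin ⟨i, hi⟩ := by
    intro x hx
    refine ⟨hx.choose, (hF _).2 hx.choose_spec.1, hx.choose_spec.2, ?_⟩
    simp only [g]
    rw [dif_pos hx]
  have gX : ∀ x ∈ outside S, g x = c x := fun x hx => by
    simp only [g]
    rw [dif_neg]
    rintro ⟨i, -, hi⟩
    exact hx i hi
  refine ⟨g, fun x hx => ?_, fun x hx y hy hxy => ?_⟩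
  · rcases hx with hx | hx
    · obtain ⟨i, hi, hxi, hg⟩ := gS x hx
      rw [hg]
      exact (Fin.is_lt _).trans_le ha
    · rw [gX x hx.1]; exact hc x hx
  · rcases hx with hx | hx <;> rcases hy with hy | hy
    · obtain ⟨i, hi, hxi, hg⟩ := gS x hx
      obtain ⟨j, hj, hyj, hg'⟩ := gS y hy
      rw [hg, hg']
      intro he
      have := F.equivFin.injective (Fin.ext he)
      exact (hS.adj_iff i j x y hxi hyj).1 hxy (congrArg Subtype.val this)
    · obtain ⟨i, hi, hxi⟩ := hx
      exact absurd hxy.symm (hno i hi y hy x hxi)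
    · obtain ⟨i, hi, hyi⟩ := hy
      exact absurd hxy (hno i hi x hx y hyi)
    · rw [gX x hx.1, gX y hy.1]; exact hc' x hx y hy hxy

/-- Colouring by splitting the parts of a block into two classes. -/
lemma Block.colorable_of_split [Finite V] (hP : PathsDominateEdges G) {n : ℕ}
    {S : Fin n → Set V} (hS : Block G Set.univ S) (h : Fin n → Bool) (a : Bool → ℕ)
    (h2 : ∀ b, ∃ i j, i ≠ j ∧ h i = b ∧ h j = b)
    (ha : ∀ b, (Finset.univ.filter (h · = b)).card ≤ a b)
    (hX : ∀ b, CliqueBound G {x | x ∈ outside S ∧ ∀ i, label G S x = some i → h i ≠ b} (a b)) :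
    G.Colorable (a false + a true) := by
  classical
  obtain ⟨c, hc, hc'⟩ := hS.setColorable_half hP h false (h2 _) (ha _) (hX _)
  obtain ⟨d, hd, hd'⟩ := hS.setColorable_half hP h true (h2 _) (ha _) (hX _)
  have cover : ∀ x, ∃ b, (∃ i, h i = b ∧ x ∈ S i) ∨
      (x ∈ outside S ∧ ∀ i, label G S x = some i → h i ≠ b) := by
    intro x
    by_cases hx : x ∈ outside S
    · cases hl : label G S x with
      | none => exact ⟨true, .inr ⟨hx, by simp⟩⟩
      | some i => exact ⟨!h i, .inr ⟨hx, by simp⟩⟩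
    · simp only [outside, Set.mem_ofPred_eq, not_forall, not_not] at hx
      obtain ⟨i, hi⟩ := hx
      exact ⟨h i, .inl ⟨i, rfl, hi⟩⟩
  choose b hb using cover
  have hbf : ∀ x, b x = false → x ∈ {x | (∃ i, h i = false ∧ x ∈ S i) ∨
      (x ∈ outside S ∧ ∀ i, label G S x = some i → h i ≠ false)} := fun x hx => hx ▸ hb x
  have hbt : ∀ x, b x = true → x ∈ {x | (∃ i, h i = true ∧ x ∈ S i) ∨
      (x ∈ outside S ∧ ∀ i, label G S x = some i → h i ≠ true)} := fun x hx => hx ▸ hb x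
  refine colorable_of_nat (fun x => if b x = false then c x else a false + d x)
    (fun x => ?_) fun x y hxy he => ?_
  · by_cases hx : b x = false
    · have := hc x (hbf x hx)
      simp only [hx, if_true]
      omega
    · have := hd x (hbt x (by simpa using hx))
      rw [if_neg hx]
      omega
  · by_cases hx : b x = false <;> by_cases hy : b y = false <;>
      simp only [hx, hy, if_true, if_false, Bool.true_eq_false] at he
    · exact hc' x (hbf x hx) y (hbf y hy) hxy he
    · have := hc x (hbf x hx)
      omega
    · have := hc y (hbf y hy)
      omega
    · exact hd' x (hbt x (by simpa using hx)) y (hbt y (by simpa using hy)) hxy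
        (Nat.add_left_cancel he)

lemma Block.colorable_of_cliqueBound_three [Finite V] (hP : PathsDominateEdges G) {n : ℕ}
    (hn : 4 ≤ n) {S : Fin n → Set V} (hS : Block G Set.univ S)
    (hR : CliqueBound G (outside S) 3) : G.Colorable ((4 * n + 2) / 3) := by
  classical
  have key : G.Colorable (max 3 (n - 2) + 3) := by
    refine hS.colorable_of_split hP (fun i => decide ((i : ℕ) < 2))
      (fun b => if b then 3 else max 3 (n - 2)) ?_ ?_ ?_
    · rintro (_ | _)
      · exact ⟨⟨2, by omega⟩, ⟨3, by omega⟩, by simp, by simp, by simp⟩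
      · exact ⟨⟨0, by omega⟩, ⟨1, by omega⟩, by simp, by simp, by simp⟩
    · have h2 : (Finset.univ.filter fun i : Fin n => (i : ℕ) < 2).card = 2 := by
        rw [Fin.card_filter_val_lt]; omega
      rintro (_ | _)
      · have := Finset.card_filter_add_card_filter_not (s := (Finset.univ : Finset (Fin n)))
          (fun i => (i : ℕ) < 2)
        simp only [decide_eq_false_iff_not, Bool.false_eq_true, if_false]
        rw [h2] at this
        simp at this ⊢
        omega
      · simp only [decide_eq_true_eq, if_true]
        omega
    · intro b
      exact hR.mono (fun x hx => hx.1) (by cases b <;> simp)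
  exact key.mono (by omega)

/-- Extending a colouring of the complement of `W` to the cells of `W`. -/
lemma colorable_of_cells {κ : Type*} {N : ℕ} (W : Set V) (f : V → ℕ) (cell : V → κ)
    (F : κ → Finset ℕ) (hf : ∀ x ∉ W, f x < N)
    (hff : ∀ x ∉ W, ∀ y ∉ W, G.Adj x y → f x ≠ f y)
    (hfW : ∀ x ∉ W, ∀ y ∈ W, G.Adj x y → f x ∈ F (cell y))
    (hWW : ∀ x ∈ W, ∀ y ∈ W, G.Adj x y → cell x = cell y)
    (hc : ∀ a, ∃ d ≤ (Finset.range N \ F a).card, SetColorable G {y ∈ W | cell y = a} d) :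
    G.Colorable N := by
  classical
  have key : ∀ a, ∃ e : V → ℕ, (∀ y ∈ W, cell y = a → e y < N ∧ e y ∉ F a) ∧
      ∀ x ∈ W, cell x = a → ∀ y ∈ W, cell y = a → G.Adj x y → e x ≠ e y := by
    intro a
    obtain ⟨d, hd, c, hc, hc'⟩ := hc a
    let φ := (Finset.range N \ F a).equivFin.symm
    have hlt : ∀ y ∈ W, cell y = a → c y < (Finset.range N \ F a).card := fun y hy hya =>
      (hc y ⟨hy, hya⟩).trans_le hd
    have he : ∀ y ∈ W, cell y = a → ∃ h, (if h : c y < (Finset.range N \ F a).card then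
        (φ ⟨c y, h⟩ : ℕ) else 0) = φ ⟨c y, h⟩ := fun y hy hya =>
      ⟨hlt y hy hya, dif_pos _⟩
    refine ⟨fun y => if h : c y < (Finset.range N \ F a).card then (φ ⟨c y, h⟩ : ℕ) else 0,
      fun y hy hya => ?_, fun x hx hxa y hy hya hxy => ?_⟩
    · obtain ⟨h, h'⟩ := he y hy hya
      have := (φ ⟨c y, h⟩).2
      rw [Finset.mem_sdiff, Finset.mem_range] at this
      simpa only [h'] using this
    · obtain ⟨h, h'⟩ := he x hx hxa
      obtain ⟨k, k'⟩ := he y hy hya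
      simp only [h', k']
      intro hh
      exact hc' x ⟨hx, hxa⟩ y ⟨hy, hya⟩ hxy
        (congrArg Fin.val (φ.injective (Subtype.ext hh)))
  choose e he he' using key
  refine colorable_of_nat (fun x => if x ∈ W then e (cell x) x else f x) (fun x => ?_)
    fun x y hxy hh => ?_
  · by_cases hx : x ∈ W <;> simp only [hx, if_true, if_false]
    · exact (he _ x hx rfl).1
    · exact hf x hx
  · by_cases hx : x ∈ W <;> by_cases hy : y ∈ W <;>
      simp only [hx, hy, if_true, if_false] at hh
    · have hcell := hWW x hx y hy hxy
      rw [hcell] at hh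
      exact he' _ x hx hcell y hy rfl hxy hh
    · exact (he _ x hx rfl).2 (hh ▸ hfW y hy x hx hxy.symm)
    · exact (he _ y hy rfl).2 (hh ▸ hfW x hx y hy hxy)
    · exact hff x hx y hy hxy hh

section avoid

variable {n : ℕ}

lemma exists_two_avoid (T : Finset (Option (Fin n))) (h : T.card + 1 < n) :
    ∃ i j, i ≠ j ∧ some i ∉ T ∧ some j ∉ T := by
  have h1 : T.eraseNone.card ≤ T.card := Finset.card_eraseNone_le _
  have h2 := Finset.card_compl T.eraseNone
  rw [Fintype.card_fin] at h2
  obtain ⟨i, hi, j, hj, hij⟩ := Finset.one_lt_card.mp (show 1 < T.eraseNoneᶜ.card by omega)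
  exact ⟨i, j, hij, by simpa using hi, by simpa using hj⟩

lemma exists_avoid (T : Finset (Option (Fin n))) (h : T.card < n) : ∃ i, some i ∉ T := by
  have h1 : T.eraseNone.card ≤ T.card := Finset.card_eraseNone_le _
  have h2 := Finset.card_compl T.eraseNone
  rw [Fintype.card_fin] at h2
  obtain ⟨i, hi⟩ := Finset.card_pos.mp (show 0 < T.eraseNoneᶜ.card by omega)
  exact ⟨i, by simpa using hi⟩

lemma exists_avoid_three (hn : 4 ≤ n) (a b c : Option (Fin n)) :
    ∃ i, a ≠ some i ∧ b ≠ some i ∧ c ≠ some i := by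
  obtain ⟨i, hi⟩ := exists_avoid {a, b, c} (Finset.card_le_three.trans_lt (by omega))
  simp only [Finset.mem_insert, Finset.mem_singleton, not_or] at hi
  exact ⟨i, Ne.symm hi.1, Ne.symm hi.2.1, Ne.symm hi.2.2⟩

lemma exists_two_avoid_two (hn : 4 ≤ n) (a b : Option (Fin n)) :
    ∃ i j, i ≠ j ∧ (a ≠ some i ∧ b ≠ some i) ∧ a ≠ some j ∧ b ≠ some j := by
  obtain ⟨i, j, hij, hi, hj⟩ := exists_two_avoid {a, b}
    (lt_of_le_of_lt (Nat.add_le_add_right Finset.card_le_two 1) (by omega))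
  simp only [Finset.mem_insert, Finset.mem_singleton, not_or] at hi hj
  exact ⟨i, j, hij, ⟨Ne.symm hi.1, Ne.symm hi.2⟩, Ne.symm hj.1, Ne.symm hj.2⟩

/-- Three optional indices leave two indices free unless they are distinct actual indices. -/
lemma exists_two_avoid_three (hn : 4 ≤ n) (a b c : Option (Fin n))
    (h : 5 ≤ n ∨ ¬ ((∃ i, a = some i) ∧ (∃ i, b = some i) ∧ (∃ i, c = some i) ∧
      a ≠ b ∧ a ≠ c ∧ b ≠ c)) :
    ∃ i j, i ≠ j ∧ (a ≠ some i ∧ b ≠ some i ∧ c ≠ some i) ∧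
      a ≠ some j ∧ b ≠ some j ∧ c ≠ some j := by
  by_cases h5 : 5 ≤ n
  · obtain ⟨i, j, hij, hi, hj⟩ := exists_two_avoid {a, b, c}
      (lt_of_le_of_lt (Nat.add_le_add_right Finset.card_le_three 1) (by omega))
    simp only [Finset.mem_insert, Finset.mem_singleton, not_or] at hi hj
    exact ⟨i, j, hij, ⟨Ne.symm hi.1, Ne.symm hi.2.1, Ne.symm hi.2.2⟩,
      Ne.symm hj.1, Ne.symm hj.2.1, Ne.symm hj.2.2⟩
  · replace h := h.resolve_left h5
    obtain ⟨i1, j1, n1, x1, y1⟩ := exists_two_avoid_two hn a b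
    obtain ⟨i2, j2, n2, x2, y2⟩ := exists_two_avoid_two hn a c
    obtain ⟨i3, j3, n3, x3, y3⟩ := exists_two_avoid_two hn b c
    by_cases hab : a = b
    · exact ⟨i2, j2, n2, by grind, by grind⟩
    by_cases hac : a = c
    · exact ⟨i1, j1, n1, by grind, by grind⟩
    by_cases hbc : b = c
    · exact ⟨i1, j1, n1, by grind, by grind⟩
    rcases a with _ | a
    · exact ⟨i3, j3, n3, by grind, by grind⟩
    rcases b with _ | b
    · exact ⟨i2, j2, n2, by grind, by grind⟩
    rcases c with _ | c
    · exact ⟨i1, j1, n1, by grind, by grind⟩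
    exact absurd ⟨⟨a, rfl⟩, ⟨b, rfl⟩, ⟨c, rfl⟩, hab, hac, hbc⟩ h

end avoid

lemma Block.isPath4 {A : Set V} {k : ℕ} {S : Fin k → Set V} (hS : Block G A S) {y y' s s' : V}
    {i l : Fin k} (hyA : y ∈ A) (hy : y ∈ outside S) (hy'A : y' ∈ A) (hy' : y' ∈ outside S)
    (hyy' : G.Adj y y') (hs : s ∈ S i) (hys : G.Adj y s) (hy's : ¬ G.Adj y' s) (hil : l ≠ i)
    (hl : label G S y' ≠ some l) (hs' : s' ∈ S l) : IsPath4 G y' y s s' :=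
  ⟨hyy'.symm, hys, (hS.adj_iff _ _ _ _ hs hs').2 hil.symm, hy's,
    fun h => hl (hS.label_eq hy'A hy' hs' h),
    fun h => hil (hS.unique y hyA hy _ _ _ _ hs' hs h hys)⟩

/-- Two disjoint blocks of the whole graph. -/
structure BlockPair (G : SimpleGraph V) {m n : ℕ} (S : Fin m → Set V) (Q : Fin n → Set V) :
    Prop where
  left : Block G Set.univ S
  right : Block G Set.univ Q
  disjoint : ∀ i j, ∀ x ∈ S i, x ∉ Q j

lemma BlockPair.symm {m n : ℕ} {S : Fin m → Set V} {Q : Fin n → Set V} (h : BlockPair G S Q) :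
    BlockPair G Q S :=
  ⟨h.right, h.left, fun i j x hx hx' => h.disjoint j i x hx' hx⟩

/-- Every edge avoiding both blocks joins vertices with the same neighbours in the blocks. -/
def Homogeneous (G : SimpleGraph V) {m n : ℕ} (S : Fin m → Set V) (Q : Fin n → Set V) : Prop :=
  ∀ y ∈ outside S, y ∈ outside Q → ∀ y' ∈ outside S, y' ∈ outside Q → G.Adj y y' →
    (∀ i, ∀ s ∈ S i, G.Adj y s → G.Adj y' s) ∧ ∀ j, ∀ p ∈ Q j, G.Adj y p → G.Adj y' p

section BlockPair

variable {m n : ℕ} {S : Fin m → Set V} {Q : Fin n → Set V} {y y' : V}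

lemma BlockPair.mem_outside_right (h : BlockPair G S Q) {i : Fin m} {x : V} (hx : x ∈ S i) :
    x ∈ outside Q := fun j => h.disjoint i j x hx

lemma BlockPair.adj_left_of_adj (hP : PathsDominateEdges G) (h : BlockPair G S Q) (hm : 5 ≤ m)
    (hn : 4 ≤ n) (hy : y ∈ outside S) (hyQ : y ∈ outside Q) (hy' : y' ∈ outside S)
    (hy'Q : y' ∈ outside Q) (hyy' : G.Adj y y') {i : Fin m} {s : V} (hs : s ∈ S i)
    (hys : G.Adj y s) : G.Adj y' s := by
  by_contra hy's
  have hsQ := h.mem_outside_right hs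
  have LS : ∀ {x u i}, x ∈ outside S → u ∈ S i → G.Adj x u → label G S x = some i :=
    fun hx hu hxu => h.left.label_eq trivial hx hu hxu
  have LQ : ∀ {x u i}, x ∈ outside Q → u ∈ Q i → G.Adj x u → label G Q x = some i :=
    fun hx hu hxu => h.right.label_eq trivial hx hu hxu
  by_cases hd : (∃ i, label G Q y = some i) ∧ (∃ i, label G Q y' = some i) ∧
      (∃ i, label G Q s = some i) ∧ label G Q y ≠ label G Q y' ∧
      label G Q y ≠ label G Q s ∧ label G Q y' ≠ label G Q s
  · obtain ⟨⟨j, hj⟩, -, ⟨e, he⟩, h1, h2, h3⟩ := hd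
    obtain ⟨p, hp, hyp⟩ := exists_adj_of_label_eq hj
    obtain ⟨q, hq, hsq⟩ := exists_adj_of_label_eq he
    have hpath : IsPath4 G y' y p q := h.right.isPath4 trivial hyQ trivial hy'Q hyy' hp hyp
      (fun h' => h1 (hj.trans (LQ hy'Q hp h').symm)) (fun h' => h2 (by rw [hj, he, h']))
      (fun h' => h3 (by rw [h', he])) hq
    have hpS := h.symm.mem_outside_right hp
    have hqS := h.symm.mem_outside_right hq
    obtain ⟨a, b, hab, ⟨a1, a2, a3⟩, b1, b2, b3⟩ := exists_two_avoid_three (by omega)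
      (label G S y') (label G S y) (label G S p) (.inl hm)
    have hqy : label G S q = label G S y := (LS hqS hs hsq.symm).trans (LS hy hs hys).symm
    obtain ⟨u, hu⟩ := h.left.nonempty a
    obtain ⟨v, hv⟩ := h.left.nonempty b
    have := hP _ _ _ _ u v hpath ((h.left.adj_iff _ _ _ _ hu hv).2 hab)
    grind
  · obtain ⟨a, b, hab, ⟨a1, a2, a3⟩, b1, b2, b3⟩ := exists_two_avoid_three hn _ _ _ (.inr hd)
    obtain ⟨u, hu⟩ := h.right.nonempty a
    obtain ⟨v, hv⟩ := h.right.nonempty b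
    have huS := h.symm.mem_outside_right hu
    have hvS := h.symm.mem_outside_right hv
    obtain ⟨l, hl⟩ := exists_avoid {some i, label G S y', label G S u, label G S v}
      (Finset.card_le_four.trans_lt (by omega))
    simp only [Finset.mem_insert, Finset.mem_singleton, not_or, Option.some.injEq] at hl
    obtain ⟨s', hs'⟩ := h.left.nonempty l
    have hpath := h.left.isPath4 trivial hy trivial hy' hyy' hs hys hy's hl.1 (Ne.symm hl.2.1) hs'
    have := hP _ _ _ _ u v hpath ((h.right.adj_iff _ _ _ _ hu hv).2 hab)
    have h1 : ¬ G.Adj s' u := fun h' => hl.2.2.1 (LS huS hs' h'.symm).symm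
    have h2 : ¬ G.Adj s' v := fun h' => hl.2.2.2 (LS hvS hs' h'.symm).symm
    grind

lemma label_eq_of_forall_adj_iff (h : ∀ i, ∀ s ∈ S i, G.Adj y s ↔ G.Adj y' s) :
    label G S y = label G S y' := by
  have : (fun i => ∃ u ∈ S i, G.Adj y u) = fun i => ∃ u ∈ S i, G.Adj y' u := by
    funext i
    exact propext (exists_congr fun u => and_congr_right fun hu => h i u hu)
  classical
  have := congrArg (fun P : Fin m → Prop => if h : ∃ i, P i then some h.choose else none) this
  unfold label
  convert this

lemma BlockPair.homogeneous (hP : PathsDominateEdges G) (h : BlockPair G S Q) (hm : 5 ≤ m)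
    (hn : 4 ≤ n) : Homogeneous G S Q := by
  intro y hy hyQ y' hy' hy'Q hyy'
  refine ⟨fun i s hs => h.adj_left_of_adj hP hm hn hy hyQ hy' hy'Q hyy' hs, fun j p hp hyp => ?_⟩
  by_contra hy'p
  have hlab : label G S y = label G S y' := label_eq_of_forall_adj_iff fun i s hs =>
    ⟨h.adj_left_of_adj hP hm hn hy hyQ hy' hy'Q hyy' hs,
      h.adj_left_of_adj hP hm hn hy' hy'Q hy hyQ hyy'.symm hs⟩
  obtain ⟨l, hl, hl', -⟩ := exists_avoid_three hn (some j) (label G Q y') none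
  obtain ⟨q, hq⟩ := h.right.nonempty l
  have hpath := h.right.isPath4 trivial hyQ trivial hy'Q hyy' hp hyp hy'p (by grind) hl' hq
  obtain ⟨a, b, hab, ⟨a1, a2, a3⟩, b1, b2, b3⟩ := exists_two_avoid_three (by omega)
      (label G S y') (label G S q) (label G S p) (.inl hm)
  obtain ⟨u, hu⟩ := h.left.nonempty a
  obtain ⟨v, hv⟩ := h.left.nonempty b
  have LS : ∀ {x u i}, x ∈ outside S → u ∈ S i → G.Adj x u → label G S x = some i :=
    fun hx hu hxu => h.left.label_eq trivial hx hu hxu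
  have hpS := h.symm.mem_outside_right hp
  have hqS := h.symm.mem_outside_right hq
  have := hP _ _ _ _ u v hpath ((h.left.adj_iff _ _ _ _ hu hv).2 hab)
  grind

end BlockPair

/-- Colour of a vertex in row part `i` attached to column part `j`. -/
def rowColor (i j : ℕ) : ℕ :=
  if i % 3 = 0 then 4 * (i / 3) else if i % 3 = 1 then 4 * (i / 3) + 2
  else if j = i then 4 * (i / 3) + 1 else 4 * (i / 3) + 3

/-- Colour of a vertex in column part `j` attached to row part `i`. -/
def colColor (i j : ℕ) : ℕ :=
  if j % 3 = 0 then 4 * (j / 3) + 1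
  else if j % 3 = 1 then (if i = j then 4 * (j / 3) else 4 * (j / 3) + 2)
  else 4 * (j / 3) + 3

lemma rowColor_ne_colColor (i j : ℕ) : rowColor i j ≠ colColor i j := by
  unfold rowColor colColor; split_ifs <;> omega

lemma rowColor_ne {i i' : ℕ} (h : i ≠ i') (j j' : ℕ) : rowColor i j ≠ rowColor i' j' := by
  unfold rowColor; split_ifs <;> omega

lemma colColor_ne {j j' : ℕ} (h : j ≠ j') (i i' : ℕ) : colColor i j ≠ colColor i' j' := by
  unfold colColor; split_ifs <;> omega

lemma rowColor_lt {i m : ℕ} (h : i < m) (j : ℕ) : rowColor i j < (4 * m + 2) / 3 := by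
  unfold rowColor; split_ifs <;> omega

lemma colColor_lt {j m : ℕ} (h : j < m) (i : ℕ) : colColor i j < (4 * m + 2) / 3 := by
  unfold colColor; split_ifs <;> omega

/-- The colours used in row part `i`. -/
def rowColors (i : ℕ) : Finset ℕ := {rowColor i i, rowColor i (i + 1)}

/-- The colours used in column part `j`. -/
def colColors (j : ℕ) : Finset ℕ := {colColor j j, colColor (j + 1) j}

lemma rowColor_mem (i j : ℕ) : rowColor i j ∈ rowColors i := by
  simp only [rowColors, rowColor, Finset.mem_insert, Finset.mem_singleton]; split_ifs <;> omega

lemma colColor_mem (i j : ℕ) : colColor i j ∈ colColors j := by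
  simp only [colColors, colColor, Finset.mem_insert, Finset.mem_singleton]; split_ifs <;> omega

lemma card_rowColors_le (i : ℕ) : (rowColors i).card ≤ 2 := Finset.card_le_two

lemma card_colColors_le (i : ℕ) : (colColors i).card ≤ 2 := Finset.card_le_two

lemma card_rowColors_zero : (rowColors 0).card = 1 := by decide

lemma card_colColors_zero : (colColors 0).card = 1 := by decide

lemma Block.index_unique {A : Set V} {k : ℕ} {S : Fin k → Set V} (hS : Block G A S) {x : V}
    {i j : Fin k} (hi : x ∈ S i) (hj : x ∈ S j) : i = j := by
  by_contra h
  exact G.irrefl ((hS.adj_iff _ _ _ _ hi hj).2 h)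

section BlockPair

variable {m n : ℕ} {S : Fin m → Set V} {Q : Fin n → Set V}

/-- The vertices outside both blocks with prescribed labels. -/
def cellSet (G : SimpleGraph V) {m n : ℕ} (S : Fin m → Set V) (Q : Fin n → Set V)
    (a : Option (Fin m)) (b : Option (Fin n)) : Set V :=
  {x | x ∈ outside S ∧ x ∈ outside Q ∧ label G S x = a ∧ label G Q x = b}

lemma Homogeneous.label_eq (hom : Homogeneous G S Q) {y y' : V} (hy : y ∈ outside S)
    (hyQ : y ∈ outside Q) (hy' : y' ∈ outside S) (hy'Q : y' ∈ outside Q) (hyy' : G.Adj y y') :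
    label G S y = label G S y' ∧ label G Q y = label G Q y' := by
  obtain ⟨h1, h2⟩ := hom y hy hyQ y' hy' hy'Q hyy'
  obtain ⟨h3, h4⟩ := hom y' hy' hy'Q y hy hyQ hyy'.symm
  exact ⟨label_eq_of_forall_adj_iff fun i s hs => ⟨h1 i s hs, h3 i s hs⟩,
    label_eq_of_forall_adj_iff fun i s hs => ⟨h2 i s hs, h4 i s hs⟩⟩

lemma BlockPair.not_adj_of_edge (hP : PathsDominateEdges G) (h : BlockPair G S Q) (hn : 4 ≤ n)
    (hom : Homogeneous G S Q) {i i' : Fin m} {j j' b : Fin n} (hi : i ≠ i') {d e d' s' p : V}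
    (hd : d ∈ cellSet G S Q (some i) (some j)) (he : e ∈ cellSet G S Q (some i) (some j))
    (hde : G.Adj d e) (hd' : d' ∈ cellSet G S Q (some i') (some j')) (hs' : s' ∈ S i')
    (hds' : G.Adj d' s') (hbj : b ≠ j) (hbj' : b ≠ j') (hp : p ∈ Q b) : ¬ G.Adj s' p := by
  intro hsp
  obtain ⟨c, hcb, hcj, hcj'⟩ := exists_ne_three hn b j j'
  obtain ⟨q, hq⟩ := h.right.nonempty c
  have LS : ∀ {x u i}, x ∈ outside S → u ∈ S i → G.Adj x u → label G S x = some i :=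
    fun hx hu hxu => h.left.label_eq trivial hx hu hxu
  have LQ : ∀ {x u i}, x ∈ outside Q → u ∈ Q i → G.Adj x u → label G Q x = some i :=
    fun hx hu hxu => h.right.label_eq trivial hx hu hxu
  have hs'Q := h.mem_outside_right hs'
  obtain ⟨d1, d2, d3, d4⟩ := hd
  obtain ⟨e1, e2, e3, e4⟩ := he
  obtain ⟨f1, f2, f3, f4⟩ := hd'
  have path : IsPath4 G d' s' p q := ⟨hds', hsp, (h.right.adj_iff _ _ _ _ hp hq).2 hcb.symm,
    fun h' => by grind, fun h' => by grind, fun h' => by grind⟩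
  have n1 : ¬ G.Adj d' d := fun h' => by
    have := (hom.label_eq f1 f2 d1 d2 h').1
    grind
  have n2 : ¬ G.Adj d' e := fun h' => by
    have := (hom.label_eq f1 f2 e1 e2 h').1
    grind
  have := hP _ _ _ _ d e path hde
  grind [SimpleGraph.adj_comm]

lemma BlockPair.eq_or_eq_of_edges (hP : PathsDominateEdges G) (h : BlockPair G S Q) (hn : 4 ≤ n)
    (hom : Homogeneous G S Q) {i i' : Fin m} {j j' : Fin n} {d e d' e' : V}
    (hd : d ∈ cellSet G S Q (some i) (some j)) (he : e ∈ cellSet G S Q (some i) (some j))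
    (hde : G.Adj d e) (hd' : d' ∈ cellSet G S Q (some i') (some j'))
    (he' : e' ∈ cellSet G S Q (some i') (some j')) (hde' : G.Adj d' e') : i = i' ∨ j = j' := by
  by_contra! hne
  obtain ⟨hi, hj⟩ := hne
  obtain ⟨s, hs, hds⟩ := exists_adj_of_label_eq hd.2.2.1
  obtain ⟨s', hs', hds'⟩ := exists_adj_of_label_eq hd'.2.2.1
  obtain ⟨b, c, hbc, hb, hc⟩ := exists_two_avoid_two hn (some j) (some j')
  obtain ⟨u, hu⟩ := h.right.nonempty b
  obtain ⟨v, hv⟩ := h.right.nonempty c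
  have LS : ∀ {x u i}, x ∈ outside S → u ∈ S i → G.Adj x u → label G S x = some i :=
    fun hx hu hxu => h.left.label_eq trivial hx hu hxu
  have LQ : ∀ {x u i}, x ∈ outside Q → u ∈ Q i → G.Adj x u → label G Q x = some i :=
    fun hx hu hxu => h.right.label_eq trivial hx hu hxu
  have key : ∀ {a w}, some j ≠ some a ∧ some j' ≠ some a → w ∈ Q a →
      ¬ G.Adj s w ∧ ¬ G.Adj s' w := by
    intro a w ha hw
    exact ⟨h.not_adj_of_edge hP hn hom hi.symm hd' he' hde' hd hs hds (by grind) (by grind) hw,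
      h.not_adj_of_edge hP hn hom hi hd he hde hd' hs' hds' (by grind) (by grind) hw⟩
  have k1 := key hb hu
  have k2 := key hc hv
  obtain ⟨d1, d2, d3, d4⟩ := hd
  obtain ⟨f1, f2, f3, f4⟩ := hd'
  have path : IsPath4 G d s s' d' := ⟨hds, (h.left.adj_iff _ _ _ _ hs hs').2 hi, hds'.symm,
    fun h' => by grind, fun h' => hi (by
      have := (hom.label_eq d1 d2 f1 f2 h').1
      grind), fun h' => by grind [SimpleGraph.adj_comm]⟩
  have := hP _ _ _ _ u v path ((h.right.adj_iff _ _ _ _ hu hv).2 hbc)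
  grind

/-- Only the cells in one row and one column can contain cliques of size `m - 1`. -/
lemma BlockPair.exists_cross (hP : PathsDominateEdges G) (h : BlockPair G S Q) (hm : 4 ≤ m)
    (hn : 4 ≤ n) (hom : Homogeneous G S Q) : ∃ i₀ j₀, ∀ i j, i ≠ i₀ → j ≠ j₀ →
      CliqueBound G (cellSet G S Q (some i) (some j)) (m - 2) := by
  have edge : ∀ i j, ¬ CliqueBound G (cellSet G S Q (some i) (some j)) (m - 2) →
      ∃ d ∈ cellSet G S Q (some i) (some j), ∃ e ∈ cellSet G S Q (some i) (some j),
        G.Adj d e := by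
    intro i j hij
    simp only [CliqueBound, not_forall, not_le] at hij
    obtain ⟨K, hK, hc, hcard⟩ := hij
    obtain ⟨d, hd, e, he, hne⟩ := Finset.one_lt_card.mp (show 1 < K.card by omega)
    exact ⟨d, hK d hd, e, hK e he, hc hd he hne⟩
  by_contra! hno
  obtain ⟨i, j, -, -, hij⟩ := hno ⟨0, by omega⟩ ⟨0, by omega⟩
  obtain ⟨i', j', hi, hj, hij'⟩ := hno i j
  obtain ⟨d, hd, e, he, hde⟩ := edge i j hij
  obtain ⟨d', hd', e', he', hde'⟩ := edge i' j' hij'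
  rcases h.eq_or_eq_of_edges hP hn hom hd he hde hd' he' hde' with h' | h'
  exacts [hi h'.symm, hj h'.symm]

end BlockPair

section BlockPair

variable {m n : ℕ} {S : Fin m → Set V} {Q : Fin n → Set V}

lemma Homogeneous.cliqueBound_cellSet (h : BlockPair G S Q) (hom : Homogeneous G S Q)
    (hR : CliqueBound G (outside S) n) (hn : 4 ≤ n) (a : Option (Fin m)) (j : Fin n) :
    CliqueBound G (cellSet G S Q a (some j)) (n - 1) := by
  classical
  intro K hK hc
  rcases K.eq_empty_or_nonempty with rfl | ⟨y, hy⟩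
  · simp
  obtain ⟨h1, h2, h3, h4⟩ := hK y hy
  obtain ⟨p, hp, hyp⟩ := exists_adj_of_label_eq h4
  have hpK : p ∉ K := fun hpK => (hK p hpK).2.1 j hp
  have := hR (insert p K) (fun x hx => by
      rcases Finset.mem_insert.mp hx with rfl | hx
      exacts [h.symm.mem_outside_right hp, (hK x hx).1]) (by
      rw [Finset.coe_insert, SimpleGraph.isClique_insert]
      refine ⟨hc, fun x hx _ => ?_⟩
      by_cases hxy : y = x
      · exact hxy ▸ hyp.symm
      · exact ((hom y h1 h2 x (hK x hx).1 (hK x hx).2.1 (hc hy hx hxy)).2 j p hp hyp).symm)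
  rw [Finset.card_insert_of_notMem hpK] at this
  omega

lemma Block.setColorable_of_label_eq [Finite V] (hP : PathsDominateEdges G) {k : ℕ}
    {S : Fin k → Set V} (hS : Block G Set.univ S) (hk : 4 ≤ k) {X : Set V} {a : Option (Fin k)}
    (hX : ∀ x ∈ X, x ∈ outside S ∧ label G S x = a) {d : ℕ} (hd : CliqueBound G X d) :
    SetColorable G X d := by
  obtain ⟨i, j, hij, ⟨hi, -⟩, hj, -⟩ := exists_two_avoid_two hk a a
  refine hS.setColorable hP hij (fun x hx u hu hxu => hi ?_) (fun x hx u hu hxu => hj ?_) hd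
  · rw [← (hX x hx).2, hS.label_eq trivial (hX x hx).1 hu hxu]
  · rw [← (hX x hx).2, hS.label_eq trivial (hX x hx).1 hu hxu]

open Classical in
/-- The table colouring of the vertices in two blocks. -/
noncomputable def tableColor (G : SimpleGraph V) (S : Fin m → Set V) (Q : Fin n → Set V)
    (σ : Fin m → ℕ) (ρ : Fin n → ℕ) (x : V) : ℕ :=
  if h : ∃ i, x ∈ S i then rowColor (σ h.choose) ((label G Q x).elim 0 ρ)
  else if h : ∃ j, x ∈ Q j then colColor ((label G S x).elim 0 σ) (ρ h.choose) else 0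

lemma BlockPair.tableColor_left (h : BlockPair G S Q) (σ : Fin m → ℕ) (ρ : Fin n → ℕ) {x : V}
    {i : Fin m} (hx : x ∈ S i) :
    tableColor G S Q σ ρ x = rowColor (σ i) ((label G Q x).elim 0 ρ) := by
  have hx' : ∃ i, x ∈ S i := ⟨i, hx⟩
  unfold tableColor
  rw [dif_pos hx', h.left.index_unique hx'.choose_spec hx]

lemma BlockPair.tableColor_right (h : BlockPair G S Q) (σ : Fin m → ℕ) (ρ : Fin n → ℕ) {x : V}
    {j : Fin n} (hx : x ∈ Q j) :
    tableColor G S Q σ ρ x = colColor ((label G S x).elim 0 σ) (ρ j) := by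
  have hx' : ∃ j, x ∈ Q j := ⟨j, hx⟩
  have hxS : ¬ ∃ i, x ∈ S i := fun ⟨i, hi⟩ => h.disjoint i j x hi hx
  unfold tableColor
  rw [dif_neg hxS, dif_pos hx', h.right.index_unique hx'.choose_spec hx]

/-- The colours that a cell must avoid. -/
def cellColors (σ : Fin m → ℕ) (ρ : Fin n → ℕ) (a : Option (Fin m) × Option (Fin n)) :
    Finset ℕ :=
  a.1.elim ∅ (fun i => rowColors (σ i)) ∪ a.2.elim ∅ (fun j => colColors (ρ j))

lemma card_cellColors_le (σ : Fin m → ℕ) (ρ : Fin n → ℕ) (a : Option (Fin m) × Option (Fin n)) :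
    (cellColors σ ρ a).card ≤ a.1.elim 0 (fun i => (rowColors (σ i)).card) +
      a.2.elim 0 (fun j => (colColors (ρ j)).card) := by
  refine (Finset.card_union_le _ _).trans (Nat.add_le_add ?_ ?_)
  · cases a.1 <;> simp
  · cases a.2 <;> simp

lemma BlockPair.colorable_of_homogeneous [Finite V] (hP : PathsDominateEdges G)
    (h : BlockPair G S Q) (hm : 4 ≤ m) (hn : 4 ≤ n) (hnm : n ≤ m) (hom : Homogeneous G S Q)
    (hω : CliqueBound G Set.univ m) (hR : CliqueBound G (outside S) n) :
    G.Colorable ((4 * m + 2) / 3) := by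
  classical
  obtain ⟨i₀, j₀, hcross⟩ := h.exists_cross hP hm hn hom
  let σ : Fin m → ℕ := fun i => Equiv.swap i₀ ⟨0, by omega⟩ i
  let ρ : Fin n → ℕ := fun j => Equiv.swap j₀ ⟨0, by omega⟩ j
  have σ0 : σ i₀ = 0 := by simp [σ]
  have ρ0 : ρ j₀ = 0 := by simp [ρ]
  have hσ : Function.Injective σ := fun i j hij => (Equiv.injective _) (Fin.ext hij)
  have hρ : Function.Injective ρ := fun i j hij => (Equiv.injective _) (Fin.ext hij)
  have LS : ∀ {x u i}, x ∈ outside S → u ∈ S i → G.Adj x u → label G S x = some i :=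
    fun hx hu hxu => h.left.label_eq trivial hx hu hxu
  have LQ : ∀ {x u i}, x ∈ outside Q → u ∈ Q i → G.Adj x u → label G Q x = some i :=
    fun hx hu hxu => h.right.label_eq trivial hx hu hxu
  have cases : ∀ x ∉ outside S ∩ outside Q, (∃ i, x ∈ S i) ∨ ∃ j, x ∈ Q j := by
    intro x hx
    by_contra! hno
    exact hx ⟨hno.1, hno.2⟩
  refine colorable_of_cells (outside S ∩ outside Q) (tableColor G S Q σ ρ)
    (fun x => (label G S x, label G Q x)) (cellColors σ ρ) ?_ ?_ ?_ ?_ ?_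
  · intro x hx
    rcases cases x hx with ⟨i, hi⟩ | ⟨j, hj⟩
    · rw [h.tableColor_left σ ρ hi]
      exact rowColor_lt (Fin.is_lt _) _
    · rw [h.tableColor_right σ ρ hj]
      exact colColor_lt ((Fin.is_lt _).trans_le hnm) _
  · have mixed : ∀ i j x y, x ∈ S i → y ∈ Q j → G.Adj x y →
        tableColor G S Q σ ρ x ≠ tableColor G S Q σ ρ y := by
      intro i j x y hx hy hxy
      rw [h.tableColor_left σ ρ hx, h.tableColor_right σ ρ hy,
        LQ (h.mem_outside_right hx) hy hxy, LS (h.symm.mem_outside_right hy) hx hxy.symm]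
      exact rowColor_ne_colColor _ _
    intro x hx y hy hxy
    rcases cases x hx with ⟨i, hi⟩ | ⟨i, hi⟩ <;> rcases cases y hy with ⟨j, hj⟩ | ⟨j, hj⟩
    · rw [h.tableColor_left σ ρ hi, h.tableColor_left σ ρ hj]
      exact rowColor_ne (fun hij => (h.left.adj_iff _ _ _ _ hi hj).1 hxy (hσ hij)) _ _
    · exact mixed i j x y hi hj hxy
    · exact (mixed j i y x hj hi hxy.symm).symm
    · rw [h.tableColor_right σ ρ hi, h.tableColor_right σ ρ hj]
      exact colColor_ne (fun hij => (h.right.adj_iff _ _ _ _ hi hj).1 hxy (hρ hij)) _ _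
  · intro x hx y hy hxy
    rcases cases x hx with ⟨i, hi⟩ | ⟨i, hi⟩
    · rw [h.tableColor_left σ ρ hi, cellColors, LS hy.1 hi hxy.symm]
      exact Finset.mem_union_left _ (rowColor_mem _ _)
    · rw [h.tableColor_right σ ρ hi, cellColors, LQ hy.2 hi hxy.symm]
      exact Finset.mem_union_right _ (colColor_mem _ _)
  · intro x hx y hy hxy
    exact Prod.ext_iff.mpr (hom.label_eq hx.1 hx.2 hy.1 hy.2 hxy)
  · rintro ⟨a, b⟩
    refine ⟨_, le_rfl, h.left.setColorable_of_label_eq hP hm (a := a)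
      (fun x hx => ⟨hx.1.1, congrArg Prod.fst hx.2⟩) ?_⟩
    have hsub : {y | y ∈ outside S ∩ outside Q ∧ (label G S y, label G Q y) = (a, b)} ⊆
        cellSet G S Q a b := fun y hy =>
      ⟨hy.1.1, hy.1.2, congrArg Prod.fst hy.2, congrArg Prod.snd hy.2⟩
    have hcard : (4 * m + 2) / 3 - (cellColors σ ρ (a, b)).card ≤
        (Finset.range ((4 * m + 2) / 3) \ cellColors σ ρ (a, b)).card := by
      have := Finset.le_card_sdiff (cellColors σ ρ (a, b)) (Finset.range ((4 * m + 2) / 3))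
      rwa [Finset.card_range] at this
    have hle := card_cellColors_le σ ρ (a, b)
    rcases a with _ | i
    · have h2 : b.elim 0 (fun j => (colColors (ρ j)).card) ≤ 2 := by
        cases b
        exacts [Nat.zero_le _, card_colColors_le _]
      simp only [Option.elim_none] at hle
      exact hω.mono (fun _ _ => trivial) (by omega)
    · have h1 := card_rowColors_le (σ i)
      rcases b with _ | j
      · simp only [Option.elim_none, Option.elim_some] at hle
        exact hω.mono (fun _ _ => trivial) (by omega)
      · have h2 := card_colColors_le (ρ j)
        simp only [Option.elim_some] at hle
        by_cases hi : i = i₀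
        · have : (rowColors (σ i)).card = 1 := by rw [hi, σ0, card_rowColors_zero]
          exact (hom.cliqueBound_cellSet h hR hn _ j).mono hsub (by omega)
        by_cases hj : j = j₀
        · have : (colColors (ρ j)).card = 1 := by rw [hj, ρ0, card_colColors_zero]
          exact (hom.cliqueBound_cellSet h hR hn _ j).mono hsub (by omega)
        · exact (hcross i j hi hj).mono hsub (by omega)

end BlockPair

lemma NoHVN.index_eq_of_not_adj (hG : NoHVN G) {n : ℕ} (hn : 4 ≤ n) {Q : Fin n → Set V}
    (hne : ∀ i, ∃ u, u ∈ Q i)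
    (hQ : ∀ i j u v, u ∈ Q i → v ∈ Q j → (G.Adj u v ↔ i ≠ j)) {s p₀ p₁ p p' : V}
    {a b j j' : Fin n} (hab : a ≠ b) (hp₀ : p₀ ∈ Q a) (hp₁ : p₁ ∈ Q b) (h₀ : G.Adj s p₀)
    (h₁ : G.Adj s p₁) (hp : p ∈ Q j) (hp' : p' ∈ Q j') (hsp : ¬ G.Adj s p)
    (hsp' : ¬ G.Adj s p') : j = j' := by
  by_contra hjj
  have four : ∀ {a b c d u v w x}, u ∈ Q a → v ∈ Q b → w ∈ Q c → x ∈ Q d → a ≠ b → a ≠ c →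
      a ≠ d → b ≠ c → b ≠ d → c ≠ d → G.Adj s u → G.Adj s v → G.Adj s w ∨ G.Adj s x :=
    fun hu hv hw hx h1 h2 h3 h4 h5 h6 => hG _ _ _ _ _ ((hQ _ _ _ _ hu hv).2 h1)
      ((hQ _ _ _ _ hu hw).2 h2) ((hQ _ _ _ _ hu hx).2 h3) ((hQ _ _ _ _ hv hw).2 h4)
      ((hQ _ _ _ _ hv hx).2 h5) ((hQ _ _ _ _ hw hx).2 h6)
  have other : ∀ {c d u v}, u ∈ Q c → v ∈ Q d → c ≠ d → c ≠ j → c ≠ j' → d ≠ j → d ≠ j' →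
      G.Adj s u → ¬ G.Adj s v := by
    intro c d u v hu hv hcd h1 h2 h3 h4 hsu hsv
    rcases four hu hv hp hp' hcd h1 h2 h3 h4 hjj hsu hsv with h | h
    exacts [hsp h, hsp' h]
  have mixed : ∀ {c d u v}, u ∈ Q c → v ∈ Q d → (c = j ∨ c = j') → d ≠ j → d ≠ j' →
      G.Adj s u → ¬ G.Adj s v := by
    intro c d u v hu hv hc h3 h4 hsu hsv
    obtain ⟨f, hf1, hf2, hf3⟩ := exists_ne_three hn j j' d
    obtain ⟨x, hx⟩ := hne f
    have hsx : ¬ G.Adj s x := other hv hx hf3.symm h3 h4 hf1 hf2 hsv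
    rcases hc with rfl | rfl
    · rcases four hu hv hp' hx h3.symm hjj hf1.symm h4 hf3.symm hf2.symm hsu hsv with h | h
      exacts [hsp' h, hsx h]
    · rcases four hu hv hp hx h4.symm (Ne.symm hjj) hf2.symm h3 hf3.symm hf1.symm hsu hsv
        with h | h
      exacts [hsp h, hsx h]
  by_cases ha : a = j ∨ a = j' <;> by_cases hb : b = j ∨ b = j'
  · obtain ⟨f, hf1, hf2, -⟩ := exists_ne_three hn j j' j
    obtain ⟨f', hf1', hf2', hf3'⟩ := exists_ne_three hn j j' f
    obtain ⟨x, hx⟩ := hne f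
    obtain ⟨x', hx'⟩ := hne f'
    rcases four hp₀ hp₁ hx hx' hab (by grind) (by grind) (by grind) (by grind) hf3'.symm h₀ h₁
      with h | h
    · exact mixed hp₀ hx ha hf1 hf2 h₀ h
    · exact mixed hp₀ hx' ha hf1' hf2' h₀ h
  · exact mixed hp₀ hp₁ ha (by grind) (by grind) h₀ h₁
  · exact mixed hp₁ hp₀ hb (by grind) (by grind) h₁ h₀
  · exact other hp₀ hp₁ hab (by grind) (by grind) (by grind) (by grind) h₀ h₁

/-- All parts of `Q` except part `j₀` see only part `i` of `S`. -/
def Concentrated (G : SimpleGraph V) {m n : ℕ} (S : Fin m → Set V) (Q : Fin n → Set V)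
    (i : Fin m) (j₀ : Fin n) : Prop :=
  ∀ j ≠ j₀, ∀ p ∈ Q j, label G S p = some i

/-- `y` and `y'` see distinct parts of `S`, both different from part `i`. -/
structure SplitBy (G : SimpleGraph V) {m : ℕ} (S : Fin m → Set V) (i : Fin m) (y y' : V) :
    Prop where
  left : ∃ b, label G S y = some b
  right : ∃ b, label G S y' = some b
  left_ne : label G S y ≠ some i
  right_ne : label G S y' ≠ some i
  ne : label G S y ≠ label G S y'

lemma SplitBy.symm {m : ℕ} {S : Fin m → Set V} {i : Fin m} {y y' : V} (h : SplitBy G S i y y') :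
    SplitBy G S i y' y :=
  ⟨h.right, h.left, h.right_ne, h.left_ne, h.ne.symm⟩

section Concentrated

variable {m n : ℕ} {S : Fin m → Set V} {Q : Fin n → Set V} {i : Fin m} {j₀ : Fin n} {y y' : V}

lemma Block.pair_or_concentrated (hG : NoHVN G) (hn : 4 ≤ n) (hS : Block G Set.univ S)
    (hQ : Block G (outside S) Q) : BlockPair G S Q ∨ ∃ i j₀, Concentrated G S Q i j₀ := by
  by_cases h : ∀ k, ∀ s ∈ S k, TouchesOne G Q s
  · refine .inl ⟨hS, ⟨fun _ _ _ => trivial, hQ.nonempty, hQ.adj_iff, fun x _ hxQ => ?_⟩,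
      fun i j x hx hxQ => hQ.subset j x hxQ i hx⟩
    by_cases hx : x ∈ outside S
    · exact hQ.unique x hx hxQ
    · simp only [outside, Set.mem_ofPred_eq, not_forall, not_not] at hx
      obtain ⟨k, hk⟩ := hx
      exact h k x hk
  · simp only [TouchesOne, not_forall] at h
    obtain ⟨i, s, hs, a, b, p₀, p₁, hp₀, hp₁, h₀, h₁, hab⟩ := h
    have hadj : ∀ {j p}, p ∈ Q j → G.Adj s p → label G S p = some i := fun hp hsp =>
      hS.label_eq trivial (hQ.subset _ _ hp) hs hsp.symm
    by_cases hex : ∃ j, ∃ p ∈ Q j, ¬ G.Adj s p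
    · obtain ⟨j₀, p, hp, hsp⟩ := hex
      refine .inr ⟨i, j₀, fun j hj p' hp' => hadj hp' ?_⟩
      by_contra hsp'
      exact hj (hG.index_eq_of_not_adj hn hQ.nonempty hQ.adj_iff hab hp₀ hp₁ h₀ h₁ hp' hp hsp' hsp)
    · simp only [not_exists, not_and, not_not] at hex
      exact .inr ⟨i, a, fun j _ p hp => hadj hp (hex j p hp)⟩

lemma Concentrated.splitBy_right (hP : PathsDominateEdges G) (hm : 4 ≤ m) (hn : 4 ≤ n)
    (hS : Block G Set.univ S) (hQ : Block G (outside S) Q) (hc : Concentrated G S Q i j₀)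
    (hy : y ∈ outside S) (hyQ : y ∈ outside Q) (hy' : y' ∈ outside S) (hy'Q : y' ∈ outside Q)
    (hyy' : G.Adj y y') {k : Fin m} (hk : k ≠ i) {s : V} (hs : s ∈ S k) (hys : G.Adj y s)
    (hy's : ¬ G.Adj y' s) : n < 5 ∧ SplitBy G Q j₀ y y' := by
  have LS : ∀ {x u i}, x ∈ outside S → u ∈ S i → G.Adj x u → label G S x = some i :=
    fun hx hu hxu => hS.label_eq trivial hx hu hxu
  have LQ : ∀ {x u i}, x ∈ outside S → x ∈ outside Q → u ∈ Q i → G.Adj x u →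
      label G Q x = some i := fun hx hxQ hu hxu => hQ.label_eq hx hxQ hu hxu
  have only : ∀ {k s j p}, k ≠ i → s ∈ S k → j ≠ j₀ → p ∈ Q j → ¬ G.Adj s p := by
    intro k s j p hk hs hj hp hsp
    have := LS (hQ.subset _ _ hp) hs hsp.symm
    rw [hc j hj p hp] at this
    exact hk (Option.some.inj this).symm
  obtain ⟨l, hl1, hl2, hl3⟩ := exists_avoid_three hm (some k) (label G S y') (some i)
  obtain ⟨s', hs'⟩ := hS.nonempty l
  have path := hS.isPath4 trivial hy trivial hy' hyy' hs hys hy's (by grind) hl2 hs'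
  by_contra hno
  obtain ⟨a, b, hab, ⟨a1, a2, a3⟩, b1, b2, b3⟩ := exists_two_avoid_three hn (label G Q y)
    (label G Q y') (some j₀) (by
      by_cases h5 : 5 ≤ n
      · exact .inl h5
      · exact .inr fun h => hno ⟨by omega, h.1, h.2.1, h.2.2.2.2.1, h.2.2.2.2.2, h.2.2.2.1⟩)
  obtain ⟨u, hu⟩ := hQ.nonempty a
  obtain ⟨v, hv⟩ := hQ.nonempty b
  have := hP _ _ _ _ u v path ((hQ.adj_iff _ _ _ _ hu hv).2 hab)
  have k1 := only (j := a) hk hs (by grind) hu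
  have k2 := only (j := b) hk hs (by grind) hv
  have k3 := only (j := a) (k := l) (by grind) hs' (by grind) hu
  have k4 := only (j := b) (k := l) (by grind) hs' (by grind) hv
  grind

lemma Concentrated.splitBy_left (hP : PathsDominateEdges G) (hm : 4 ≤ m) (hn : 4 ≤ n)
    (hS : Block G Set.univ S) (hQ : Block G (outside S) Q) (hc : Concentrated G S Q i j₀)
    (hy : y ∈ outside S) (hyQ : y ∈ outside Q) (hy' : y' ∈ outside S) (hy'Q : y' ∈ outside Q)
    (hyy' : G.Adj y y') {b : Fin n} (hb : b ≠ j₀) {p : V} (hp : p ∈ Q b) (hyp : G.Adj y p)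
    (hy'p : ¬ G.Adj y' p) : m < 5 ∧ SplitBy G S i y y' := by
  have LS : ∀ {x u i}, x ∈ outside S → u ∈ S i → G.Adj x u → label G S x = some i :=
    fun hx hu hxu => hS.label_eq trivial hx hu hxu
  obtain ⟨l, hl1, hl2, hl3⟩ := exists_avoid_three hn (some b) (label G Q y') (some j₀)
  obtain ⟨q, hq⟩ := hQ.nonempty l
  have path := hQ.isPath4 hy hyQ hy' hy'Q hyy' hp hyp hy'p (by grind) hl2 hq
  by_contra hno
  obtain ⟨a, c, hac, ⟨a1, a2, a3⟩, b1, b2, b3⟩ := exists_two_avoid_three hm (label G S y)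
    (label G S y') (some i) (by
      by_cases h5 : 5 ≤ m
      · exact .inl h5
      · exact .inr fun h => hno ⟨by omega, h.1, h.2.1, h.2.2.2.2.1, h.2.2.2.2.2, h.2.2.2.1⟩)
  obtain ⟨u, hu⟩ := hS.nonempty a
  obtain ⟨v, hv⟩ := hS.nonempty c
  have := hP _ _ _ _ u v path ((hS.adj_iff _ _ _ _ hu hv).2 hac)
  have h1 := hc b hb p hp
  have h2 := hc l (by grind) q hq
  have h3 := hQ.subset _ _ hp
  have h4 := hQ.subset _ _ hq
  grind

/-- Adjacent vertices distinguished by a part other than `i` are split on both sides. -/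
lemma Concentrated.splitBy (hP : PathsDominateEdges G) (hm : 4 ≤ m) (hn : 4 ≤ n)
    (hS : Block G Set.univ S) (hQ : Block G (outside S) Q) (hc : Concentrated G S Q i j₀)
    (hy : y ∈ outside S) (hyQ : y ∈ outside Q) (hy' : y' ∈ outside S) (hy'Q : y' ∈ outside Q)
    (hyy' : G.Adj y y') {k : Fin m} (hk : k ≠ i) {s : V} (hs : s ∈ S k) (hys : G.Adj y s)
    (hy's : ¬ G.Adj y' s) : m < 5 ∧ SplitBy G S i y y' := by
  obtain ⟨-, h⟩ := hc.splitBy_right hP hm hn hS hQ hy hyQ hy' hy'Q hyy' hk hs hys hy's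
  obtain ⟨b, hb⟩ := h.left
  obtain ⟨p, hp, hyp⟩ := exists_adj_of_label_eq hb
  refine hc.splitBy_left hP hm hn hS hQ hy hyQ hy' hy'Q hyy' (b := b) ?_ hp hyp fun hy'p => ?_
  · rintro rfl; exact h.left_ne hb
  · exact h.ne (hb.trans (hQ.label_eq hy' hy'Q hp hy'p).symm)

lemma getD_label_eq {A : Set V} (hS : Block G A S) (hyA : y ∈ A) (hy : y ∈ outside S)
    (hyA' : y' ∈ A) (hy' : y' ∈ outside S)
    (h : ∀ k ≠ i, ∀ s ∈ S k, G.Adj y s ↔ G.Adj y' s) :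
    (label G S y).getD i = (label G S y').getD i := by
  have key : ∀ z ∈ A, z ∈ outside S → ∀ z' ∈ A, z' ∈ outside S →
      (∀ k ≠ i, ∀ s ∈ S k, G.Adj z s ↔ G.Adj z' s) → ∀ k ≠ i,
      label G S z = some k → label G S z' = some k := by
    intro z hzA hz z' hzA' hz' h k hk hl
    obtain ⟨s, hs, hzs⟩ := exists_adj_of_label_eq hl
    exact hS.label_eq hzA' hz' hs ((h k hk s hs).1 hzs)
  have k1 := key y hyA hy y' hyA' hy' h
  have k2 := key y' hyA' hy' y hyA hy fun k hk s hs => (h k hk s hs).symm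
  cases h1 : label G S y with
  | none =>
    cases h2 : label G S y' with
    | none => rfl
    | some b =>
      by_cases hb : b = i
      · simp [hb]
      · have := k2 b hb h2
        grind
  | some a =>
    by_cases ha : a = i
    · cases h2 : label G S y' with
      | none => simp [ha]
      | some b =>
        by_cases hb : b = i
        · simp [ha, hb]
        · have := k2 b hb h2
          grind
    · rw [k1 a ha h1]

end Concentrated

section Concentrated

variable {m n : ℕ} {S : Fin m → Set V} {Q : Fin n → Set V} {i : Fin m} {j₀ : Fin n} {y y' : V}

open Classical in
/-- The colour equal to the index of the part in `S`, or given by `φ` on the parts of `Q`. -/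
noncomputable def partColor (S : Fin m → Set V) (Q : Fin n → Set V) (φ : Fin n → ℕ) (x : V) : ℕ :=
  if h : ∃ i, x ∈ S i then h.choose else if h : ∃ j, x ∈ Q j then φ h.choose else 0

lemma partColor_left {A : Set V} (hS : Block G A S) (φ : Fin n → ℕ) {x : V} (hx : x ∈ S i) :
    partColor S Q φ x = i := by
  have hx' : ∃ i, x ∈ S i := ⟨i, hx⟩
  unfold partColor
  rw [dif_pos hx', hS.index_unique hx'.choose_spec hx]

lemma partColor_right {A : Set V} (hQ : Block G A Q) (φ : Fin n → ℕ) {x : V} {j : Fin n}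
    (hxS : x ∈ outside S) (hx : x ∈ Q j) : partColor S Q φ x = φ j := by
  have hx' : ∃ j, x ∈ Q j := ⟨j, hx⟩
  have hxS' : ¬ ∃ i, x ∈ S i := fun ⟨i, hi⟩ => hxS i hi
  unfold partColor
  rw [dif_neg hxS', dif_pos hx', hQ.index_unique hx'.choose_spec hx]

lemma Concentrated.colorable [Finite V] (hP : PathsDominateEdges G) (hm : 4 ≤ m) (hn : 4 ≤ n)
    (hnm : n ≤ m) (hS : Block G Set.univ S) (hQ : Block G (outside S) Q)
    (hc : Concentrated G S Q i j₀)
    (hno : ∀ y ∈ outside S, y ∈ outside Q → ∀ y' ∈ outside S, y' ∈ outside Q → G.Adj y y' →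
      ¬ (m < 5 ∧ SplitBy G S i y y'))
    (hω : CliqueBound G Set.univ m) : G.Colorable ((4 * m + 2) / 3) := by
  classical
  let φ : Fin n → ℕ := fun j =>
    if j = j₀ then m else Equiv.swap (Fin.castLE hnm j₀) i (Fin.castLE hnm j)
  have LS : ∀ {x u i}, x ∈ outside S → u ∈ S i → G.Adj x u → label G S x = some i :=
    fun hx hu hxu => hS.label_eq trivial hx hu hxu
  have φ0 : φ j₀ = m := by simp [φ]
  have φ1 : ∀ j, j ≠ j₀ → φ j < m ∧ φ j ≠ i := by
    intro j hj
    simp only [φ, hj, if_false]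
    refine ⟨Fin.is_lt _, fun h => hj ?_⟩
    have h' := Fin.ext h
    rw [Equiv.swap_apply_eq_iff, Equiv.swap_apply_right] at h'
    exact Fin.castLE_injective hnm h'
  have φinj : ∀ j j', j ≠ j' → φ j ≠ φ j' := by
    intro j j' hjj
    by_cases hj : j = j₀
    · have := φ1 j' (hj ▸ hjj.symm)
      rw [hj, φ0]; omega
    by_cases hj' : j' = j₀
    · have := φ1 j hj
      rw [hj', φ0]; omega
    simp only [φ, hj, hj', if_false]
    intro h
    exact hjj (Fin.castLE_injective hnm ((Equiv.injective _) (Fin.ext h)))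
  have φN : ∀ j, φ j ≤ m := by
    intro j
    by_cases hj : j = j₀
    · rw [hj, φ0]
    · exact (φ1 j hj).1.le
  have cases : ∀ x ∉ outside S ∩ outside Q, (∃ i, x ∈ S i) ∨ ∃ j, x ∈ Q j := by
    intro x hx
    by_contra! hno
    exact hx ⟨hno.1, hno.2⟩
  have colS : ∀ {x k}, x ∈ S k → partColor S Q φ x = k := partColor_left hS φ
  have colQ : ∀ {x j}, x ∈ Q j → partColor S Q φ x = φ j := fun hx =>
    partColor_right hQ φ (hQ.subset _ _ hx) hx
  refine colorable_of_cells (outside S ∩ outside Q) (partColor S Q φ)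
    (fun x => ((label G S x).getD i, (label G Q x).getD j₀)) (fun a => {(a.1 : ℕ), φ a.2})
    ?_ ?_ ?_ ?_ ?_
  · intro x hx
    rcases cases x hx with ⟨k, hk⟩ | ⟨j, hj⟩
    · rw [colS hk]; have := k.is_lt; omega
    · rw [colQ hj]; have := φN j; omega
  · have mixed : ∀ k j x y, x ∈ S k → y ∈ Q j → G.Adj x y →
        partColor S Q φ x ≠ partColor S Q φ y := by
      intro k j x y hx hy hxy
      rw [colS hx, colQ hy]
      by_cases hj : j = j₀
      · rw [hj, φ0]; have := k.is_lt; omega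
      · have h1 := LS (hQ.subset _ _ hy) hx hxy.symm
        rw [hc j hj y hy] at h1
        rw [← Option.some.inj h1]
        exact (φ1 j hj).2.symm
    intro x hx y hy hxy
    rcases cases x hx with ⟨k, hi⟩ | ⟨k, hi⟩ <;> rcases cases y hy with ⟨j, hj⟩ | ⟨j, hj⟩
    · rw [colS hi, colS hj]
      exact fun h => (hS.adj_iff _ _ _ _ hi hj).1 hxy (Fin.ext h)
    · exact mixed k j x y hi hj hxy
    · exact (mixed j k y x hj hi hxy.symm).symm
    · rw [colQ hi, colQ hj]
      exact φinj _ _ ((hQ.adj_iff _ _ _ _ hi hj).1 hxy)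
  · intro x hx y hy hxy
    rcases cases x hx with ⟨k, hi⟩ | ⟨k, hi⟩
    · rw [colS hi]
      simp [LS hy.1 hi hxy.symm]
    · rw [colQ hi]
      simp [hQ.label_eq hy.1 hy.2 hi hxy.symm]
  · rintro x ⟨hx, hxQ⟩ y ⟨hy, hyQ⟩ hxy
    refine Prod.ext_iff.mpr ⟨getD_label_eq hS trivial hx trivial hy fun k hk s hs => ⟨fun h => ?_,
      fun h => ?_⟩, getD_label_eq hQ hx hxQ hy hyQ fun k hk s hs => ⟨fun h => ?_, fun h => ?_⟩⟩
    · by_contra h'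
      exact hno x hx hxQ y hy hyQ hxy (hc.splitBy hP hm hn hS hQ hx hxQ hy hyQ hxy hk hs h h')
    · by_contra h'
      exact hno y hy hyQ x hx hxQ hxy.symm
        (hc.splitBy hP hm hn hS hQ hy hyQ hx hxQ hxy.symm hk hs h h')
    · by_contra h'
      exact hno x hx hxQ y hy hyQ hxy (hc.splitBy_left hP hm hn hS hQ hx hxQ hy hyQ hxy hk hs h h')
    · by_contra h'
      exact hno y hy hyQ x hx hxQ hxy.symm
        (hc.splitBy_left hP hm hn hS hQ hy hyQ hx hxQ hxy.symm hk hs h h')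
  · rintro ⟨a, b⟩
    obtain ⟨k, l, hkl, ⟨hk, hk'⟩, hl, hl'⟩ := exists_two_avoid_two hm (some a) (some i)
    have avoid : ∀ k, some a ≠ some k → some i ≠ some k →
        ∀ x ∈ {y | y ∈ outside S ∩ outside Q ∧
          ((label G S y).getD i, (label G Q y).getD j₀) = (a, b)}, ∀ u ∈ S k, ¬ G.Adj x u := by
      intro k hk hk' x hx u hu hxu
      have := congrArg Prod.fst hx.2
      simp only [LS hx.1.1 hu hxu, Option.getD_some] at this
      exact hk (by rw [this])
    refine ⟨_, le_rfl, hS.setColorable hP hkl (avoid k hk hk') (avoid l hl hl')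
      (hω.mono (fun _ _ => trivial) ?_)⟩
    have h2 := Finset.le_card_sdiff {(a : ℕ), φ b} (Finset.range ((4 * m + 2) / 3))
    have h3 : ({(a : ℕ), φ b} : Finset ℕ).card ≤ 2 := Finset.card_le_two
    rw [Finset.card_range] at h2
    change m ≤ (Finset.range ((4 * m + 2) / 3) \ {(a : ℕ), φ b}).card
    omega

end Concentrated

/-- `y` and `y'` see distinct parts of `S`. -/
def Distinct (G : SimpleGraph V) {m : ℕ} (S : Fin m → Set V) (y y' : V) : Prop :=
  (∃ i, label G S y = some i) ∧ (∃ i, label G S y' = some i) ∧ label G S y ≠ label G S y'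

/-- Two parts of `Q` see only part `x`, respectively only part `x'`, of `S`. -/
structure PureAt (G : SimpleGraph V) {m n : ℕ} (S : Fin m → Set V) (Q : Fin n → Set V)
    (b c : Fin n) (x x' : Fin m) : Prop where
  ne : b ≠ c
  ne' : x ≠ x'
  left : ∀ p ∈ Q b, label G S p = some x
  right : ∀ p ∈ Q c, label G S p = some x'

section four

variable {S Q : Fin 4 → Set V} {y y' : V}

lemma exists_three_avoid (a b : Option (Fin 4))
    (h : ¬ ((∃ i, a = some i) ∧ (∃ i, b = some i) ∧ a ≠ b)) :
    ∃ i j k, i ≠ j ∧ i ≠ k ∧ j ≠ k ∧ (a ≠ some i ∧ b ≠ some i) ∧ (a ≠ some j ∧ b ≠ some j) ∧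
      a ≠ some k ∧ b ≠ some k := by
  revert a b
  decide

lemma false_of_four_pairs {i k l l' : Fin 4} (h : i ≠ k) (hi : l ≠ i) (hk : l ≠ k) (hi' : l' ≠ i)
    (hk' : l' ≠ k) (hl : l ≠ l') (o : Fin 3 → Option (Fin 4))
    (ho : ∀ a b, a ≠ b → ∀ x, (x = i ∨ x = k) → ∀ z, (z = l ∨ z = l') →
      (o a = some x ∨ o a = some z) ∨ (o b = some x ∨ o b = some z)) : False := by
  have h1 := ho 0 1 (by decide)
  have h2 := ho 0 2 (by decide)
  have h3 := ho 1 2 (by decide)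
  simp only [forall_eq_or_imp, forall_eq] at h1 h2 h3
  generalize o 0 = a at *
  generalize o 1 = b at *
  generalize o 2 = c at *
  clear ho
  grind (splits := 40)

lemma BlockPair.adj_or_label (hP : PathsDominateEdges G) (h : BlockPair G S Q)
    (hy : y ∈ outside S) (hyQ : y ∈ outside Q) (hy' : y' ∈ outside S) (hy'Q : y' ∈ outside Q)
    (hyy' : G.Adj y y') {i : Fin 4} {s : V} (hs : s ∈ S i) (hys : G.Adj y s)
    (hy's : ¬ G.Adj y' s) {l : Fin 4} (hli : l ≠ i) (hl : label G S y' ≠ some l)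
    {b c : Fin 4} (hbc : b ≠ c) (hb : label G Q y ≠ some b ∧ label G Q y' ≠ some b)
    (hc : label G Q y ≠ some c ∧ label G Q y' ≠ some c) {p q : V} (hp : p ∈ Q b) (hq : q ∈ Q c) :
    (G.Adj s p ∨ label G S p = some l) ∨ (G.Adj s q ∨ label G S q = some l) := by
  have LS : ∀ {x u i}, x ∈ outside S → u ∈ S i → G.Adj x u → label G S x = some i :=
    fun hx hu hxu => h.left.label_eq trivial hx hu hxu
  have LQ : ∀ {x u i}, x ∈ outside Q → u ∈ Q i → G.Adj x u → label G Q x = some i :=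
    fun hx hu hxu => h.right.label_eq trivial hx hu hxu
  obtain ⟨s', hs'⟩ := h.left.nonempty l
  have path := h.left.isPath4 trivial hy trivial hy' hyy' hs hys hy's hli hl hs'
  have := hP _ _ _ _ p q path ((h.right.adj_iff _ _ _ _ hp hq).2 hbc)
  have h3 := h.symm.mem_outside_right hp
  have h4 := h.symm.mem_outside_right hq
  grind [SimpleGraph.adj_comm]

lemma BlockPair.distinct_right (hP : PathsDominateEdges G) (h : BlockPair G S Q)
    (hy : y ∈ outside S) (hyQ : y ∈ outside Q) (hy' : y' ∈ outside S) (hy'Q : y' ∈ outside Q)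
    (hyy' : G.Adj y y') {i : Fin 4} {s : V} (hs : s ∈ S i) (hys : G.Adj y s)
    (hy's : ¬ G.Adj y' s) : Distinct G Q y y' := by
  by_contra hno
  have LS : ∀ {x u i}, x ∈ outside S → u ∈ S i → G.Adj x u → label G S x = some i :=
    fun hx hu hxu => h.left.label_eq trivial hx hu hxu
  have LQ : ∀ {x u i}, x ∈ outside Q → u ∈ Q i → G.Adj x u → label G Q x = some i :=
    fun hx hu hxu => h.right.label_eq trivial hx hu hxu
  have adj : ∀ {l}, l ≠ i → label G S y' ≠ some l → ∀ {b c p q}, b ≠ c →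
      (label G Q y ≠ some b ∧ label G Q y' ≠ some b) →
      (label G Q y ≠ some c ∧ label G Q y' ≠ some c) → p ∈ Q b → q ∈ Q c →
      (G.Adj s p ∨ label G S p = some l) ∨ (G.Adj s q ∨ label G S q = some l) :=
    fun hli hl => fun hbc hb hc hp hq =>
      h.adj_or_label hP hy hyQ hy' hy'Q hyy' hs hys hy's hli hl hbc hb hc hp hq
  by_cases hk : ∃ k, k ≠ i ∧ label G S y' = some k
  · obtain ⟨k, hki, hk⟩ := hk
    obtain ⟨s', hs', hys'⟩ := exists_adj_of_label_eq hk
    have hyi := LS hy hs hys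
    have hys'2 : ¬ G.Adj y s' := fun h' => by have := LS hy hs' h'; grind
    obtain ⟨l, hl⟩ := exists_ne_three le_rfl i k k
    obtain ⟨l', hl'⟩ := exists_ne_three le_rfl i k l
    obtain ⟨b0, b1, b2, n01, n02, n12, ha⟩ := exists_three_avoid _ _ hno
    let b : Fin 3 → Fin 4 := ![b0, b1, b2]
    have hb : ∀ j, label G Q y ≠ some (b j) ∧ label G Q y' ≠ some (b j) := by
      intro j; fin_cases j
      exacts [ha.1, ha.2.1, ha.2.2]
    have hbne : ∀ j j', j ≠ j' → b j ≠ b j' := by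
      intro j j' hj; fin_cases j <;> fin_cases j' <;> simp [b] at hj ⊢ <;> grind
    choose p hp using fun j => h.right.nonempty (b j)
    refine false_of_four_pairs hki.symm hl.1 hl.2.1 hl'.1 hl'.2.1 hl'.2.2.symm
      (fun j => label G S (p j)) ?_
    intro a c hac x hx z hz
    have hpa := h.symm.mem_outside_right (hp a)
    have hpc := h.symm.mem_outside_right (hp c)
    have toLabel : ∀ {t w u}, w ∈ outside S → t ∈ S u → G.Adj t w → label G S w = some u :=
      fun hw ht htw => LS hw ht htw.symm
    rcases hx with rfl | rfl
    · have := adj (l := z) (by grind) (by grind) (hbne a c hac) (hb a) (hb c) (hp a) (hp c)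
      have t1 := toLabel (t := s) hpa hs
      have t2 := toLabel (t := s) hpc hs
      grind
    · have := h.adj_or_label hP hy' hy'Q hy hyQ hyy'.symm hs' hys' hys'2 (l := z) (by grind)
        (by grind) (hbne a c hac) (hb a).symm (hb c).symm (hp a) (hp c)
      have t1 := toLabel (t := s') hpa hs'
      have t2 := toLabel (t := s') hpc hs'
      grind
  · have hsQ := h.mem_outside_right hs
    obtain ⟨b, c, hbc, ⟨b1, b2, b3⟩, c1, c2, c3⟩ := exists_two_avoid_three le_rfl (label G Q y)
      (label G Q y') (label G Q s) (.inr fun h' => hno ⟨h'.1, h'.2.1, h'.2.2.2.1⟩)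
    obtain ⟨p, hp⟩ := h.right.nonempty b
    obtain ⟨q, hq⟩ := h.right.nonempty c
    obtain ⟨l, hl1, hl2, hl3⟩ := exists_avoid_three le_rfl (some i) (label G S p) (label G S q)
    have := adj (l := l) (by grind) (by grind) hbc ⟨b1, b2⟩ ⟨c1, c2⟩ hp hq
    grind

lemma Distinct.exists_adj (h : Distinct G S y y') {A : Set V} (hS : Block G A S) (hy' : y' ∈ A)
    (hy'S : y' ∈ outside S) : ∃ i, ∃ s ∈ S i, G.Adj y s ∧ ¬ G.Adj y' s := by
  obtain ⟨⟨i, hi⟩, -, hne⟩ := h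
  obtain ⟨s, hs, hys⟩ := exists_adj_of_label_eq hi
  exact ⟨i, s, hs, hys, fun h' => hne (hi.trans (hS.label_eq hy' hy'S hs h').symm)⟩

lemma BlockPair.distinct (hP : PathsDominateEdges G) (h : BlockPair G S Q)
    (hy : y ∈ outside S) (hyQ : y ∈ outside Q) (hy' : y' ∈ outside S) (hy'Q : y' ∈ outside Q)
    (hyy' : G.Adj y y') {i : Fin 4} {s : V} (hs : s ∈ S i) (hys : G.Adj y s)
    (hy's : ¬ G.Adj y' s) : Distinct G S y y' ∧ Distinct G Q y y' := by
  have hQ := h.distinct_right hP hy hyQ hy' hy'Q hyy' hs hys hy's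
  obtain ⟨j, p, hp, hyp, hy'p⟩ := hQ.exists_adj h.right trivial hy'Q
  exact ⟨h.symm.distinct_right hP hyQ hy hy'Q hy' hyy' hp hyp hy'p, hQ⟩

lemma BlockPair.exists_distinct (hP : PathsDominateEdges G) (h : BlockPair G S Q)
    (hno : ¬ Homogeneous G S Q) : ∃ y ∈ outside S, y ∈ outside Q ∧ ∃ y' ∈ outside S,
      y' ∈ outside Q ∧ G.Adj y y' ∧ Distinct G S y y' ∧ Distinct G Q y y' := by
  by_contra! hd
  refine hno fun y hy hyQ y' hy' hy'Q hyy' => ⟨fun i s hs hys => ?_, fun j p hp hyp => ?_⟩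
  · by_contra hy's
    have := h.distinct hP hy hyQ hy' hy'Q hyy' hs hys hy's
    exact hd y hy hyQ y' hy' hy'Q hyy' this.1 this.2
  · by_contra hy'p
    have := h.symm.distinct hP hyQ hy hy'Q hy' hyy' hp hyp hy'p
    exact hd y hy hyQ y' hy' hy'Q hyy' this.2 this.1

lemma exists_complement {i k : Fin 4} (h : i ≠ k) : ∃ l l' : Fin 4, l ≠ l' ∧ l ≠ i ∧ l ≠ k ∧
    l' ≠ i ∧ l' ≠ k := by
  revert i k
  decide

lemma pure_of_pairs {i k l l' : Fin 4} (h : i ≠ k) (hl : l ≠ l') (hi : l ≠ i) (hk : l ≠ k)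
    (hi' : l' ≠ i) (hk' : l' ≠ k) {X Y : Set (Option (Fin 4))} {o o' : Option (Fin 4)}
    (ho : o ∈ X) (ho' : o' ∈ Y)
    (hXY : ∀ a ∈ X, ∀ b ∈ Y, ∀ x, (x = i ∨ x = k) → ∀ z, (z = l ∨ z = l') →
      (a = some x ∨ a = some z) ∨ (b = some x ∨ b = some z)) :
    ∃ x x', x ≠ x' ∧ (∀ a ∈ X, a = some x) ∧ ∀ b ∈ Y, b = some x' := by
  simp only [forall_eq_or_imp, forall_eq] at hXY
  have h0 := hXY o ho o' ho'
  rcases o with _ | x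
  · grind
  rcases o' with _ | x'
  · grind
  refine ⟨x, x', ?_, fun a ha => ?_, fun b hb => ?_⟩
  · grind
  · have := hXY a ha _ ho'
    grind
  · have := hXY _ ho b hb
    grind

lemma BlockPair.exists_pureAt (hP : PathsDominateEdges G) (h : BlockPair G S Q)
    (hno : ¬ Homogeneous G S Q) : ∃ b c x x', PureAt G S Q b c x x' := by
  obtain ⟨y, hy, hyQ, y', hy', hy'Q, hyy', hS, hQ⟩ := h.exists_distinct hP hno
  obtain ⟨⟨i, hi⟩, ⟨k, hk⟩, hik⟩ := hS
  obtain ⟨⟨j, hj⟩, ⟨j', hj'⟩, hjj⟩ := hQ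
  have LS : ∀ {x u i}, x ∈ outside S → u ∈ S i → G.Adj x u → label G S x = some i :=
    fun hx hu hxu => h.left.label_eq trivial hx hu hxu
  obtain ⟨s, hs, hys⟩ := exists_adj_of_label_eq hi
  obtain ⟨s', hs', hys'⟩ := exists_adj_of_label_eq hk
  have hy's : ¬ G.Adj y' s := fun h' => by have := LS hy' hs h'; grind
  have hys'2 : ¬ G.Adj y s' := fun h' => by have := LS hy hs' h'; grind
  have hik' : i ≠ k := by grind
  obtain ⟨l, l', hl, h1, h2, h3, h4⟩ := exists_complement hik'
  obtain ⟨b, c, hbc, b1, b2, c1, c2⟩ := exists_complement (show j ≠ j' by grind)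
  obtain ⟨p₀, hp₀⟩ := h.right.nonempty b
  obtain ⟨q₀, hq₀⟩ := h.right.nonempty c
  obtain ⟨x, x', hx, hX, hY⟩ := pure_of_pairs hik' hl h1 h2 h3 h4
    (X := label G S '' Q b) (Y := label G S '' Q c) ⟨p₀, hp₀, rfl⟩ ⟨q₀, hq₀, rfl⟩ (by
      rintro _ ⟨p, hp, rfl⟩ _ ⟨q, hq, rfl⟩ x hx z hz
      have hpS := h.symm.mem_outside_right hp
      have hqS := h.symm.mem_outside_right hq
      have toLabel : ∀ {t w u}, w ∈ outside S → t ∈ S u → G.Adj t w → label G S w = some u :=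
        fun hw ht htw => LS hw ht htw.symm
      rcases hx with rfl | rfl
      · have := h.adj_or_label hP hy hyQ hy' hy'Q hyy' hs hys hy's (l := z) (by grind) (by grind)
          hbc (by grind) (by grind) hp hq
        have t1 := toLabel (t := s) hpS hs
        have t2 := toLabel (t := s) hqS hs
        grind
      · have := h.adj_or_label hP hy' hy'Q hy hyQ hyy'.symm hs' hys' hys'2 (l := z) (by grind)
          (by grind) hbc (by grind) (by grind) hp hq
        have t1 := toLabel (t := s') hpS hs'
        have t2 := toLabel (t := s') hqS hs'
        grind)
  exact ⟨b, c, x, x', hbc, hx, fun p hp => hX _ ⟨p, hp, rfl⟩, fun p hp => hY _ ⟨p, hp, rfl⟩⟩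

end four

section transversal

variable {S Q Q' : Fin 4 → Set V} {e : Fin 4 → V}

lemma Block.exists_mem_of_two {A : Set V} (hQ : Block G A Q) (heA : ∀ i, e i ∈ A)
    (he : ∀ i j, i ≠ j → G.Adj (e i) (e j)) {i j : Fin 4} (hij : i ≠ j)
    (hi : e i ∉ outside Q) (hj : e j ∉ outside Q) (c : Fin 4) : ∃ k, e k ∈ Q c := by
  have hmem : ∀ k, ∃ a, e k ∈ Q a := by
    intro k
    by_contra! hk
    simp only [outside, Set.mem_ofPred_eq, not_forall, not_not] at hi hj
    obtain ⟨a, ha⟩ := hi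
    obtain ⟨b, hb⟩ := hj
    have hki : k ≠ i := by rintro rfl; exact hk a ha
    have hkj : k ≠ j := by rintro rfl; exact hk b hb
    exact (hQ.adj_iff _ _ _ _ ha hb).1 (he i j hij)
      (hQ.unique _ (heA k) hk _ _ _ _ ha hb (he k i hki) (he k j hkj))
  choose f hf using hmem
  have hinj : Function.Injective f := fun k l hkl => by
    by_contra hne
    exact (hQ.adj_iff _ _ _ _ (hf k) (hf l)).1 (he k l hne) hkl
  obtain ⟨k, hk⟩ := Finite.surjective_of_injective hinj c
  exact ⟨k, hk ▸ hf k⟩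

/-- Some two vertices of the transversal `e` see parts of `S` in different classes of `h`. -/
def Separates (G : SimpleGraph V) (S : Fin 4 → Set V) (h : Fin 4 → Bool) (e : Fin 4 → V) : Prop :=
  ∃ i j a b, label G S (e i) = some a ∧ label G S (e j) = some b ∧ h a ≠ h b

lemma Block.colorable_of_separates [Finite V] (hP : PathsDominateEdges G) (hG : NoHVN G)
    (hS : Block G Set.univ S) (hR : CliqueBound G (outside S) 4) (h : Fin 4 → Bool)
    (h2 : ∀ b, ∃ i j, i ≠ j ∧ h i = b ∧ h j = b)
    (h3 : ∀ b, (Finset.univ.filter (h · = b)).card ≤ 3)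
    (hsep : ∀ Q : Fin 4 → Set V, Block G (outside S) Q → ∀ e : Fin 4 → V, (∀ i, e i ∈ Q i) →
      Separates G S h e) : G.Colorable 6 := by
  refine hS.colorable_of_split hP h (fun _ => 3) h2 h3 fun b K hK hc => ?_
  by_contra! hlt
  obtain ⟨K', hK', hcard⟩ := Finset.exists_subset_card_eq hlt
  obtain ⟨Q, hQ, hQK⟩ := hG.exists_block le_rfl hR (fun x hx => (hK x (hK' hx)).1)
    (hc.subset (Finset.coe_subset.mpr hK')) hcard
  choose e heK he using hQK
  obtain ⟨i, j, x, y, hx, hy, hxy⟩ := hsep Q hQ e he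
  have h1 := (hK _ (hK' (heK i))).2 x hx
  have h2 := (hK _ (hK' (heK j))).2 y hy
  exact hxy ((Bool.eq_not.mpr h1).trans (Bool.eq_not.mpr h2).symm)

lemma BlockPair.distinct_of_label_ne (hP : PathsDominateEdges G) (h : BlockPair G S Q) {y y' : V}
    (hy : y ∈ outside S) (hyQ : y ∈ outside Q) (hy' : y' ∈ outside S) (hy'Q : y' ∈ outside Q)
    (hyy' : G.Adj y y') (hne : label G S y ≠ label G S y') :
    Distinct G S y y' ∧ Distinct G Q y y' := by
  by_contra hno
  refine hne (label_eq_of_forall_adj_iff fun i s hs => ⟨fun hys => ?_, fun hys => ?_⟩)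
  · by_contra hy's
    exact hno (h.distinct hP hy hyQ hy' hy'Q hyy' hs hys hy's)
  · by_contra hy's
    obtain ⟨⟨h1, h2, h3⟩, h4, h5, h6⟩ := h.distinct hP hy' hy'Q hy hyQ hyy'.symm hs hys hy's
    exact hno ⟨⟨h2, h1, h3.symm⟩, h5, h4, h6.symm⟩

variable {b₀ c₀ b c a : Fin 4} {x x' z z' : Fin 4}

lemma BlockPair.label_of_one_mem (hP : PathsDominateEdges G) (h : BlockPair G S Q)
    (hp : PureAt G S Q b₀ c₀ x x') (hQ' : Block G (outside S) Q') (hp' : PureAt G S Q' b c z z')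
    (he : ∀ i, e i ∈ Q' i) {d : Fin 4} (hd : e d ∈ Q a) (hout : ∀ j ≠ d, e j ∈ outside Q) :
    (label G S (e d) = some x ∧ ∀ j ≠ d, label G S (e j) = some x') ∨
      (label G S (e d) = some x' ∧ ∀ j ≠ d, label G S (e j) = some x) := by
  have adj : ∀ i j, i ≠ j → G.Adj (e i) (e j) := fun i j => (hQ'.adj_iff _ _ _ _ (he i) (he j)).2
  have heS : ∀ i, e i ∈ outside S := fun i => hQ'.subset _ _ (he i)
  have lQ : ∀ j ≠ d, label G Q (e j) = some a := fun j hj =>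
    h.right.label_eq trivial (hout j hj) hd (adj j d hj)
  have twin : ∀ j ≠ d, ∀ j' ≠ d, label G S (e j) = label G S (e j') := by
    intro j hj j' hj'
    by_contra hne
    have hjj : j ≠ j' := by rintro rfl; exact hne rfl
    exact (h.distinct_of_label_ne hP (heS j) (hout j hj) (heS j') (hout j' hj')
      (adj j j' hjj) hne).2.2.2 ((lQ j hj).trans (lQ j' hj').symm)
  obtain ⟨β, hβ⟩ : ∃ β, ∀ j ≠ d, label G S (e j) = some β := by
    by_cases hbd : b = d
    · have hcd : c ≠ d := fun h' => hp'.ne (hbd.trans h'.symm)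
      exact ⟨z', fun j hj => (twin j hj c hcd).trans (hp'.right _ (he c))⟩
    · exact ⟨z, fun j hj => (twin j hj b hbd).trans (hp'.left _ (he b))⟩
  have pure : ∀ t ≠ a, ∀ p ∈ Q t, ∀ k, label G S p = some k → k = β := by
    intro t hta p hpt k hk
    by_contra hkβ
    obtain ⟨s, hs, hps⟩ := exists_adj_of_label_eq hk
    obtain ⟨j, hj, -⟩ := exists_ne_three le_rfl d d d
    obtain ⟨j', hj', -, hjj'⟩ := exists_ne_three le_rfl d d j
    obtain ⟨t', ht't, ht'a, -⟩ := exists_ne_three le_rfl t a a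
    obtain ⟨q, hq⟩ := h.right.nonempty t'
    obtain ⟨l, hl1, hl2, hl3⟩ := exists_avoid_three le_rfl (some k) (some β) (label G S q)
    obtain ⟨s', hs'⟩ := h.left.nonempty l
    have hpS := h.symm.mem_outside_right hpt
    have hqS := h.symm.mem_outside_right hq
    have hsQ := h.mem_outside_right hs
    have path : IsPath4 G s' s p q := ⟨(h.left.adj_iff _ _ _ _ hs' hs).2 (by grind), hps.symm,
      (h.right.adj_iff _ _ _ _ hpt hq).2 ht't.symm,
      fun h' => by have := h.left.label_eq trivial hpS hs' h'.symm; grind,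
      fun h' => hl3 (h.left.label_eq trivial hqS hs' h'.symm),
      fun h' => ht't (h.right.unique s trivial hsQ _ _ _ _ hq hpt h' hps.symm)⟩
    have miss : ∀ j ≠ d, ¬ (G.Adj s' (e j) ∨ G.Adj s (e j) ∨ G.Adj p (e j) ∨ G.Adj q (e j)) := by
      intro j hj
      have h1 := hβ j hj
      have h2 := lQ j hj
      rintro (h' | h' | h' | h')
      · have := h.left.label_eq trivial (heS j) hs' h'.symm; grind
      · have := h.left.label_eq trivial (heS j) hs h'.symm; grind
      · have := h.right.label_eq trivial (hout j hj) hpt h'.symm; grind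
      · have := h.right.label_eq trivial (hout j hj) hq h'.symm; grind
    exact (hP _ _ _ _ _ _ path (adj j j' hjj'.symm)).elim (miss j hj) (miss j' hj')
  obtain ⟨p, hpb⟩ := h.right.nonempty b₀
  obtain ⟨q, hqc⟩ := h.right.nonempty c₀
  have h1 := hp.left p hpb
  have h2 := hp.right q hqc
  by_cases hb : b₀ = a
  · subst hb
    have := pure c₀ hp.ne.symm q hqc x' h2
    subst this
    exact .inl ⟨hp.left _ hd, hβ⟩
  have hx := pure b₀ hb p hpb x h1
  by_cases hc : c₀ = a
  · subst hc hx
    exact .inr ⟨hp.right _ hd, hβ⟩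
  · exact absurd (hx.trans (pure c₀ hc q hqc x' h2).symm) hp.ne'

lemma BlockPair.separates_of_outside (hP : PathsDominateEdges G) (hG : NoHVN G)
    (h : BlockPair G S Q) (hp : PureAt G S Q b₀ c₀ x x')
    (hQ' : Block G (outside S) Q') (hp' : PureAt G S Q' b c z z') (he : ∀ i, e i ∈ Q' i)
    (hout : ∀ i, e i ∈ outside Q) {g : Fin 4 → Bool} (hg : g x ≠ g x') : Separates G S g e := by
  classical
  have adj : ∀ i j, i ≠ j → G.Adj (e i) (e j) := fun i j => (hQ'.adj_iff _ _ _ _ (he i) (he j)).2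
  have heS : ∀ i, e i ∈ outside S := fun i => hQ'.subset _ _ (he i)
  have lz := hp'.left _ (he b)
  have lz' := hp'.right _ (he c)
  have dist : ∀ i j, label G S (e i) ≠ label G S (e j) →
      Distinct G S (e i) (e j) ∧ Distinct G Q (e i) (e j) := by
    intro i j hne
    exact h.distinct_of_label_ne hP (heS i) (hout i) (heS j) (hout j)
      (adj i j (by rintro rfl; exact hne rfl)) hne
  have other : ∀ i, ∃ j, label G S (e i) ≠ label G S (e j) := by
    intro i
    by_cases hi : label G S (e i) = some z
    · exact ⟨c, by have := hp'.ne'; grind⟩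
    · exact ⟨b, by grind⟩
  by_cases hinj : ∀ i j, label G S (e i) = label G S (e j) → i = j
  · have hsome : ∀ i, ∃ a, label G S (e i) = some a := fun i =>
      have ⟨j, hj⟩ := other i
      (dist i j hj).1.1
    choose f hf using hsome
    have hf' : Function.Injective f := fun i j hij => hinj i j (by rw [hf, hf, hij])
    obtain ⟨i, rfl⟩ := Finite.surjective_of_injective hf' x
    obtain ⟨j, rfl⟩ := Finite.surjective_of_injective hf' x'
    exact ⟨i, j, _, _, hf i, hf j, hg⟩
  push Not at hinj
  obtain ⟨u, v, huv, hne⟩ := hinj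
  obtain ⟨j, hj⟩ := other u
  obtain ⟨q, hq⟩ := (dist u j hj).2.1
  obtain ⟨p, hpq, hup⟩ := exists_adj_of_label_eq hq
  have hvp : G.Adj (e v) p := by
    by_contra hvp
    exact (h.symm.distinct hP (hout u) (heS u) (hout v) (heS v) (adj u v hne) hpq hup hvp).2.2.2 huv
  obtain ⟨w, d, hwd, hwu, hwv, hdu, hdv, hpw⟩ : ∃ w d, w ≠ d ∧ w ≠ u ∧ w ≠ v ∧ d ≠ u ∧ d ≠ v ∧
      G.Adj p (e w) := by
    obtain ⟨w, d, hwd, hwu, hwv, hdu, hdv⟩ := exists_complement hne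
    rcases hG _ _ _ _ p (adj u v hne) (adj u w hwu.symm) (adj u d hdu.symm) (adj v w hwv.symm)
      (adj v d hdv.symm) (adj w d hwd) hup.symm hvp.symm with h' | h'
    · exact ⟨w, d, hwd, hwu, hwv, hdu, hdv, h'⟩
    · exact ⟨d, w, hwd.symm, hdu, hdv, hwu, hwv, h'⟩
  have hpS := h.symm.mem_outside_right hpq
  have hpd : p ∈ Q' d := by
    obtain ⟨t, ht⟩ : ∃ t, p ∈ Q' t := by
      by_contra! hno
      exact hne (hQ'.unique p hpS hno _ _ _ _ (he u) (he v) hup.symm hvp.symm)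
    have h1 := (hQ'.adj_iff _ _ _ _ ht (he u)).1 hup.symm
    have h2 := (hQ'.adj_iff _ _ _ _ ht (he v)).1 hvp.symm
    have h3 := (hQ'.adj_iff _ _ _ _ ht (he w)).1 hpw
    obtain rfl : t = d := by omega
    exact ht
  have he' : ∀ i, Function.update e d p i ∈ Q' i := by
    intro i
    by_cases hi : i = d
    · subst hi; simpa using hpd
    · simpa [Function.update_of_ne hi] using he i
  have key := h.label_of_one_mem hP hp hQ' hp' he' (d := d) (a := q) (by simpa using hpq)
    (fun j hj => by simpa [Function.update_of_ne hj] using hout j)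
  have upd : ∀ j ≠ d, Function.update e d p j = e j := fun j hj => Function.update_of_ne hj _ _
  have hlab : label G S (e d) = label G S p := by
    by_cases hb : b = d
    · rw [hp'.left _ (hb ▸ he d), hp'.left _ (hb ▸ hpd)]
    by_cases hc : c = d
    · rw [hp'.right _ (hc ▸ he d), hp'.right _ (hc ▸ hpd)]
    have := hp'.ne'
    grind
  rw [Function.update_self] at key
  rcases key with ⟨k1, k2⟩ | ⟨k1, k2⟩
  · have := k2 u hdu.symm
    rw [upd u hdu.symm] at this
    exact ⟨d, u, _, _, hlab.trans k1, this, hg⟩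
  · have := k2 u hdu.symm
    rw [upd u hdu.symm] at this
    exact ⟨d, u, _, _, hlab.trans k1, this, hg.symm⟩

lemma BlockPair.separates (hP : PathsDominateEdges G) (hG : NoHVN G)
    (h : BlockPair G S Q) (hp : PureAt G S Q b₀ c₀ x x')
    (hQ' : Block G (outside S) Q') (hp' : PureAt G S Q' b c z z') (he : ∀ i, e i ∈ Q' i)
    {g : Fin 4 → Bool} (hg : g x ≠ g x') : Separates G S g e := by
  have adj : ∀ i j, i ≠ j → G.Adj (e i) (e j) := fun i j => (hQ'.adj_iff _ _ _ _ (he i) (he j)).2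
  by_cases hout : ∀ i, e i ∈ outside Q
  · exact h.separates_of_outside hP hG hp hQ' hp' he hout hg
  push Not at hout
  obtain ⟨d, hd⟩ := hout
  by_cases hout : ∀ j ≠ d, e j ∈ outside Q
  · obtain ⟨a, ha⟩ : ∃ a, e d ∈ Q a := by simpa [outside] using hd
    obtain ⟨j, hj, -⟩ := exists_ne_three le_rfl d d d
    rcases h.label_of_one_mem hP hp hQ' hp' he ha hout with ⟨k1, k2⟩ | ⟨k1, k2⟩
    · exact ⟨d, j, _, _, k1, k2 j hj, hg⟩
    · exact ⟨d, j, _, _, k1, k2 j hj, hg.symm⟩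
  push Not at hout
  obtain ⟨d', hd', hout⟩ := hout
  have hall := h.right.exists_mem_of_two (fun _ => trivial) adj hd' hout hd
  obtain ⟨i, hi⟩ := hall b₀
  obtain ⟨j, hj⟩ := hall c₀
  exact ⟨i, j, _, _, hp.left _ hi, hp.right _ hj, hg⟩

end transversal

section SplitBlock

variable {S Q Q' : Fin 4 → Set V} {i κ i' κ' j₀ j₀' : Fin 4} {y y' : V}

lemma Concentrated.label_eq_of_splitBy (hP : PathsDominateEdges G) (hS : Block G Set.univ S)
    (hQ : Block G (outside S) Q) (hc : Concentrated G S Q i j₀) (hy : y ∈ outside S)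
    (hyQ : y ∈ outside Q) (hy' : y' ∈ outside S) (hy'Q : y' ∈ outside Q) (hyy' : G.Adj y y')
    (h : SplitBy G S i y y') (hκ : κ ≠ i) (hyκ : label G S y ≠ some κ)
    (hy'κ : label G S y' ≠ some κ) {p : V} (hp : p ∈ Q j₀) : label G S p = some κ := by
  have key : ∀ z ∈ outside S, z ∈ outside Q → ∀ z' ∈ outside S, z' ∈ outside Q → G.Adj z z' →
      SplitBy G S i z z' → label G S z ≠ some κ → label G S z' ≠ some κ →
      label G S p = label G S z ∨ label G S p = some κ := by
    intro z hz hzQ z' hz' hz'Q hzz' h hzκ hz'κ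
    obtain ⟨k, hk⟩ := h.left
    have hki : k ≠ i := fun h' => h.left_ne (h' ▸ hk)
    have hkκ : κ ≠ k := fun h' => hzκ (h' ▸ hk)
    obtain ⟨s, hs, hzs⟩ := exists_adj_of_label_eq hk
    have hz's : ¬ G.Adj z' s := fun h' => h.ne (hk.trans (hS.label_eq trivial hz' hs h').symm)
    obtain ⟨s', hs'⟩ := hS.nonempty κ
    have path := hS.isPath4 trivial hz trivial hz' hzz' hs hzs hz's hkκ hz'κ hs'
    have hsplit := (hc.splitBy_right hP le_rfl le_rfl hS hQ hz hzQ hz' hz'Q hzz' hki hs hzs hz's).2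
    obtain ⟨f, hf1, hf2, hf3⟩ := exists_avoid_three le_rfl (some j₀) (label G Q z) (label G Q z')
    obtain ⟨q, hq⟩ := hQ.nonempty f
    have hfj : f ≠ j₀ := by grind
    have hpS := hQ.subset _ _ hp
    have hqS := hQ.subset _ _ hq
    have hql := hc f hfj q hq
    have n1 := fun h' : G.Adj z' p => hsplit.right_ne (hQ.label_eq hz' hz'Q hp h')
    have n2 := fun h' : G.Adj z p => hsplit.left_ne (hQ.label_eq hz hzQ hp h')
    have n3 := fun h' : G.Adj z' q => hf3 (hQ.label_eq hz' hz'Q hq h')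
    have n4 := fun h' : G.Adj z q => hf2 (hQ.label_eq hz hzQ hq h')
    have n5 : ¬ G.Adj s q := fun h' => by have := hS.label_eq trivial hqS hs h'.symm; grind
    have n6 : ¬ G.Adj s' q := fun h' => by have := hS.label_eq trivial hqS hs' h'.symm; grind
    rcases hP _ _ _ _ p q path ((hQ.adj_iff _ _ _ _ hp hq).2 hfj.symm) with h' | h'
    · rcases h' with h' | h' | h' | h'
      · exact (n1 h').elim
      · exact (n2 h').elim
      · exact .inl ((hS.label_eq trivial hpS hs h'.symm).trans hk.symm)
      · exact .inr (hS.label_eq trivial hpS hs' h'.symm)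
    · exact (h'.elim n3 fun h' => h'.elim n4 fun h' => h'.elim n5 n6).elim
  have h1 := key y hy hyQ y' hy' hy'Q hyy' h hyκ hy'κ
  have h2 := key y' hy' hy'Q y hy hyQ hyy'.symm h.symm hy'κ hyκ
  have := h.ne
  grind

/-- A block outside `S` one of whose parts sees only part `κ` of `S`, while the others see only
part `i`; some edge avoiding both blocks joins vertices that see the other two parts of `S`. -/
structure SplitBlock (G : SimpleGraph V) (S Q : Fin 4 → Set V) (i κ j₀ : Fin 4) : Prop where
  block : Block G (outside S) Q
  conc : Concentrated G S Q i j₀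
  ne : κ ≠ i
  label_eq : ∀ p ∈ Q j₀, label G S p = some κ
  avoid : ∀ y ∈ outside S, y ∈ outside Q → ∀ y' ∈ outside S, y' ∈ outside Q → G.Adj y y' →
    SplitBy G S i y y' → label G S y ≠ some κ ∧ label G S y' ≠ some κ
  exists_split : ∃ y ∈ outside S, y ∈ outside Q ∧ ∃ y' ∈ outside S, y' ∈ outside Q ∧
    G.Adj y y' ∧ SplitBy G S i y y'

lemma exists_ne_avoid (S : Fin 4 → Set V) (i : Fin 4) (y y' : V) :
    ∃ κ, κ ≠ i ∧ label G S y ≠ some κ ∧ label G S y' ≠ some κ := by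
  obtain ⟨κ, h1, h2, h3⟩ := exists_avoid_three le_rfl (label G S y) (label G S y') (some i)
  exact ⟨κ, by grind, h1, h2⟩

lemma Concentrated.splitBlock (hP : PathsDominateEdges G) (hS : Block G Set.univ S)
    (hQ : Block G (outside S) Q) (hc : Concentrated G S Q i j₀)
    (hex : ∃ y ∈ outside S, y ∈ outside Q ∧ ∃ y' ∈ outside S, y' ∈ outside Q ∧
      G.Adj y y' ∧ SplitBy G S i y y') : ∃ κ, SplitBlock G S Q i κ j₀ := by
  obtain ⟨y, hy, hyQ, y', hy', hy'Q, hyy', h⟩ := id hex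
  obtain ⟨κ, hκ, hyκ, hy'κ⟩ := exists_ne_avoid S i y y'
  have hlab := fun p hp => hc.label_eq_of_splitBy hP hS hQ hy hyQ hy' hy'Q hyy' h hκ hyκ hy'κ
    (p := p) hp
  refine ⟨κ, hQ, hc, hκ, hlab, fun z hz hzQ z' hz' hz'Q hzz' h' => ?_, hex⟩
  obtain ⟨κ', hκ', hzκ, hz'κ⟩ := exists_ne_avoid S i z z'
  obtain ⟨p, hp⟩ := hQ.nonempty j₀
  have h1 := hc.label_eq_of_splitBy hP hS hQ hz hzQ hz' hz'Q hzz' h' hκ' hzκ hz'κ hp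
  obtain rfl : κ = κ' := Option.some.inj ((hlab p hp).symm.trans h1)
  exact ⟨hzκ, hz'κ⟩

lemma SplitBlock.pureAt (h : SplitBlock G S Q i κ j₀) : ∃ c, PureAt G S Q j₀ c κ i := by
  obtain ⟨c, hc, -⟩ := exists_ne_three le_rfl j₀ j₀ j₀
  exact ⟨c, hc.symm, h.ne, h.label_eq, h.conc c hc⟩

/-- A vertex common to two such blocks lies in the exceptional part of each of them. -/
lemma SplitBlock.false_of_mem (hP : PathsDominateEdges G) (hS : Block G Set.univ S)
    (h : SplitBlock G S Q i κ j₀) (h' : SplitBlock G S Q' i' κ' j₀') {a f b : Fin 4} {q u v : V}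
    (hqa : q ∈ Q a) (hqf : q ∈ Q' f) (ha : a ≠ j₀) (hu : u ∈ Q j₀) (huQ : u ∈ outside Q')
    (hv : v ∈ Q b) (hvQ : v ∈ outside Q') (hb : b ≠ j₀) (hba : b ≠ a) : False := by
  have huS := h.block.subset _ _ hu
  have hvS := h.block.subset _ _ hv
  have huv := (h.block.adj_iff _ _ _ _ hu hv).2 hb.symm
  have lu := h.label_eq u hu
  have lv := h.conc b hb v hv
  have qu := h'.block.label_eq huS huQ hqf ((h.block.adj_iff _ _ _ _ hu hqa).2 ha.symm)
  have qv := h'.block.label_eq hvS hvQ hqf ((h.block.adj_iff _ _ _ _ hv hqa).2 hba)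
  have hne := h.ne
  by_cases hκ : κ = i'
  · obtain ⟨s, hs, hvs⟩ := exists_adj_of_label_eq lv
    exact (h'.conc.splitBy_right hP le_rfl le_rfl hS h'.block hvS hvQ huS huQ huv.symm
      (fun hi => hne (hκ.trans hi.symm)) hs hvs fun hus => by
        have := hS.label_eq trivial huS hs hus; grind).2.ne (qv.trans qu.symm)
  · obtain ⟨s, hs, hus⟩ := exists_adj_of_label_eq lu
    exact (h'.conc.splitBy_right hP le_rfl le_rfl hS h'.block huS huQ hvS hvQ huv hκ hs hus
      fun hvs => by have := hS.label_eq trivial hvS hs hvs; grind).2.ne (qu.trans qv.symm)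

lemma SplitBlock.false_of_split (hP : PathsDominateEdges G) (hS : Block G Set.univ S)
    (h : SplitBlock G S Q i κ j₀) (h' : SplitBlock G S Q' i' κ j₀') {e : Fin 4 → V}
    (he : ∀ j, e j ∈ Q' j) (hmem : e j₀' ∈ Q j₀) (hout : ∀ j ≠ j₀', e j ∈ outside Q)
    (hi : i' ≠ i) (hy : y ∈ outside S) (hyQ : y ∈ outside Q) (hy' : y' ∈ outside S)
    (hy'Q : y' ∈ outside Q) (hyy' : G.Adj y y') (hsp : SplitBy G S i y y')
    (hl : label G S y = some i') : False := by
  have adj : ∀ i j, i ≠ j → G.Adj (e i) (e j) := fun i j =>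
    (h'.block.adj_iff _ _ _ _ (he i) (he j)).2
  have heS : ∀ i, e i ∈ outside S := fun i => h'.block.subset _ _ (he i)
  obtain ⟨s, hs, hys⟩ := exists_adj_of_label_eq hl
  have hsp' := (h.conc.splitBy_right hP le_rfl le_rfl hS h.block hy hyQ hy' hy'Q hyy' hi hs hys
    fun hy's => hsp.ne (hl.trans (hS.label_eq trivial hy' hs hy's).symm)).2
  obtain ⟨b, hb⟩ := hsp'.left
  have hbj : b ≠ j₀ := fun hb' => hsp'.left_ne (hb' ▸ hb)
  obtain ⟨p, hp, hyp⟩ := exists_adj_of_label_eq hb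
  have hy'p : ¬ G.Adj y' p := fun h1 => hsp'.ne (hb.trans (h.block.label_eq hy' hy'Q hp h1).symm)
  obtain ⟨d, hd1, hd2, hd3⟩ := exists_avoid_three le_rfl (some j₀) (some b) (label G Q y')
  obtain ⟨q, hq⟩ := h.block.nonempty d
  have path := h.block.isPath4 hy hyQ hy' hy'Q hyy' hp hyp hy'p (by grind) hd3 hq
  have lQ : ∀ j ≠ j₀', label G Q (e j) = some j₀ := fun j hj =>
    h.block.label_eq (heS j) (hout j hj) hmem (adj j _ hj)
  have missp : ∀ j ≠ j₀', ¬ G.Adj p (e j) := fun j hj h1 => by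
    have := h.block.label_eq (heS j) (hout j hj) hp h1.symm
    have := lQ j hj
    grind
  have missq : ∀ j ≠ j₀', ¬ G.Adj q (e j) := fun j hj h1 => by
    have := h.block.label_eq (heS j) (hout j hj) hq h1.symm
    have := lQ j hj
    grind
  have outQ' : ∀ z ∈ outside S, z ∈ outside Q → label G Q z ≠ some j₀ → label G S z ≠ some κ →
      z ∈ outside Q' := by
    intro z hz hzQ hzj hzκ t ht
    by_cases htj : t = j₀'
    · subst htj
      exact hzκ (h'.label_eq z ht)
    · exact hzj (h.block.label_eq hz hzQ hmem ((h'.block.adj_iff _ _ _ _ ht (he _)).2 htj))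
  have hav := h.avoid y hy hyQ y' hy' hy'Q hyy' hsp
  have hyQ' := outQ' y hy hyQ hsp'.left_ne hav.1
  have hy'Q' := outQ' y' hy' hy'Q hsp'.right_ne hav.2
  obtain ⟨j, hj, hyj⟩ : ∃ j, j ≠ j₀' ∧ G.Adj y (e j) := by
    by_contra! hno
    obtain ⟨j, k, hjk, ⟨hj1, hj2⟩, hk1, hk2⟩ :=
      exists_two_avoid_two le_rfl (some j₀') (label G Q' y')
    have hj : j ≠ j₀' := by grind
    have hk : k ≠ j₀' := by grind
    have miss : ∀ j ≠ j₀', label G Q' y' ≠ some j →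
        ¬ (G.Adj y' (e j) ∨ G.Adj y (e j) ∨ G.Adj p (e j) ∨ G.Adj q (e j)) := by
      rintro j hj hj2 (h1 | h1 | h1 | h1)
      exacts [hj2 (h'.block.label_eq hy' hy'Q' (he j) h1), hno j hj h1, missp j hj h1,
        missq j hj h1]
    exact (hP _ _ _ _ _ _ path (adj j k hjk)).elim (miss j hj hj2) (miss k hk hk2)
  exact (h.conc.splitBy_left hP le_rfl le_rfl hS h.block hy hyQ (heS j) (hout j hj) hyj hbj hp hyp
    fun h1 => missp j hj h1.symm).2.ne (hl.trans (h'.conc j hj _ (he j)).symm)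

lemma SplitBlock.separates_of_one_mem (hP : PathsDominateEdges G) (hS : Block G Set.univ S)
    (h : SplitBlock G S Q i κ j₀) (h' : SplitBlock G S Q' i' κ' j₀') {e : Fin 4 → V}
    (he : ∀ j, e j ∈ Q' j) {a f : Fin 4} (hmem : e f ∈ Q a) (hout : ∀ j ≠ f, e j ∈ outside Q)
    {g : Fin 4 → Bool} (hg : g κ ≠ g i) : Separates G S g e := by
  have adj : ∀ i j, i ≠ j → G.Adj (e i) (e j) := fun i j =>
    (h'.block.adj_iff _ _ _ _ (he i) (he j)).2
  have heS : ∀ i, e i ∈ outside S := fun i => h'.block.subset _ _ (he i)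
  have hpQ : ∀ c ≠ a, ∀ p ∈ Q c, p ∈ outside Q' := by
    intro c hca p hp t ht
    have hpe := (h.block.adj_iff _ _ _ _ hmem hp).2 hca.symm
    have htf : t ≠ f := ((h'.block.adj_iff _ _ _ _ ht (he f)).1 hpe.symm)
    obtain ⟨k, hkf, hkt, -⟩ := exists_ne_three le_rfl f t t
    exact hca (h.block.unique (e k) (heS k) (hout k hkf) _ _ _ _ hp hmem
      ((h'.block.adj_iff _ _ _ _ (he k) ht).2 hkt) (adj k f hkf))
  obtain rfl : a = j₀ := by
    by_contra ha
    obtain ⟨b, hb, hba, -⟩ := exists_ne_three le_rfl j₀ a a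
    obtain ⟨u, hu⟩ := h.block.nonempty j₀
    obtain ⟨v, hv⟩ := h.block.nonempty b
    exact h.false_of_mem hP hS h' hmem (he f) ha hu (hpQ _ (Ne.symm ha) _ hu) hv (hpQ _ hba _ hv)
      hb hba
  obtain rfl : f = j₀' := by
    by_contra hf
    obtain ⟨b, hb, hbf, -⟩ := exists_ne_three le_rfl j₀' f f
    exact h'.false_of_mem hP hS h (he f) hmem hf (he j₀') (hout _ (Ne.symm hf)) (he b)
      (hout _ hbf) hb hbf
  have lf := h.label_eq _ hmem
  obtain rfl : κ = κ' := Option.some.inj (lf.symm.trans (h'.label_eq _ (he f)))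
  by_cases hi : i' = i
  · subst hi
    obtain ⟨b, hb, -⟩ := exists_ne_three le_rfl f f f
    exact ⟨f, b, _, _, lf, h'.conc b hb _ (he b), hg⟩
  · obtain ⟨y, hy, hyQ, y', hy', hy'Q, hyy', hsp⟩ := h.exists_split
    have hav := h.avoid y hy hyQ y' hy' hy'Q hyy' hsp
    obtain ⟨⟨k, hk⟩, ⟨k', hk'⟩, h1, h2, h3⟩ := id hsp
    have := h'.ne
    rw [hk] at h1 h3 hav
    rw [hk'] at h2 h3 hav
    have : k = i' ∨ k' = i' := by
      have := h.ne
      simp only [ne_eq, Option.some.injEq] at h1 h2 h3 hav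
      omega
    rcases this with rfl | rfl
    · exact (h.false_of_split hP hS h' he hmem hout hi hy hyQ hy' hy'Q hyy' hsp hk).elim
    · exact (h.false_of_split hP hS h' he hmem hout hi hy' hy'Q hy hyQ hyy'.symm hsp.symm
        hk').elim

lemma SplitBlock.separates (hP : PathsDominateEdges G) (hS : Block G Set.univ S)
    (h : SplitBlock G S Q i κ j₀) (h' : SplitBlock G S Q' i' κ' j₀') {e : Fin 4 → V}
    (he : ∀ j, e j ∈ Q' j) {g : Fin 4 → Bool} (hg : g κ ≠ g i)
    (hg' : ∀ l l', l ≠ l' → l ≠ κ → l ≠ i → l' ≠ κ → l' ≠ i → g l ≠ g l') :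
    Separates G S g e := by
  have adj : ∀ i j, i ≠ j → G.Adj (e i) (e j) := fun i j =>
    (h'.block.adj_iff _ _ _ _ (he i) (he j)).2
  have heS : ∀ i, e i ∈ outside S := fun i => h'.block.subset _ _ (he i)
  by_cases hout : ∀ i, e i ∈ outside Q
  · obtain ⟨f, hf, -⟩ := exists_ne_three le_rfl j₀' j₀' j₀'
    have lf := h'.conc f hf _ (he f)
    have lj := h'.label_eq _ (he j₀')
    have hne := h'.ne
    have hsp : SplitBy G S i (e f) (e j₀') := by
      by_cases hi : i' = i
      · obtain ⟨s, hs, hjs⟩ := exists_adj_of_label_eq lj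
        exact (h.conc.splitBy hP le_rfl le_rfl hS h.block (heS _) (hout _) (heS _) (hout _)
          (adj _ _ hf.symm) (fun h1 => hne (h1.trans hi.symm)) hs hjs fun hfs => by
            have := hS.label_eq trivial (heS f) hs hfs; grind).2.symm
      · obtain ⟨s, hs, hfs⟩ := exists_adj_of_label_eq lf
        exact (h.conc.splitBy hP le_rfl le_rfl hS h.block (heS _) (hout _) (heS _) (hout _)
          (adj _ _ hf) hi hs hfs fun hjs => by
            have := hS.label_eq trivial (heS j₀') hs hjs; grind).2
    have hav := h.avoid _ (heS _) (hout _) _ (heS _) (hout _) (adj _ _ hf) hsp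
    have h1 := hsp.left_ne
    have h2 := hsp.right_ne
    rw [lf] at hav h1
    rw [lj] at hav h2
    simp only [ne_eq, Option.some.injEq] at hav h1 h2
    exact ⟨f, j₀', _, _, lf, lj, hg' _ _ hne.symm hav.1 h1 hav.2 h2⟩
  push Not at hout
  obtain ⟨d, hd⟩ := hout
  by_cases hout : ∀ j ≠ d, e j ∈ outside Q
  · obtain ⟨a, ha⟩ : ∃ a, e d ∈ Q a := by simpa [outside] using hd
    exact h.separates_of_one_mem hP hS h' he ha hout hg
  push Not at hout
  obtain ⟨d', hd', hout⟩ := hout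
  have hall := h.block.exists_mem_of_two heS adj hd' hout hd
  obtain ⟨b, hb, -⟩ := exists_ne_three le_rfl j₀ j₀ j₀
  obtain ⟨k, hk⟩ := hall j₀
  obtain ⟨l, hl⟩ := hall b
  exact ⟨k, l, _, _, h.label_eq _ hk, h.conc b hb _ hl, hg⟩

end SplitBlock

lemma exists_balanced {x x' : Fin 4} (h : x ≠ x') : ∃ g : Fin 4 → Bool, g x ≠ g x' ∧
    (∀ l l', l ≠ l' → l ≠ x → l ≠ x' → l' ≠ x → l' ≠ x' → g l ≠ g l') ∧
    (∀ b, ∃ i j, i ≠ j ∧ g i = b ∧ g j = b) ∧ ∀ b, (Finset.univ.filter (g · = b)).card ≤ 3 := by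
  have key : ∀ x x' : Fin 4, x ≠ x' → ∃ l, decide (x = x ∨ x = l) ≠ decide (x' = x ∨ x' = l) ∧
      (∀ l₁ l₂, l₁ ≠ l₂ → l₁ ≠ x → l₁ ≠ x' → l₂ ≠ x → l₂ ≠ x' →
        decide (l₁ = x ∨ l₁ = l) ≠ decide (l₂ = x ∨ l₂ = l)) ∧
      (∀ b, ∃ i j, i ≠ j ∧ decide (i = x ∨ i = l) = b ∧ decide (j = x ∨ j = l) = b) ∧
      ∀ b, (Finset.univ.filter fun i => decide (i = x ∨ i = l) = b).card ≤ 3 := by decide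
  obtain ⟨l, h1, h2, h3, h4⟩ := key x x' h
  exact ⟨fun i => decide (i = x ∨ i = l), h1, h2, h3, h4⟩

lemma Block.colorable_four [Finite V] (hP : PathsDominateEdges G) (hG : NoHVN G)
    {S : Fin 4 → Set V} (hS : Block G Set.univ S) (hω : CliqueBound G Set.univ 4) :
    G.Colorable 6 := by
  have hR : CliqueBound G (outside S) 4 := hω.mono (fun _ _ => trivial) le_rfl
  by_contra hcol
  have cases : ∀ Q : Fin 4 → Set V, Block G (outside S) Q →
      (BlockPair G S Q ∧ ∃ b c x x', PureAt G S Q b c x x') ∨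
        ∃ i κ j₀, SplitBlock G S Q i κ j₀ := by
    intro Q hQ
    rcases hS.pair_or_concentrated hG le_rfl hQ with h | ⟨i, j₀, hc⟩
    · exact .inl ⟨h, h.exists_pureAt hP fun hom =>
        hcol (h.colorable_of_homogeneous hP le_rfl le_rfl le_rfl hom hω hR)⟩
    · right
      by_contra hno
      refine hcol (hc.colorable hP le_rfl le_rfl le_rfl hS hQ
        (fun y hy hyQ y' hy' hy'Q hyy' hsp => hno ?_) hω)
      obtain ⟨κ, hκ⟩ := hc.splitBlock hP hS hQ ⟨y, hy, hyQ, y', hy', hy'Q, hyy', hsp.2⟩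
      exact ⟨i, κ, j₀, hκ⟩
  have pure : ∀ Q : Fin 4 → Set V, Block G (outside S) Q → ∃ b c x x', PureAt G S Q b c x x' := by
    intro Q hQ
    rcases cases Q hQ with h | ⟨i, κ, j₀, h⟩
    · exact h.2
    · obtain ⟨c, hc⟩ := h.pureAt
      exact ⟨_, _, _, _, hc⟩
  by_cases hpair : ∃ Q : Fin 4 → Set V, Block G (outside S) Q ∧ BlockPair G S Q
  · obtain ⟨Q, hQ, h⟩ := hpair
    obtain ⟨b, c, x, x', hp⟩ := pure Q hQ
    obtain ⟨g, hg, -, h2, h3⟩ := exists_balanced hp.ne'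
    refine hcol (hS.colorable_of_separates hP hG hR g h2 h3 fun Q' hQ' e he => ?_)
    obtain ⟨b', c', z, z', hp'⟩ := pure Q' hQ'
    exact h.separates hP hG hp hQ' hp' he hg
  push Not at hpair
  have split : ∀ Q : Fin 4 → Set V, Block G (outside S) Q → ∃ i κ j₀, SplitBlock G S Q i κ j₀ :=
    fun Q hQ => (cases Q hQ).resolve_left fun h => hpair Q hQ h.1
  by_cases hex : ∃ Q : Fin 4 → Set V, Block G (outside S) Q
  · obtain ⟨Q, hQ⟩ := hex
    obtain ⟨i, κ, j₀, h⟩ := split Q hQ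
    obtain ⟨g, hg, hg', h2, h3⟩ := exists_balanced h.ne
    refine hcol (hS.colorable_of_separates hP hG hR g h2 h3 fun Q' hQ' e he => ?_)
    obtain ⟨i', κ', j₀', h'⟩ := split Q' hQ'
    exact h.separates hP hS h' he hg hg'
  · obtain ⟨g, -, -, h2, h3⟩ := exists_balanced (x := 0) (x' := 1) (by decide)
    exact hcol (hS.colorable_of_separates hP hG hR g h2 h3 fun Q hQ => (hex ⟨Q, hQ⟩).elim)

lemma colorable_of_isClique [Finite V] (hP : PathsDominateEdges G) (hG : NoHVN G) {m : ℕ}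
    (hm : 4 ≤ m) (hω : CliqueBound G Set.univ m) {K : Finset V} (hK : G.IsClique K)
    (hcard : K.card = m) : G.Colorable ((4 * m + 2) / 3) := by
  obtain ⟨S, hS, -⟩ := hG.exists_block hm hω (fun _ _ => trivial) hK hcard
  by_cases hm4 : m = 4
  · subst hm4
    exact hS.colorable_four hP hG hω
  have hR : CliqueBound G (outside S) m := hω.mono (fun _ _ => trivial) le_rfl
  classical
  have hbound : ∃ t, CliqueBound G (outside S) t := ⟨m, hR⟩
  have ht := Nat.find_spec hbound
  have hle : Nat.find hbound ≤ m := Nat.find_min' hbound hR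
  have hmin := fun k (hk : k < Nat.find hbound) => Nat.find_min hbound hk
  generalize Nat.find hbound = t at ht hle hmin
  by_cases ht4 : t ≤ 3
  · exact hS.colorable_of_cliqueBound_three hP hm (ht.mono le_rfl ht4)
  have := hmin (t - 1) (by omega)
  simp only [CliqueBound, not_forall, not_le] at this
  obtain ⟨L, hLS, hL, hlt⟩ := this
  obtain ⟨Q, hQ, -⟩ := hG.exists_block (by omega) ht hLS hL
    (le_antisymm (ht L hLS hL) (by omega))
  rcases hS.pair_or_concentrated hG (by omega) hQ with h | ⟨i, j₀, hc⟩
  · exact h.colorable_of_homogeneous hP hm (by omega) hle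
      (h.homogeneous hP (by omega) (by omega)) hω ht
  · exact hc.colorable hP hm (by omega) hle hS hQ
      (fun y hy hyQ y' hy' hy'Q hyy' hsp => by omega) hω

end ForbiddenColoring

/-- Every finite simple `(P₂ ∪ P₄, HVN)`-free graph `G` with `ω(G) ≥ 4`
satisfies `χ(G) ≤ ⌈(4/3)·ω(G)⌉`. -/
theorem chromatic_bound_P2P4_HVN_free_of_four_le_cliqueNum {V : Type*} [Fintype V]
    (G : SimpleGraph V) (h1 : IsFree G P2P4) (h2 : IsFree G HVN)
    (hw : 4 ≤ G.cliqueNum) :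
    G.chromaticNumber ≤ (⌈(4 : ℚ) * G.cliqueNum / 3⌉₊ : ℕ∞) := by
  obtain ⟨K, hK⟩ := G.exists_isNClique_cliqueNum
  have hcol := ForbiddenColoring.colorable_of_isClique
    (ForbiddenColoring.pathsDominateEdges_of_isFree h1) (ForbiddenColoring.noHVN_of_isFree h2) hw
    (fun L _ hL => hL.card_le_cliqueNum) hK.isClique hK.card_eq
  refine (hcol.mono ?_).chromaticNumber_le
  have hceil := Nat.le_ceil ((4 : ℚ) * G.cliqueNum / 3)
  rw [div_le_iff₀ (by norm_num)] at hceil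
  have : 4 * G.cliqueNum ≤ ⌈(4 : ℚ) * G.cliqueNum / 3⌉₊ * 3 := by exact_mod_cast hceil
  omega
end

section
/- There exists a finite simple (P₂ ∪ P₄, HVN)-free graph G with ω(G) = 2 and χ(G) = 4 (for instance, the Mycielski–Grötzsch graph); hence the bound χ(G) ≤ 4 for (P₂ ∪ P₄, HVN)-free graphs with clique number 2 is tight. -/
open SimpleGraph

namespace SimpleGraph

variable {V : Type*}

/-- The adjacency relation of the Mycielskian of `G`: `some (inl v)` is an original vertex,
`some (inr v)` is its shadow, adjacent to the original neighbours of `v`, and `none` is the apex,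
adjacent to all shadows. -/
def mycielskianAdj (G : SimpleGraph V) : Option (V ⊕ V) → Option (V ⊕ V) → Prop
  | some (.inl u), some (.inl v) => G.Adj u v
  | some (.inl u), some (.inr v) => G.Adj u v
  | some (.inr u), some (.inl v) => G.Adj u v
  | some (.inr _), none => True
  | none, some (.inr _) => True
  | _, _ => False

/-- The Mycielskian of a simple graph. -/
def mycielskian (G : SimpleGraph V) : SimpleGraph (Option (V ⊕ V)) where
  Adj := G.mycielskianAdj
  symm := ⟨by
    rintro (_ | _ | _) (_ | _ | _) h <;> first | exact h | exact G.adj_symm h⟩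
  loopless := ⟨by
    rintro (_ | _ | v) h
    · exact h
    · exact G.irrefl h
    · exact h⟩

instance (G : SimpleGraph V) [DecidableRel G.Adj] : DecidableRel G.mycielskian.Adj := by
  rintro (_ | _ | _) (_ | _ | _) <;> dsimp only [mycielskian, mycielskianAdj] <;> infer_instance

/-- A proper `(n + 1)`-colouring of the Mycielskian yields a proper `n`-colouring of the graph:
recolour every vertex having the colour of the apex with the colour of its shadow. -/
theorem Colorable.of_mycielskian {G : SimpleGraph V} {n : ℕ}
    (h : G.mycielskian.Colorable (n + 1)) : G.Colorable n := by
  obtain ⟨c⟩ := h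
  have hll {u v : V} (h : G.Adj u v) : c (some (.inl u)) ≠ c (some (.inl v)) :=
    c.valid (v := some (.inl u)) (w := some (.inl v)) h
  have hlr {u v : V} (h : G.Adj u v) : c (some (.inl u)) ≠ c (some (.inr v)) :=
    c.valid (v := some (.inl u)) (w := some (.inr v)) h
  have hr (v : V) : c (some (.inr v)) ≠ c none :=
    c.valid (v := some (.inr v)) (w := none) trivial
  let d (v : V) : {i // i ≠ c none} :=
    if hv : c (some (.inl v)) = c none then ⟨c (some (.inr v)), hr v⟩ else ⟨c (some (.inl v)), hv⟩
  have hd : ∀ {u v : V}, G.Adj u v → d u ≠ d v := by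
    intro u v huv
    have := hll huv
    have := hlr huv
    have := hlr huv.symm
    grind
  have hcol := (Coloring.mk d hd).colorable
  simpa using hcol

/-- The Grötzsch graph, the Mycielskian of the 5-cycle. -/
abbrev grotzsch : SimpleGraph (Option (Fin 5 ⊕ Fin 5)) := (cycleGraph 5).mycielskian

theorem grotzsch_triangle_free (a b c : Option (Fin 5 ⊕ Fin 5)) :
    grotzsch.Adj a b → grotzsch.Adj a c → ¬ grotzsch.Adj b c := by
  revert a b c
  decide +kernel

theorem grotzsch_cliqueFree_three : grotzsch.CliqueFree 3 := by
  intro s hs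
  obtain ⟨a, b, c, hab, hac, hbc, -⟩ := is3Clique_iff.mp hs
  exact grotzsch_triangle_free a b c hab hac hbc

theorem grotzsch_cliqueNum : grotzsch.cliqueNum = 2 := by
  apply le_antisymm
  · obtain ⟨s, hs⟩ := grotzsch.exists_isNClique_cliqueNum
    by_contra! h
    exact grotzsch_cliqueFree_three.mono h s hs
  · have h : grotzsch.IsClique ({none, some (.inr 0)} : Finset (Option (Fin 5 ⊕ Fin 5))) := by
      simp [mycielskian, mycielskianAdj]
    simpa using h.card_le_cliqueNum

theorem grotzsch_chromaticNumber : grotzsch.chromaticNumber = 4 := by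
  have hcol : grotzsch.Colorable 4 := by
    let c : Option (Fin 5 ⊕ Fin 5) → Fin 4 := fun
      | none => 0
      | some (.inl i) => ![0, 1, 0, 1, 2] i
      | some (.inr _) => 3
    exact ⟨Coloring.mk c (by decide +kernel)⟩
  refine chromaticNumber_eq_iff_colorable_not_colorable.mpr ⟨hcol, fun h => ?_⟩
  have := h.of_mycielskian.chromaticNumber_le
  rw [chromaticNumber_cycleGraph_of_odd 5 (by norm_num) (by decide)] at this
  exact absurd this (by decide)

theorem grotzsch_isFree_HVN : IsFree grotzsch HVN := by
  refine ⟨fun f => grotzsch_triangle_free (f 0) (f 1) (f 2) ?_ ?_ ?_⟩ <;>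
    exact f.map_adj_iff.mpr (by simp [HVN])

set_option synthInstance.maxSize 512 in
/-- No induced path on four vertices is anticomplete to an edge of the Grötzsch graph. -/
theorem grotzsch_no_path_anticomplete_edge : ∀ a b, grotzsch.Adj a b →
    ∀ c, ¬ grotzsch.Adj a c → ¬ grotzsch.Adj b c →
    ∀ d, grotzsch.Adj c d → ¬ grotzsch.Adj a d → ¬ grotzsch.Adj b d →
    ∀ e, grotzsch.Adj d e → ¬ grotzsch.Adj a e → ¬ grotzsch.Adj b e → e ≠ c →
    ∀ f, grotzsch.Adj e f → ¬ grotzsch.Adj a f → ¬ grotzsch.Adj b f → f = d := by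
  decide +kernel

theorem grotzsch_isFree_P2P4 : IsFree grotzsch P2P4 := by
  refine ⟨fun f => ?_⟩
  have hadj {i j : Fin 6} (h : P2P4.Adj i j) : grotzsch.Adj (f i) (f j) := f.map_adj_iff.mpr h
  have hnadj {i j : Fin 6} (h : ¬ P2P4.Adj i j) : ¬ grotzsch.Adj (f i) (f j) :=
    mt f.map_adj_iff.mp h
  refine f.injective.ne (by decide : (5 : Fin 6) ≠ 3) (grotzsch_no_path_anticomplete_edge
    (f 0) (f 1) (hadj ?_) (f 2) (hnadj ?_) (hnadj ?_) (f 3) (hadj ?_) (hnadj ?_) (hnadj ?_)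
    (f 4) (hadj ?_) (hnadj ?_) (hnadj ?_) (f.injective.ne (by decide))
    (f 5) (hadj ?_) (hnadj ?_) (hnadj ?_)) <;>
  simp [P2P4]

end SimpleGraph

/-- There exists a finite simple `(P₂ ∪ P₄, HVN)`-free graph `G` with `ω(G) = 2`
and `χ(G) = 4`; hence the bound `χ(G) ≤ 4` for `(P₂ ∪ P₄, HVN)`-free graphs with
clique number `2` is tight. -/
theorem exists_P2P4_HVN_free_cliqueNum_two_chromaticNumber_four :
    ∃ (V : Type) (_ : Fintype V) (G : SimpleGraph V),
      IsFree G P2P4 ∧ IsFree G HVN ∧ G.cliqueNum = 2 ∧ G.chromaticNumber = 4 :=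
  ⟨_, inferInstance, grotzsch, grotzsch_isFree_P2P4, grotzsch_isFree_HVN,
    grotzsch_cliqueNum, grotzsch_chromaticNumber⟩
end

section
/- For every integer ω ≥ 4, the graph G_ω is (P₂ ∪ P₄, HVN)-free. -/
open SimpleGraph

/-- The graph `G_ω` on `2ω²` vertices: `Sum.inl (i, t)` is the vertex `aᵢᵗ` and
`Sum.inr (j, s)` is the vertex `bⱼˢ`.  Two `a`-vertices (resp. two `b`-vertices)
are adjacent iff their first indices differ, and `aᵢᵗ` is adjacent to `bⱼˢ` iff
`j = t` and `s = i` (so `[V(A), V(B)]` is a perfect matching). -/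
def GOmega (n : ℕ) : SimpleGraph ((Fin n × Fin n) ⊕ (Fin n × Fin n)) :=
  SimpleGraph.fromRel (fun x y =>
    match x, y with
    | Sum.inl (i, _), Sum.inl (j, _) => i ≠ j
    | Sum.inr (i, _), Sum.inr (j, _) => i ≠ j
    | Sum.inl (i, t), Sum.inr (j, s) => j = t ∧ s = i
    | Sum.inr _, Sum.inl _ => False)

/-- Non-adjacency is transitive on each side of `G_ω`. -/
lemma GOmega_not_adj_trans {n : ℕ} {x y z : (Fin n × Fin n) ⊕ (Fin n × Fin n)}
    (hxy : x.isLeft = y.isLeft) (hyz : y.isLeft = z.isLeft)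
    (h₁ : ¬ (GOmega n).Adj x y) (h₂ : ¬ (GOmega n).Adj y z) : ¬ (GOmega n).Adj x z := by
  rcases x with ⟨i, t⟩ | ⟨i, t⟩ <;> rcases y with ⟨j, s⟩ | ⟨j, s⟩ <;>
    rcases z with ⟨k, r⟩ | ⟨k, r⟩ <;> simp [GOmega] at * <;> grind +splitImp

/-- A vertex of `G_ω` has at most one neighbour on the opposite side. -/
lemma GOmega_eq_of_adj_cross {n : ℕ} {x y z : (Fin n × Fin n) ⊕ (Fin n × Fin n)}
    (hxy : x.isLeft ≠ y.isLeft) (hxz : x.isLeft ≠ z.isLeft)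
    (h₁ : (GOmega n).Adj x y) (h₂ : (GOmega n).Adj x z) : y = z := by
  rcases x with ⟨i, t⟩ | ⟨i, t⟩ <;> rcases y with ⟨j, s⟩ | ⟨j, s⟩ <;>
    rcases z with ⟨k, r⟩ | ⟨k, r⟩ <;> simp [GOmega] at * <;> grind +splitImp

/-- An induced copy of `H` in `G_ω` splits the vertices of `H` into two sides, each inducing a
complete multipartite graph, with the edges across forming a matching. -/
lemma exists_side_of_embedding_GOmega {n : ℕ} {W : Type*} {H : SimpleGraph W}
    (f : H ↪g GOmega n) : ∃ s : W → Bool,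
      (∀ x y z, s x = s y → s y = s z → ¬ H.Adj x y → ¬ H.Adj y z → ¬ H.Adj x z) ∧
      (∀ x y z, s x ≠ s y → s x ≠ s z → H.Adj x y → H.Adj x z → y = z) := by
  refine ⟨fun w => (f w).isLeft, fun x y z hxy hyz h₁ h₂ => ?_, fun x y z hxy hxz h₁ h₂ => ?_⟩
  · rw [← f.map_adj_iff] at *
    exact GOmega_not_adj_trans hxy hyz h₁ h₂
  · exact f.injective
      (GOmega_eq_of_adj_cross hxy hxz (f.map_adj_iff.2 h₁) (f.map_adj_iff.2 h₂))

instance : DecidableRel P2P4.Adj := fun x y => by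
  simp only [P2P4, fromEdgeSet_adj, Set.mem_insert_iff, Set.mem_singleton_iff]
  infer_instance

instance : DecidableRel HVN.Adj := fun x y => by
  simp only [HVN, fromEdgeSet_adj, Set.mem_insert_iff, Set.mem_singleton_iff]
  infer_instance

set_option synthInstance.maxHeartbeats 400000 in
set_option synthInstance.maxSize 4000 in
/-- For every integer `ω ≥ 4`, the graph `G_ω` is `(P₂ ∪ P₄, HVN)`-free. -/
theorem GOmega_isFree (n : ℕ) (hn : 4 ≤ n) :
    IsFree (GOmega n) P2P4 ∧ IsFree (GOmega n) HVN := by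
  refine ⟨⟨fun f => ?_⟩, ⟨fun f => ?_⟩⟩
  · obtain ⟨s, hs, hc⟩ := exists_side_of_embedding_GOmega f
    revert s
    decide +kernel
  · obtain ⟨s, hs, hc⟩ := exists_side_of_embedding_GOmega f
    revert s
    decide +kernel
end

section
/- For every integer ω ≥ 4, the clique number of the graph G_ω equals ω. -/
open SimpleGraph

namespace GOmega

variable {n : ℕ}

@[simp]
lemma adj_inl_inl (p q : Fin n × Fin n) :
    (GOmega n).Adj (Sum.inl p) (Sum.inl q) ↔ p.1 ≠ q.1 := by
  simp only [GOmega, SimpleGraph.fromRel_adj]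
  grind

@[simp]
lemma adj_inr_inr (p q : Fin n × Fin n) :
    (GOmega n).Adj (Sum.inr p) (Sum.inr q) ↔ p.1 ≠ q.1 := by
  simp only [GOmega, SimpleGraph.fromRel_adj]
  grind

@[simp]
lemma adj_inl_inr (p q : Fin n × Fin n) :
    (GOmega n).Adj (Sum.inl p) (Sum.inr q) ↔ q = p.swap := by
  simp [GOmega, Prod.ext_iff]

/-- The first index of a vertex of `GOmega n`. -/
def index (x : (Fin n × Fin n) ⊕ (Fin n × Fin n)) : Fin n :=
  Sum.elim Prod.fst Prod.fst x

/-- A clique meeting both sides of `GOmega n` is a single matching edge. -/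
lemma subset_pair_of_isClique {s : Finset ((Fin n × Fin n) ⊕ (Fin n × Fin n))}
    (hs : (GOmega n).IsClique s) {p q : Fin n × Fin n}
    (hp : Sum.inl p ∈ s) (hq : Sum.inr q ∈ s) : s ⊆ {Sum.inl p, Sum.inr q} := by
  have cross {u v : Fin n × Fin n} (hu : Sum.inl u ∈ s) (hv : Sum.inr v ∈ s) :
      v = u.swap :=
    (adj_inl_inr u v).1 (hs hu hv Sum.inl_ne_inr)
  rintro (x | x) hx
  · have : x = p := Prod.swap_injective ((cross hx hq).symm.trans (cross hp hq))
    simp [this]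
  · have : x = q := (cross hp hx).trans (cross hp hq).symm
    simp [this]

/-- A clique contained in one side of `GOmega n` has at most one vertex for each index. -/
lemma injOn_index_of_isClique {s : Finset ((Fin n × Fin n) ⊕ (Fin n × Fin n))}
    (hs : (GOmega n).IsClique s)
    (h : ∀ p q, Sum.inl p ∈ s → Sum.inr q ∉ s) :
    Set.InjOn index (s : Set ((Fin n × Fin n) ⊕ (Fin n × Fin n))) := by
  rintro (x | x) hx (y | y) hy hxy
  · by_contra hne
    exact (adj_inl_inl x y).1 (hs hx hy hne) hxy
  · exact (h x y hx hy).elim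
  · exact (h y x hy hx).elim
  · by_contra hne
    exact (adj_inr_inr x y).1 (hs hx hy hne) hxy

lemma card_le_of_isClique (hn : 2 ≤ n) {s : Finset ((Fin n × Fin n) ⊕ (Fin n × Fin n))}
    (hs : (GOmega n).IsClique s) : s.card ≤ n := by
  by_cases h : ∃ p q, Sum.inl p ∈ s ∧ Sum.inr q ∈ s
  · obtain ⟨p, q, hp, hq⟩ := h
    exact (Finset.card_le_card (subset_pair_of_isClique hs hp hq)).trans
      (Finset.card_le_two.trans hn)
  · push Not at h
    simpa using Finset.card_le_card_of_injOn index (fun _ _ => Finset.mem_univ _)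
      (injOn_index_of_isClique hs h)

/-- The clique of all vertices `aᵢⁱ`. -/
lemma isNClique_diagonal (n : ℕ) :
    (GOmega n).IsNClique n
      (Finset.univ.map ⟨fun i : Fin n => Sum.inl (i, i), fun i j h => by simpa using h⟩) := by
  refine ⟨?_, by simp⟩
  intro x hx y hy hxy
  simp only [Finset.coe_map, Set.mem_image] at hx hy
  obtain ⟨i, -, rfl⟩ := hx
  obtain ⟨j, -, rfl⟩ := hy
  exact (adj_inl_inl (i, i) (j, j)).2 fun h : i = j => hxy (h ▸ rfl)

end GOmega

/-- For every integer `ω ≥ 4`, the clique number of the graph `G_ω` equals `ω`. -/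
theorem GOmega_cliqueNum (n : ℕ) (hn : 4 ≤ n) : (GOmega n).cliqueNum = n := by
  apply le_antisymm
  · obtain ⟨s, hs⟩ := (GOmega n).exists_isNClique_cliqueNum
    exact hs.card_eq ▸ GOmega.card_le_of_isClique (by omega) hs.isClique
  · have h := GOmega.isNClique_diagonal n
    exact h.card_eq.symm.le.trans h.isClique.card_le_cliqueNum
end

section
/- For every integer ω ≥ 4, the graph G_ω is not (⌈(4/3)·ω⌉ − 1)-colourable; that is, χ(G_ω) ≥ ⌈(4/3)·ω⌉. -/
open SimpleGraph

/-- In a family of nonempty pairwise disjoint finite sets of elements of a type of size `k`,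
at least `2n - k` of the `n` sets are singletons. -/
theorem two_mul_card_le_card_add_card_singletons {ι α : Type*} [Fintype ι] [Fintype α]
    [DecidableEq α] (S : ι → Finset α) (hne : ∀ i, (S i).Nonempty)
    (hd : Pairwise fun i j => Disjoint (S i) (S j)) :
    2 * Fintype.card ι ≤ Fintype.card α + (Finset.univ.filter fun i => (S i).card = 1).card := by
  have hsum : ∑ i, (S i).card ≤ Fintype.card α := by
    rw [← Finset.card_biUnion fun i _ j _ h => hd h]
    exact Finset.card_le_univ _
  have hle : ∑ _i : ι, 2 ≤ ∑ i, ((S i).card + if (S i).card = 1 then 1 else 0) := by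
    refine Finset.sum_le_sum fun i _ => ?_
    have := (hne i).card_pos
    split_ifs <;> omega
  rw [Finset.sum_add_distrib, Finset.sum_const, Finset.card_univ, smul_eq_mul,
    ← Finset.card_filter] at hle
  omega

/-- Two families of `n` nonempty pairwise disjoint subsets of a type of size `k` that have no
singleton in common require `4n ≤ 3k`. -/
theorem four_mul_card_le_of_no_common_singleton {ι α : Type*} [Fintype ι] [Fintype α]
    [DecidableEq α] (S T : ι → Finset α) (hS : ∀ i, (S i).Nonempty) (hT : ∀ i, (T i).Nonempty)
    (hSd : Pairwise fun i j => Disjoint (S i) (S j))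
    (hTd : Pairwise fun i j => Disjoint (T i) (T j))
    (hST : ∀ i j x, S i = {x} → T j ≠ {x}) :
    4 * Fintype.card ι ≤ 3 * Fintype.card α := by
  have hp := two_mul_card_le_card_add_card_singletons S hS hSd
  have hq := two_mul_card_le_card_add_card_singletons T hT hTd
  have card_eq (U : ι → Finset α) (hd : Pairwise fun i j => Disjoint (U i) (U j)) :
      ((Finset.univ.filter fun i => (U i).card = 1).biUnion U).card =
        (Finset.univ.filter fun i => (U i).card = 1).card := by
    rw [Finset.card_biUnion fun i _ j _ h => hd h,
      Finset.sum_congr rfl fun i hi => (Finset.mem_filter.mp hi).2, ← Finset.card_eq_sum_ones]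
  have hdisj : Disjoint ((Finset.univ.filter fun i => (S i).card = 1).biUnion S)
      ((Finset.univ.filter fun i => (T i).card = 1).biUnion T) := by
    simp only [Finset.disjoint_biUnion_left, Finset.disjoint_biUnion_right, Finset.mem_filter,
      Finset.mem_univ, true_and, Finset.card_eq_one]
    rintro j ⟨y, hy⟩ i ⟨x, hx⟩
    rw [hx, hy, Finset.disjoint_singleton]
    rintro rfl
    exact hST i j _ hx hy
  have hk := Finset.card_le_univ (((Finset.univ.filter fun i => (S i).card = 1).biUnion S) ∪
    ((Finset.univ.filter fun i => (T i).card = 1).biUnion T))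
  rw [Finset.card_union_of_disjoint hdisj, card_eq S hSd, card_eq T hTd] at hk
  omega

theorem GOmega.four_mul_le_of_colorable {n k : ℕ} (h : (GOmega n).Colorable k) :
    4 * n ≤ 3 * k := by
  obtain ⟨c⟩ := h
  have hA (i j t s : Fin n) (hij : i ≠ j) : c (Sum.inl (i, t)) ≠ c (Sum.inl (j, s)) :=
    c.valid (by simp [GOmega, hij])
  have hB (i j t s : Fin n) (hij : i ≠ j) : c (Sum.inr (i, t)) ≠ c (Sum.inr (j, s)) :=
    c.valid (by simp [GOmega, hij])
  have hAB (i j : Fin n) : c (Sum.inl (i, j)) ≠ c (Sum.inr (j, i)) :=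
    c.valid (by simp [GOmega])
  have := four_mul_card_le_of_no_common_singleton
    (fun i => Finset.univ.image fun t => c (Sum.inl (i, t)))
    (fun j => Finset.univ.image fun s => c (Sum.inr (j, s)))
    (fun i => ⟨_, Finset.mem_image_of_mem _ (Finset.mem_univ i)⟩)
    (fun j => ⟨_, Finset.mem_image_of_mem _ (Finset.mem_univ j)⟩)
    (fun i j hij => by
      simp only [Finset.disjoint_left, Finset.mem_image, Finset.mem_univ, true_and]
      rintro _ ⟨t, rfl⟩ ⟨s, hs⟩
      exact hA i j t s hij hs.symm)
    (fun i j hij => by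
      simp only [Finset.disjoint_left, Finset.mem_image, Finset.mem_univ, true_and]
      rintro _ ⟨t, rfl⟩ ⟨s, hs⟩
      exact hB i j t s hij hs.symm)
    (fun i j x hi hj => by
      have hxi := Finset.mem_image_of_mem (fun t => c (Sum.inl (i, t))) (Finset.mem_univ j)
      have hxj := Finset.mem_image_of_mem (fun s => c (Sum.inr (j, s))) (Finset.mem_univ i)
      rw [hi, Finset.mem_singleton] at hxi
      rw [hj, Finset.mem_singleton] at hxj
      exact hAB i j (hxi.trans hxj.symm))
  simpa using this

/-- For every integer `ω ≥ 4`, the graph `G_ω` is not `(⌈(4/3)·ω⌉ − 1)`-colourable;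
that is, `χ(G_ω) ≥ ⌈(4/3)·ω⌉`. -/
theorem GOmega_not_colorable (n : ℕ) (hn : 4 ≤ n) :
    ¬ (GOmega n).Colorable (⌈(4 : ℚ) * n / 3⌉₊ - 1) ∧
    (⌈(4 : ℚ) * n / 3⌉₊ : ℕ∞) ≤ (GOmega n).chromaticNumber := by
  have ceil_le {k : ℕ} (h : (GOmega n).Colorable k) : ⌈(4 : ℚ) * n / 3⌉₊ ≤ k := by
    have : (4 : ℚ) * n ≤ 3 * k := mod_cast GOmega.four_mul_le_of_colorable h
    exact Nat.ceil_le.mpr (by linarith)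
  refine ⟨fun h => ?_, le_chromaticNumber_iff_colorable.mpr fun k hk => mod_cast ceil_le hk⟩
  have hpos : 0 < ⌈(4 : ℚ) * n / 3⌉₊ := Nat.ceil_pos.mpr (by positivity)
  have := ceil_le h
  omega
end

section
/- Let G be a graph containing two disjoint cliques X and Y with min{|X|, |Y|} ≥ 2 and max{|X|, |Y|} ≥ 3. If the set of edges between X and Y is nonempty and forms a matching (no two of these edges share an endpoint), then the subgraph of G induced by X ∪ Y contains an induced P₄. -/
open SimpleGraph

/-- Four vertices of `s` with the adjacencies and non-adjacencies of a path induce a `P₄`;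
their distinctness is automatic. -/
theorem nonempty_pathGraph_four_embedding_induce {V : Type*} {G : SimpleGraph V} {s : Set V}
    {a b c d : V} (ha : a ∈ s) (hb : b ∈ s) (hc : c ∈ s) (hd : d ∈ s)
    (hab : G.Adj a b) (hbc : G.Adj b c) (hcd : G.Adj c d)
    (hac : ¬ G.Adj a c) (had : ¬ G.Adj a d) (hbd : ¬ G.Adj b d) :
    Nonempty (pathGraph 4 ↪g G.induce s) := by
  have hac' : a ≠ c := by rintro rfl; exact had hcd
  have had' : a ≠ d := by rintro rfl; exact hac hcd.symm
  have hbd' : b ≠ d := by rintro rfl; exact had hab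
  refine ⟨⟨⟨![⟨a, ha⟩, ⟨b, hb⟩, ⟨c, hc⟩, ⟨d, hd⟩], ?_⟩, ?_⟩⟩
  · intro i j h
    fin_cases i <;> fin_cases j <;>
      simp_all [hab.ne, hab.ne', hbc.ne, hbc.ne', hcd.ne, hcd.ne', hac'.symm, had'.symm,
        hbd'.symm]
  · intro i j
    change G.Adj (![(⟨a, ha⟩ : s), ⟨b, hb⟩, ⟨c, hc⟩, ⟨d, hd⟩] i)
      (![(⟨a, ha⟩ : s), ⟨b, hb⟩, ⟨c, hc⟩, ⟨d, hd⟩] j) ↔ _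
    fin_cases i <;> fin_cases j <;>
      simp [pathGraph_adj, hab, hab.symm, hbc, hbc.symm, hcd, hcd.symm, hac, had, hbd,
        G.adj_comm c a, G.adj_comm d a, G.adj_comm d b]

/-- If the edges between two cliques `X` and `Y` with `3 ≤ |X|` and `2 ≤ |Y|` form a nonempty
matching, then some induced `P₄` has its first two vertices in `X` and its last two in `Y`. -/
theorem exists_induced_path_of_matching_between_cliques {V : Type*} {G : SimpleGraph V}
    {X Y : Finset V} (hX : G.IsClique ↑X) (hY : G.IsClique ↑Y)
    (hXcard : 3 ≤ X.card) (hYcard : 2 ≤ Y.card)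
    (hne : ∃ x ∈ X, ∃ y ∈ Y, G.Adj x y)
    (hmatch : ∀ x ∈ X, ∀ x' ∈ X, ∀ y ∈ Y, ∀ y' ∈ Y,
      G.Adj x y → G.Adj x' y' → (x = x' ↔ y = y')) :
    ∃ a ∈ X, ∃ b ∈ X, ∃ c ∈ Y, ∃ d ∈ Y, G.Adj a b ∧ G.Adj b c ∧ G.Adj c d ∧
      ¬ G.Adj a c ∧ ¬ G.Adj a d ∧ ¬ G.Adj b d := by
  classical
  obtain ⟨x, hx, y, hy, hxy⟩ := hne
  obtain ⟨d, hd, hdy⟩ := Finset.exists_mem_ne (by omega : 1 < Y.card) y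
  have hcard : 1 < (X.erase x).card := by rw [Finset.card_erase_of_mem hx]; omega
  obtain ⟨p, hp, q, hq, hpq⟩ := Finset.one_lt_card.1 hcard
  obtain ⟨a, ha, had⟩ : ∃ a ∈ X.erase x, ¬ G.Adj a d := by
    by_contra! h
    exact hpq ((hmatch p (Finset.mem_of_mem_erase hp) q (Finset.mem_of_mem_erase hq) d hd d hd
      (h p hp) (h q hq)).2 rfl)
  obtain ⟨hax, haX⟩ := Finset.mem_erase.1 ha
  exact ⟨a, haX, x, hx, y, hy, d, hd, hX haX hx hax, hxy, hY hy hd hdy.symm,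
    fun h => hax ((hmatch a haX x hx y hy y hy h hxy).2 rfl), had,
    fun h => hdy ((hmatch x hx x hx d hd y hy h hxy).1 rfl)⟩

/-- Let `X` and `Y` be two disjoint cliques of a graph `G` with
`min{|X|, |Y|} ≥ 2` and `max{|X|, |Y|} ≥ 3`.  If the set of edges between `X`
and `Y` is nonempty and forms a matching (no two such edges share an endpoint),
then the subgraph of `G` induced by `X ∪ Y` contains an induced `P₄`. -/
theorem induced_P4_of_matching_between_cliques {V : Type*} (G : SimpleGraph V)
    (X Y : Finset V) (hdisj : Disjoint X Y)
    (hX : G.IsClique ↑X) (hY : G.IsClique ↑Y)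
    (hmin : 2 ≤ min X.card Y.card) (hmax : 3 ≤ max X.card Y.card)
    (hne : ∃ x ∈ X, ∃ y ∈ Y, G.Adj x y)
    (hmatch : ∀ x ∈ X, ∀ x' ∈ X, ∀ y ∈ Y, ∀ y' ∈ Y,
      G.Adj x y → G.Adj x' y' → (x = x' ↔ y = y')) :
    Nonempty (SimpleGraph.pathGraph 4 ↪g G.induce (↑X ∪ ↑Y)) := by
  obtain ⟨hX2, hY2⟩ := le_min_iff.1 hmin
  rcases le_max_iff.1 hmax with hX3 | hY3
  · obtain ⟨a, ha, b, hb, c, hc, d, hd, hab, hbc, hcd, hac, had, hbd⟩ :=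
      exists_induced_path_of_matching_between_cliques hX hY hX3 hY2 hne hmatch
    exact nonempty_pathGraph_four_embedding_induce (Or.inl ha) (Or.inl hb) (Or.inr hc)
      (Or.inr hd) hab hbc hcd hac had hbd
  · obtain ⟨x, hx, y, hy, hxy⟩ := hne
    obtain ⟨a, ha, b, hb, c, hc, d, hd, hab, hbc, hcd, hac, had, hbd⟩ :=
      exists_induced_path_of_matching_between_cliques hY hX hY3 hX2 ⟨y, hy, x, hx, hxy.symm⟩
        fun y hy y' hy' x hx x' hx' h h' =>
          (hmatch x hx x' hx' y hy y' hy' h.symm h'.symm).symm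
    exact nonempty_pathGraph_four_embedding_induce (Or.inr ha) (Or.inr hb) (Or.inl hc)
      (Or.inl hd) hab hbc hcd hac had hbd
end

section
/- Let G be a (P₂ ∪ P₄, HVN)-free graph with ω(G) = ω ≥ 4, let A be an induced complete ω-partite subgraph of G of maximum order, let H be the subgraph of G induced on V(G) ∖ V(A), and let k = ω(H). Then χ(G) ≤ max{2k, ω}. -/
open SimpleGraph

/-- `A` is an induced complete `m`-partite subgraph of `G` all of whose parts lie in `W`:
the parts are nonempty, pairwise disjoint, stable sets, and any two vertices in
different parts are adjacent. -/
def IsCompMultipartite {V : Type*} (G : SimpleGraph V) (W : Set V) {m : ℕ}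
    (A : Fin m → Finset V) : Prop :=
  (∀ i, (A i).Nonempty) ∧
  (∀ i, ↑(A i) ⊆ W) ∧
  (∀ i j, i ≠ j → Disjoint (A i) (A j)) ∧
  (∀ i, ∀ x ∈ A i, ∀ y ∈ A i, ¬ G.Adj x y) ∧
  (∀ i j, i ≠ j → ∀ x ∈ A i, ∀ y ∈ A j, G.Adj x y)

/-- `A` is an induced complete `m`-partite subgraph of `G` (with parts inside `W`)
of maximum order. -/
def IsMaxCompMultipartite {V : Type*} (G : SimpleGraph V) (W : Set V) {m : ℕ}
    (A : Fin m → Finset V) : Prop :=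
  IsCompMultipartite G W A ∧
    ∀ B : Fin m → Finset V, IsCompMultipartite G W B →
      ∑ i, (B i).card ≤ ∑ i, (A i).card

/-- A quadruple `a, b, c, d` with exactly the adjacencies of an induced path `P₄`. -/
def IsInducedP4 {V : Type*} (G : SimpleGraph V) (a b c d : V) : Prop :=
  G.Adj a b ∧ G.Adj b c ∧ G.Adj c d ∧ ¬ G.Adj a c ∧ ¬ G.Adj a d ∧ ¬ G.Adj b d

/-- In a set without induced `P₄`, a maximal stable set `S` meets every maximal clique. -/
lemma not_disjoint_of_maximal_stable_of_maximal_clique {V : Type*}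
    (G : SimpleGraph V) (W S K : Finset V)
    (hP : ∀ a ∈ W, ∀ b ∈ W, ∀ c ∈ W, ∀ d ∈ W, ¬ IsInducedP4 G a b c d)
    (hSW : S ⊆ W) (hS : ∀ x ∈ S, ∀ y ∈ S, ¬ G.Adj x y)
    (hSmax : ∀ v ∈ W, v ∉ S → ∃ s ∈ S, G.Adj v s)
    (hKW : K ⊆ W) (hK : G.IsClique K) (hKne : K.Nonempty)
    (hKmax : ∀ s ∈ S, s ∉ K → ∃ v ∈ K, ¬ G.Adj s v) :
    ¬ Disjoint S K := by
  classical
  intro hd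
  have hdis : ∀ x ∈ S, x ∉ K := fun x hx hx' => Finset.disjoint_left.mp hd hx hx'
  obtain ⟨v₀, hv₀⟩ := hKne
  obtain ⟨s₀, hs₀, -⟩ := hSmax v₀ (hKW hv₀) fun h => hdis _ h hv₀
  obtain ⟨s, hs, hmax⟩ := S.exists_max_image (fun s => (K.filter (G.Adj s)).card) ⟨s₀, hs₀⟩
  obtain ⟨v, hv, hsv⟩ := hKmax s hs (hdis s hs)
  obtain ⟨t, ht, hvt⟩ := hSmax v (hKW hv) fun h => hdis _ h hv
  obtain ⟨u, hu, hsu, htu⟩ : ∃ u ∈ K, G.Adj s u ∧ ¬ G.Adj t u := by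
    by_contra! hcon
    have hlt : (K.filter (G.Adj s)).card < (K.filter (G.Adj t)).card := by
      refine Finset.card_lt_card ⟨fun x hx => ?_, fun hsub => ?_⟩
      · rw [Finset.mem_filter] at hx ⊢
        exact ⟨hx.1, hcon x hx.1 hx.2⟩
      · exact hsv (Finset.mem_filter.mp (hsub (Finset.mem_filter.mpr ⟨hv, hvt.symm⟩))).2
    exact absurd (hmax t ht) (not_le.mpr hlt)
  have huv : u ≠ v := by rintro rfl; exact hsv hsu
  exact hP s (hSW hs) u (hKW hu) v (hKW hv) t (hSW ht)
    ⟨hsu, hK hu hv huv, hvt, hsv, hS s hs t ht, fun h => htu h.symm⟩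

/-- A finite set without induced `P₄` whose cliques have at most `k` vertices is `k`-colourable. -/
lemma exists_coloring_of_no_inducedP4 {V : Type*} (G : SimpleGraph V) (k : ℕ) :
    ∀ W : Finset V, (∀ a ∈ W, ∀ b ∈ W, ∀ c ∈ W, ∀ d ∈ W, ¬ IsInducedP4 G a b c d) →
      (∀ K ⊆ W, G.IsClique K → K.card ≤ k) →
      ∃ f : V → ℕ, (∀ v ∈ W, f v < k) ∧ ∀ u ∈ W, ∀ v ∈ W, G.Adj u v → f u ≠ f v := by
  classical
  induction k with
  | zero =>
    intro W _ hK
    have hW : ∀ v, v ∉ W := fun v hv => by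
      simpa using hK {v} (by simpa using hv) (by simp)
    exact ⟨fun _ => 0, fun v hv => (hW v hv).elim, fun v hv => (hW v hv).elim⟩
  | succ k ih =>
    intro W hP hK
    obtain ⟨S, hSmem, hSmax⟩ :=
      (W.powerset.filter fun S : Finset V => G.IsIndepSet (S : Set V)).exists_max_image Finset.card
        ⟨∅, by simp⟩
    rw [Finset.mem_filter, Finset.mem_powerset] at hSmem
    obtain ⟨hSW, hSind⟩ := hSmem
    have hS : ∀ x ∈ S, ∀ y ∈ S, ¬ G.Adj x y := fun x hx y hy hxy => hSind hx hy hxy.ne hxy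
    have hSdom : ∀ v ∈ W, v ∉ S → ∃ s ∈ S, G.Adj v s := by
      intro v hv hvS
      by_contra! hcon
      have h := hSmax (insert v S) (by
        rw [Finset.mem_filter, Finset.mem_powerset]
        refine ⟨Finset.insert_subset hv hSW, fun x hx y hy _ hxy => ?_⟩
        rcases Finset.mem_insert.mp hx with rfl | hxS <;>
          rcases Finset.mem_insert.mp hy with rfl | hyS
        · exact G.loopless.irrefl _ hxy
        · exact hcon y hyS hxy
        · exact hcon x hxS hxy.symm
        · exact hS x hxS y hyS hxy)
      rw [Finset.card_insert_of_notMem hvS] at h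
      omega
    obtain ⟨f, hf, hfc⟩ := ih (W \ S)
      (fun a ha b hb c hc d hd => hP a (Finset.sdiff_subset ha) b (Finset.sdiff_subset hb)
        c (Finset.sdiff_subset hc) d (Finset.sdiff_subset hd)) (by
      intro K hKW hKc
      have hKW' := hKW.trans Finset.sdiff_subset
      by_contra! hlt
      refine not_disjoint_of_maximal_stable_of_maximal_clique G W S K hP hSW hS hSdom hKW' hKc
        (Finset.card_pos.mp (by omega)) (fun s hs hsK => ?_)
        (Finset.disjoint_left.mpr fun x hx hxK => (Finset.mem_sdiff.mp (hKW hxK)).2 hx)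
      by_contra! hcon
      have h := hK (insert s K) (Finset.insert_subset (hSW hs) hKW') (by
        rw [Finset.coe_insert, SimpleGraph.isClique_insert]
        exact ⟨hKc, fun v hv _ => hcon v hv⟩)
      rw [Finset.card_insert_of_notMem hsK] at h
      omega)
    have hfc' : ∀ v ∈ W, v ∉ S → f v < k := fun v hv hvS => hf v (Finset.mem_sdiff.mpr ⟨hv, hvS⟩)
    refine ⟨fun v => if v ∈ S then k else f v, fun v hv => ?_, fun u hu v hv huv => ?_⟩
    · by_cases hvS : v ∈ S
      · simp [hvS]
      · have := hfc' v hv hvS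
        simp only [hvS, if_false]
        omega
    · by_cases huS : u ∈ S <;> by_cases hvS : v ∈ S <;> simp only [huS, hvS, if_true, if_false]
      · exact (hS u huS v hvS huv).elim
      · exact (hfc' v hv hvS).ne'
      · exact (hfc' u hu huS).ne
      · exact hfc u (Finset.mem_sdiff.mpr ⟨hu, huS⟩) v (Finset.mem_sdiff.mpr ⟨hv, hvS⟩) huv

/-- An injective map on `Fin n` that respects adjacency of pairs `i < j` is an induced copy. -/
lemma not_isFree_of_forall_lt {V : Type*} {G : SimpleGraph V} {n : ℕ} {H : SimpleGraph (Fin n)}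
    (f : Fin n → V) (hne : ∀ i j, i < j → f i ≠ f j)
    (hadj : ∀ i j, i < j → (G.Adj (f i) (f j) ↔ H.Adj i j)) : ¬ IsFree G H := by
  refine fun h => h.elim ⟨⟨f, fun i j hij => ?_⟩, fun {i j} => ?_⟩
  · rcases lt_trichotomy i j with hlt | heq | hlt
    · exact (hne i j hlt hij).elim
    · exact heq
    · exact (hne j i hlt hij.symm).elim
  · rcases lt_trichotomy i j with hlt | rfl | hlt
    · exact hadj i j hlt
    · simp
    · rw [G.adj_comm, H.adj_comm]
      exact hadj j i hlt

/-- In an `HVN`-free graph, no vertex has exactly two neighbours in a clique on four vertices. -/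
lemma not_adj_exactly_two_of_isFree_HVN {V : Type*} (G : SimpleGraph V) (h : IsFree G HVN)
    {a b c d v : V} (hab : G.Adj a b) (hac : G.Adj a c) (had : G.Adj a d) (hbc : G.Adj b c)
    (hbd : G.Adj b d) (hcd : G.Adj c d) (hva : G.Adj v a) (hvb : G.Adj v b)
    (hvc : ¬ G.Adj v c) (hvd : ¬ G.Adj v d) : False := by
  have hvc' : v ≠ c := by rintro rfl; exact hvd hcd
  have hvd' : v ≠ d := by rintro rfl; exact hvc hcd.symm
  refine not_isFree_of_forall_lt ![a, b, c, d, v] (fun i j hij => ?_) (fun i j hij => ?_) h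
  · have := hab.ne; have := hac.ne; have := had.ne; have := hbc.ne; have := hbd.ne
    have := hcd.ne; have := hva.ne'; have := hvb.ne'; have := hvc'.symm; have := hvd'.symm
    clear h
    fin_cases i <;> fin_cases j <;> first | exact absurd hij (by decide) | assumption
  · rw [G.adj_comm] at hva hvb hvc hvd
    clear h
    fin_cases i <;> fin_cases j <;> first | exact absurd hij (by decide) | simp [HVN, *]

/-- In a `P₂ ∪ P₄`-free graph, no edge is anticomplete to an induced `P₄`. -/
lemma not_anticomplete_of_isFree_P2P4 {V : Type*} (G : SimpleGraph V) (h : IsFree G P2P4)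
    {u v a b c d : V} (huv : G.Adj u v) (hp : IsInducedP4 G a b c d)
    (hu : ∀ x ∈ [a, b, c, d], ¬ G.Adj x u) (hv : ∀ x ∈ [a, b, c, d], ¬ G.Adj x v) : False := by
  obtain ⟨hab, hbc, hcd, hac, had, hbd⟩ := hp
  simp only [List.mem_cons, List.not_mem_nil, or_false, forall_eq_or_imp, forall_eq] at hu hv
  obtain ⟨hau, hbu, hcu, hdu⟩ := hu
  obtain ⟨hav, hbv, hcv, hdv⟩ := hv
  refine not_isFree_of_forall_lt ![u, v, a, b, c, d] (fun i j hij => ?_) (fun i j hij => ?_) h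
  · have hne : ∀ {x y z : V}, G.Adj x z → ¬ G.Adj y z → x ≠ y := by
      rintro x y z hx hy rfl; exact hy hx
    have := huv.ne; have := hab.ne; have := hbc.ne; have := hcd.ne
    have := (hne hcd had).symm; have := hne hab (fun h => hbd h.symm)
    have := hne hab.symm (fun h => had h.symm)
    have := hne huv hav; have := hne huv hbv; have := hne huv hcv; have := hne huv hdv
    have := hne huv.symm hau; have := hne huv.symm hbu
    have := hne huv.symm hcu; have := hne huv.symm hdu
    clear h
    fin_cases i <;> fin_cases j <;> first | exact absurd hij (by decide) | assumption
  · rw [G.adj_comm] at hau hbu hcu hdu hav hbv hcv hdv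
    clear h
    fin_cases i <;> fin_cases j <;> first | exact absurd hij (by decide) | simp [P2P4, *]

/-- Given a maximum-order complete `ω`-partite subgraph of an `HVN`-free graph, every vertex
outside it has neighbours in at most one part. -/
lemma eq_of_adj_of_isMaxCompMultipartite {V : Type*} [Fintype V] (G : SimpleGraph V)
    (h : IsFree G HVN) {w : ℕ} (hw : 4 ≤ w) (hGw : G.cliqueNum = w) (A : Fin w → Finset V)
    (hA : IsMaxCompMultipartite G Set.univ A) {v : V} (hv : ∀ i, v ∉ A i) {i j : Fin w}
    {a b : V} (ha : a ∈ A i) (hb : b ∈ A j) (hva : G.Adj v a) (hvb : G.Adj v b) : i = j := by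
  classical
  obtain ⟨⟨hne, -, hdisj, hst, hadj⟩, hmax⟩ := hA
  by_contra hij
  obtain ⟨p, hp⟩ : ∃ p, ∀ x ∈ A p, ¬ G.Adj v x := by
    by_contra! hcon
    choose g hg hvg using hcon
    have hginj : Function.Injective g := fun x y hxy => by
      by_contra hne'
      exact Finset.disjoint_left.mp (hdisj x y hne') (hg x) (hxy ▸ hg y)
    have hcl : G.IsClique (insert v (Finset.univ.image g) : Finset V) := by
      rw [Finset.coe_insert, SimpleGraph.isClique_insert]
      refine ⟨?_, ?_⟩
      · intro x hx y hy hxy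
        simp only [Finset.coe_image, Finset.coe_univ, Set.image_univ, Set.mem_range] at hx hy
        obtain ⟨x, rfl⟩ := hx
        obtain ⟨y, rfl⟩ := hy
        exact hadj x y (fun e => hxy (e ▸ rfl)) _ (hg x) _ (hg y)
      · simpa using fun x _ => hvg x
    have hcard := hcl.card_le_cliqueNum
    rw [Finset.card_insert_of_notMem, Finset.card_image_of_injective _ hginj, hGw,
      Finset.card_univ, Fintype.card_fin] at hcard
    · omega
    · simp only [Finset.mem_image, Finset.mem_univ, true_and, not_exists]
      rintro x rfl
      exact hv x (hg x)
  have key : ∀ {i j q : Fin w} {a b c : V}, a ∈ A i → b ∈ A j → c ∈ A q → G.Adj v a →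
      G.Adj v b → i ≠ j → q ≠ i → q ≠ j → q ≠ p → G.Adj v c := by
    intro i j q a b c ha hb hc hva hvb hij hqi hqj hqp
    obtain ⟨d, hd⟩ := hne p
    have hip : i ≠ p := by rintro rfl; exact hp a ha hva
    have hjp : j ≠ p := by rintro rfl; exact hp b hb hvb
    by_contra hvc
    exact not_adj_exactly_two_of_isFree_HVN G h (hadj i j hij a ha b hb)
      (hadj i q hqi.symm a ha c hc) (hadj i p hip a ha d hd) (hadj j q hqj.symm b hb c hc)
      (hadj j p hjp b hb d hd) (hadj q p hqp c hc d hd) hva hvb hvc (hp d hd)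
  obtain ⟨q, hq⟩ : ∃ q, q ∉ ({i, j, p} : Finset (Fin w)) := by
    by_contra! hcon
    have h3 := (Finset.card_le_card (fun x _ => hcon x : Finset.univ ⊆ _)).trans
      Finset.card_le_three
    rw [Finset.card_univ, Fintype.card_fin] at h3
    omega
  simp only [Finset.mem_insert, Finset.mem_singleton, not_or] at hq
  obtain ⟨hqi, hqj, hqp⟩ := hq
  obtain ⟨c, hc⟩ := hne q
  have hvc := key ha hb hc hva hvb hij hqi hqj hqp
  have hall : ∀ r, r ≠ p → ∀ x ∈ A r, G.Adj v x := by
    intro r hrp x hx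
    by_cases hri : r = i
    · subst hri
      exact key hb hc hx hvb hvc (Ne.symm hqj) hij (Ne.symm hqi) hrp
    by_cases hrj : r = j
    · subst hrj
      exact key ha hc hx hva hvc (Ne.symm hqi) hri (Ne.symm hqj) hrp
    exact key ha hb hx hva hvb hij hri hrj hrp
  have hlt := hmax (Function.update A p (insert v (A p))) (by
    have hmem : ∀ {r x}, x ∈ Function.update A p (insert v (A p)) r →
        x ∈ A r ∨ r = p ∧ x = v := by
      intro r x hx
      by_cases hr : r = p
      · subst hr
        rw [Function.update_self, Finset.mem_insert] at hx
        tauto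
      · rw [Function.update_of_ne hr] at hx
        exact Or.inl hx
    have hadj' : ∀ r s, r ≠ s → ∀ x ∈ Function.update A p (insert v (A p)) r,
        ∀ y ∈ Function.update A p (insert v (A p)) s, G.Adj x y := by
      intro r s hrs x hx y hy
      rcases hmem hx with hxA | ⟨rfl, rfl⟩ <;> rcases hmem hy with hyA | ⟨rfl, rfl⟩
      · exact hadj r s hrs x hxA y hyA
      · exact (hall r hrs x hxA).symm
      · exact hall s hrs.symm y hyA
      · exact (hrs rfl).elim
    refine ⟨fun r => ?_, fun _ => Set.subset_univ _, fun r s hrs => ?_, ?_, hadj'⟩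
    · by_cases hr : r = p
      · subst hr; simp
      · rw [Function.update_of_ne hr]; exact hne r
    · exact Finset.disjoint_left.mpr fun x hx hy => (hadj' r s hrs x hx x hy).ne rfl
    · intro r x hx y hy hxy
      rcases hmem hx with hxA | ⟨rfl, rfl⟩ <;> rcases hmem hy with hyA | ⟨hr, rfl⟩
      · exact hst r x hxA y hyA hxy
      · exact hp x (hr ▸ hxA) hxy.symm
      · exact hp y hyA hxy
      · exact hxy.ne rfl)
  refine absurd hlt (not_le.mpr (Finset.sum_lt_sum (fun r _ => ?_) ⟨p, Finset.mem_univ _, ?_⟩))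
  · by_cases hr : r = p
    · subst hr
      rw [Function.update_self]
      exact Finset.card_le_card (Finset.subset_insert _ _)
    · rw [Function.update_of_ne hr]
  · rw [Function.update_self, Finset.card_insert_of_notMem (hv p)]
    omega

/-- Let `G` be a `(P₂ ∪ P₄, HVN)`-free graph with `ω(G) = ω ≥ 4`, let `A` be an
induced complete `ω`-partite subgraph of `G` of maximum order, let `H` be the
subgraph of `G` induced on `V(G) ∖ V(A)`, and let `k = ω(H)`.  Then
`χ(G) ≤ max{2k, ω}`. -/
theorem chromatic_le_max_two_k_omega {V : Type*} [Fintype V] (G : SimpleGraph V)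
    (h1 : IsFree G P2P4) (h2 : IsFree G HVN)
    (w : ℕ) (hw : 4 ≤ w) (hGw : G.cliqueNum = w)
    (A : Fin w → Finset V) (hA : IsMaxCompMultipartite G Set.univ A)
    (k : ℕ) (hk : (G.induce (⋃ i, (↑(A i) : Set V))ᶜ).cliqueNum = k) :
    G.chromaticNumber ≤ (max (2 * k) w : ℕ) := by
  classical
  have hone := fun {v} (hv : ∀ i, v ∉ A i) {i j} {a b} =>
    eq_of_adj_of_isMaxCompMultipartite G h2 hw hGw A hA hv (i := i) (j := j) (a := a) (b := b)
  obtain ⟨⟨hne, -, hdisj, hst, hadj⟩, -⟩ := hA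
  let W : ℕ → Finset V := fun e => Finset.univ.filter fun v =>
    (∀ i, v ∉ A i) ∧ ∀ i : Fin w, ∀ a ∈ A i, G.Adj v a → (i : ℕ) % 2 = e
  have hW : ∀ {e v}, v ∈ W e ↔ (∀ i, v ∉ A i) ∧
      ∀ i : Fin w, ∀ a ∈ A i, G.Adj v a → (i : ℕ) % 2 = e := by simp [W]
  have hcol : ∀ e, ∃ f : V → ℕ, (∀ v ∈ W e, f v < k) ∧
      ∀ u ∈ W e, ∀ v ∈ W e, G.Adj u v → f u ≠ f v := by
    intro e
    refine exists_coloring_of_no_inducedP4 G k (W e) ?_ ?_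
    · intro a ha b hb c hc d hd hp
      -- two parts whose indices have the parity different from `e`
      obtain ⟨i, j, hij, hi, hj⟩ : ∃ i j : Fin w, i ≠ j ∧ (i : ℕ) % 2 ≠ e ∧ (j : ℕ) % 2 ≠ e := by
        by_cases he : e = 0
        · exact ⟨⟨1, by omega⟩, ⟨3, by omega⟩, by simp, by simp [he], by simp [he]⟩
        · exact ⟨⟨0, by omega⟩, ⟨2, by omega⟩, by simp, by simpa using Ne.symm he,
            by simpa using Ne.symm he⟩
      obtain ⟨x, hx⟩ := hne i
      obtain ⟨y, hy⟩ := hne j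
      have hanti : ∀ z ∈ [a, b, c, d], ∀ (r : Fin w), (r : ℕ) % 2 ≠ e → ∀ t ∈ A r,
          ¬ G.Adj z t := by
        intro z hz r hr t ht hzt
        have hzW : z ∈ W e := by
          simp only [List.mem_cons, List.not_mem_nil, or_false] at hz
          rcases hz with rfl | rfl | rfl | rfl <;> assumption
        exact hr ((hW.mp hzW).2 r t ht hzt)
      exact not_anticomplete_of_isFree_P2P4 G h1 (hadj i j hij x hx y hy) hp
        (fun z hz => hanti z hz i hi x hx) (fun z hz => hanti z hz j hj y hy)
    · intro K hKW hK
      set U : Set V := (⋃ i, (↑(A i) : Set V))ᶜ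
      have hKU : ∀ x ∈ K, x ∈ U := fun x hx => by simpa [U] using (hW.mp (hKW hx)).1
      have hcl : (G.induce U).IsClique (K.subtype (· ∈ U) : Finset U) := by
        intro x hx y hy hxy
        exact hK (by simpa using hx) (by simpa using hy) (fun e => hxy (Subtype.ext e))
      have hle := hcl.card_le_cliqueNum
      rwa [hk, Finset.card_subtype, Finset.filter_true_of_mem hKU] at hle
  choose f hf hfc using hcol
  have hcover : ∀ v, (∀ i, v ∉ A i) → v ∉ W 0 → v ∈ W 1 := by
    intro v hv hv0
    rw [hW] at hv0 ⊢
    push Not at hv0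
    obtain ⟨i, a, ha, hva, hi⟩ := hv0 hv
    refine ⟨hv, fun j b hb hvb => ?_⟩
    have := hone hv ha hb hva hvb
    subst this
    omega
  let g : V → ℕ := fun v => if h : ∃ i, v ∈ A i then (h.choose : ℕ) else
    if v ∈ W 0 then 2 * f 0 v + 1 else 2 * f 1 v
  have hgA : ∀ {i v}, v ∈ A i → g v = (i : ℕ) := by
    intro i v hv
    have h : ∃ i, v ∈ A i := ⟨i, hv⟩
    have hi : h.choose = i := by
      by_contra hne'
      exact Finset.disjoint_left.mp (hdisj _ _ hne') h.choose_spec hv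
    simp only [g, dif_pos h, hi]
  have hg : ∀ v, (∀ i, v ∉ A i) →
      (v ∈ W 0 ∧ g v = 2 * f 0 v + 1) ∨ (v ∈ W 1 ∧ g v = 2 * f 1 v) := by
    intro v hv
    have h : ¬ ∃ i, v ∈ A i := by simpa using hv
    by_cases hv0 : v ∈ W 0
    · exact Or.inl ⟨hv0, by simp only [g, dif_neg h, if_pos hv0]⟩
    · exact Or.inr ⟨hcover v hv hv0, by simp only [g, dif_neg h, if_neg hv0]⟩
  have hmixed : ∀ {i u v}, u ∈ A i → (∀ i, v ∉ A i) → G.Adj v u → g u ≠ g v := by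
    intro i u v hu hv hvu
    rw [hgA hu]
    rcases hg v hv with ⟨hvW, hgv⟩ | ⟨hvW, hgv⟩ <;>
    · have := (hW.mp hvW).2 i u hu hvu
      omega
  have hproper : ∀ u v, G.Adj u v → g u ≠ g v := by
    intro u v huv
    by_cases hu : ∃ i, u ∈ A i <;> by_cases hv : ∃ i, v ∈ A i
    · obtain ⟨i, hu⟩ := hu
      obtain ⟨j, hv⟩ := hv
      rw [hgA hu, hgA hv]
      intro hij
      rw [Fin.ext hij] at hu
      exact hst j u hu v hv huv
    · obtain ⟨i, hu⟩ := hu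
      exact hmixed hu (not_exists.mp hv) huv.symm
    · obtain ⟨j, hv⟩ := hv
      exact (hmixed hv (not_exists.mp hu) huv).symm
    · rcases hg u (not_exists.mp hu) with ⟨huW, hgu⟩ | ⟨huW, hgu⟩ <;>
        rcases hg v (not_exists.mp hv) with ⟨hvW, hgv⟩ | ⟨hvW, hgv⟩
      · have := hfc 0 u huW v hvW huv
        omega
      · omega
      · omega
      · have := hfc 1 u huW v hvW huv
        omega
  have hbound : ∀ v, g v < max (2 * k) w := by
    intro v
    by_cases hv : ∃ i, v ∈ A i
    · obtain ⟨i, hv⟩ := hv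
      rw [hgA hv]
      exact lt_max_of_lt_right i.isLt
    · refine lt_max_of_lt_left ?_
      rcases hg v (not_exists.mp hv) with ⟨hvW, hgv⟩ | ⟨hvW, hgv⟩
      · have := hf 0 v hvW
        omega
      · have := hf 1 v hvW
        omega
  have hC : G.Colorable (max (2 * k) w) :=
    ⟨SimpleGraph.Coloring.mk (fun v => (⟨g v, hbound v⟩ : Fin (max (2 * k) w)))
      fun {u v} huv h => hproper u v huv (congrArg Fin.val h)⟩
  exact hC.chromaticNumber_le
end
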